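/- arXiv:1902.08791 — 4 statements merged into one kernel-verified Lean document; each statement's English description precedes it below -/
import Mathlib

section
/- Let t: Aⁿ → A be idempotent and compatible with a digraph G on A. Suppose G is strongly connected and contains directed closed walks of every length ≥ 2, and suppose there are vertices α_{i,j} (for i,j ∈ {0,…,n−1}) such that for every i there is an edge α_{i,i} → t(α_{i,0}, α_{i,1}, …, α_{i,n−1}) in G. Then G contains a loop, i.e., a vertex a with an edge a → a. -/
/-- There is a directed walk of length `k` from `u` to `v` in the digraph with edge relation `E`. -/
def HasWalk {A : Type*} (E : A → A → Prop) (u v : A) (k : ℕ) : Prop :=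
  ∃ w : ℕ → A, w 0 = u ∧ w k = v ∧ ∀ i < k, E (w i) (w (i + 1))

namespace LLL

/-- Concatenation of walks. -/
theorem walk_append {A : Type*} {E : A → A → Prop} {u v w : A} {k l : ℕ}
    (h1 : HasWalk E u v k) (h2 : HasWalk E v w l) : HasWalk E u w (k + l) := by
  obtain ⟨f, f0, fk, hf⟩ := h1
  obtain ⟨g, g0, gl, hg⟩ := h2
  refine ⟨fun i => if i < k then f i else g (i - k), ?_, ?_, ?_⟩
  · by_cases h : 0 < k
    · simp [h, f0]
    · have : k = 0 := by omega
      subst this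
      simp [g0, ← fk, f0]
  · simp [gl]
  · intro i hi
    by_cases h : i + 1 < k
    · have h' : i < k := by omega
      simp only [h, h', if_true]
      exact hf i h'
    · by_cases h' : i < k
      · have h2 : i + 1 = k := by omega
        simp only [h, h', if_true, if_false]
        have := hf i h'
        rw [h2, fk] at this
        simpa [h2, g0] using this
      · simp only [h, h', if_false]
        have := hg (i - k) (by omega)
        rwa [show i + 1 - k = i - k + 1 by omega]

theorem walk_refl {A : Type*} {E : A → A → Prop} (u : A) : HasWalk E u u 0 :=
  ⟨fun _ => u, rfl, rfl, fun i hi => absurd hi (by omega)⟩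

theorem walk_mul {A : Type*} {E : A → A → Prop} {u : A} {k : ℕ}
    (h1 : HasWalk E u u k) (m : ℕ) : HasWalk E u u (m * k) := by
  induction m with
  | zero => simpa using walk_refl u
  | succ m ih => rw [Nat.succ_mul]; exact walk_append ih h1

theorem walk_eventually {A : Type*} {E : A → A → Prop}
    (hsc : ∀ u v : A, ∃ k, HasWalk E u v k)
    (hcyc : ∀ k : ℕ, 2 ≤ k → ∃ u : A, HasWalk E u u k) (a b : A) :
    ∀ᶠ k in Filter.atTop, HasWalk E a b k := by
  obtain ⟨p, hp⟩ := hcyc 2 le_rfl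
  obtain ⟨q, hq⟩ := hcyc 3 (by omega)
  obtain ⟨k1, h1⟩ := hsc a p
  obtain ⟨k2, h2⟩ := hsc p q
  obtain ⟨k3, h3⟩ := hsc q b
  rw [Filter.eventually_atTop]
  refine ⟨k1 + k2 + k3 + 3, fun k hk => ?_⟩
  obtain ⟨m, m', hm⟩ : ∃ m m' : ℕ, k = k1 + m * 2 + k2 + m' * 3 + k3 := by
    rcases Nat.even_or_odd' (k - (k1 + k2 + k3)) with ⟨c, hc | hc⟩
    · exact ⟨c, 0, by omega⟩
    · exact ⟨c - 1, 1, by omega⟩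
  rw [hm]
  exact walk_append (walk_append (walk_append (walk_append h1 (walk_mul hp m)) h2)
    (walk_mul hq m')) h3

/-- Base points of cycles, and a uniform bound for walk lengths. -/
theorem base_points {A : Type*} {E : A → A → Prop} {n : ℕ}
    (hsc : ∀ u v : A, ∃ k, HasWalk E u v k)
    (hcyc : ∀ k : ℕ, 2 ≤ k → ∃ u : A, HasWalk E u u k) (α : Fin n → Fin n → A) :
    ∃ (cv : ℕ → A) (N : ℕ), 2 ≤ N ∧ (∀ d, 2 ≤ d → HasWalk E (cv d) (cv d) d) ∧
      ∀ a b, a ∈ Set.range cv ∪ Set.range (Function.uncurry α) →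
        b ∈ Set.range cv ∪ Set.range (Function.uncurry α) →
        ∀ k, N ≤ k → HasWalk E a b k := by
  classical
  obtain ⟨c, -⟩ := hcyc 2 le_rfl
  obtain ⟨N0, hN0⟩ := Filter.eventually_atTop.1 (walk_eventually hsc hcyc c c)
  choose f hf using hcyc
  let cv : ℕ → A := fun d => if h : 2 ≤ d ∧ d < N0 then f d h.1 else c
  have hfin : (Set.range cv).Finite := by
    apply ((Set.finite_lt_nat N0).image cv |>.union (Set.finite_singleton c)).subset
    rintro _ ⟨d, rfl⟩
    by_cases h : d < N0
    · left; exact ⟨d, h, rfl⟩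
    · right; simp [cv, h]
  have hF := hfin.union (Set.finite_range (Function.uncurry α))
  have hev : ∀ᶠ k in Filter.atTop, ∀ a ∈ Set.range cv ∪ Set.range (Function.uncurry α),
      ∀ b ∈ Set.range cv ∪ Set.range (Function.uncurry α), HasWalk E a b k := by
    rw [Filter.eventually_all_finite hF]
    intro a _
    rw [Filter.eventually_all_finite hF]
    intro b _
    exact walk_eventually hsc (fun k hk => ⟨f k hk, hf k hk⟩) a b
  obtain ⟨N1, hN1⟩ := Filter.eventually_atTop.1 hev
  refine ⟨cv, N1 + 2, by omega, ?_, ?_⟩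
  · intro d hd
    by_cases h : d < N0
    · simp only [cv, hd, h, and_self, dif_pos]; exact hf d hd
    · simp only [cv, h, and_false, dif_neg, not_false_eq_true]; exact hN0 d (by omega)
  · intro a b ha hb k hk
    exact hN1 k (by omega) a ha b hb

variable {n : ℕ}

/-- Shift of a two-sided sequence. -/
def sg (k : ℤ) (s : ℤ → Fin n) : ℤ → Fin n := fun z => s (z + k)

theorem sg_sg (a b : ℤ) (s : ℤ → Fin n) : sg a (sg b s) = sg (a + b) s := by
  funext z; simp [sg, add_assoc]

theorem sg_zero (s : ℤ → Fin n) : sg 0 s = s := by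
  funext z; simp [sg]

/-- End of a constant run. -/
def AE (N : ℕ) (s : ℤ → Fin n) : Prop :=
  (∀ k : ℤ, 0 ≤ k → k < 2 * N → s k = s 0) ∧ s (2 * N) ≠ s 0

/-- Start of a constant run. -/
def AS (N : ℕ) (s : ℤ → Fin n) : Prop :=
  s (-1) ≠ s 0 ∧ ∀ k : ℤ, 0 ≤ k → k < 3 * N → s k = s 0

def Pr (N : ℕ) (s : ℤ → Fin n) : Prop := AE N s ∨ AS N s

def Cn (N : ℕ) (s : ℤ → Fin n) : Prop := ∀ k : ℤ, 0 ≤ k → k < 2 * N → s k = s 0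

/-- Numerical key of the word of length `2 N` at the origin. -/
noncomputable def key (N : ℕ) (s : ℤ → Fin n) : ℕ :=
  (Fintype.equivFin (Fin (2 * N) → Fin n) (fun k => s (k : ℕ))).val

def cardK (n N : ℕ) : ℕ := Fintype.card (Fin (2 * N) → Fin n)

theorem key_lt (N : ℕ) (s : ℤ → Fin n) : key N s < cardK n N := Fin.isLt _

theorem key_eq_iff (N : ℕ) (s s' : ℤ → Fin n) :
    key N s = key N s' ↔ ∀ k : ℤ, 0 ≤ k → k < 2 * N → s k = s' k := by
  unfold key
  rw [Fin.val_inj, Equiv.apply_eq_iff_eq, funext_iff]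
  constructor
  · intro h k h0 h1
    have := h ⟨k.toNat, by omega⟩
    simpa [Int.toNat_of_nonneg h0] using this
  · intro h k
    exact h _ (by omega) (by have := k.2; omega)

/-- Local maxima of the key. -/
def CM (N : ℕ) (s : ℤ → Fin n) : Prop :=
  ¬ Cn N s ∧ ∀ y : ℤ, -N ≤ y → y ≤ N → ¬ Pr N (sg y s) ∧ key N (sg y s) ≤ key N s

def M0 (N : ℕ) (s : ℤ → Fin n) : Prop := Pr N s ∨ CM N s

def AA (N B : ℕ) (s : ℤ → Fin n) : Prop := ∀ k : ℤ, -B ≤ k → k ≤ 2 * N → s k = s 0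

def M1 (N B : ℕ) (s : ℤ → Fin n) : Prop := M0 N s ∨ AA N B s

noncomputable def dmin (N : ℕ) (s : ℤ → Fin n) : ℕ :=
  sInf {d : ℕ | 1 ≤ d ∧ d ≤ N ∧ (CM N (sg d s) ∨ CM N (sg (-d) s))}

open Classical in
noncomputable def lab {A : Type*} (cv : ℕ → A) (α : Fin n → Fin n → A) (N : ℕ)
    (s : ℤ → Fin n) : A :=
  if AS N s then cv 0 else if CM N s then cv (dmin N s) else α (s 0) (s (2 * N))

theorem lab_mem {A : Type*} (cv : ℕ → A) (α : Fin n → Fin n → A) (N : ℕ)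
    (s : ℤ → Fin n) : lab cv α N s ∈ Set.range cv ∪ Set.range (Function.uncurry α) := by
  unfold lab
  split_ifs
  · left; exact ⟨_, rfl⟩
  · left; exact ⟨_, rfl⟩
  · right; exact ⟨(_, _), rfl⟩

/-- A word that repeats the key of a marker between two close markers is a marker. -/
theorem CM_between {N : ℕ} {s : ℤ → Fin n} {d q : ℤ} (h0 : CM N s) (hq : CM N (sg q s))
    (hd0 : 0 ≤ d) (hdq : d ≤ q) (hqN : q ≤ N)
    (hk : ∀ k : ℤ, 0 ≤ k → k < 2 * N → s (k + d) = s k) : CM N (sg d s) := by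
  have hkey : key N (sg d s) = key N s := (key_eq_iff _ _ _).2 hk
  have hkq : key N (sg q s) = key N s := by
    apply le_antisymm
    · exact (h0.2 q (by omega) hqN).2
    · have := (hq.2 (-q) (by omega) (by omega)).2
      rwa [sg_sg, neg_add_cancel, sg_zero] at this
  refine ⟨?_, ?_⟩
  · intro hc
    apply h0.1
    intro k k0 k1
    rw [← hk k k0 k1, ← hk 0 le_rfl (by omega)]
    exact hc k k0 k1
  · intro y y0 y1
    rw [sg_sg, hkey]
    by_cases h : y + d ≤ N
    · exact h0.2 _ (by omega) h
    · have := hq.2 (y + d - q) (by omega) (by omega)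
      rw [sg_sg, hkq] at this
      simpa using this

theorem CM_key_eq {N : ℕ} {s : ℤ → Fin n} {q : ℤ} (h0 : CM N s) (hq : CM N (sg q s))
    (hq0 : 0 ≤ q) (hqN : q ≤ N) : ∀ k : ℤ, 0 ≤ k → k < 2 * N → s (k + q) = s k := by
  have hkq : key N (sg q s) = key N s := by
    apply le_antisymm
    · exact (h0.2 q (by omega) hqN).2
    · have := (hq.2 (-q) (by omega) (by omega)).2
      rwa [sg_sg, neg_add_cancel, sg_zero] at this
  exact (key_eq_iff _ _ _).1 hkq

/-- Consecutive short gaps are equal. -/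
theorem gap_eq {N : ℕ} {s : ℤ → Fin n} {p q : ℤ} (h0 : CM N s) (hq : CM N (sg q s))
    (hp : CM N (sg (-p) s)) (hp1 : 1 ≤ p) (hpN : p ≤ N) (hq1 : 1 ≤ q) (hqN : q ≤ N)
    (hnq : ∀ d : ℤ, 0 < d → d < q → ¬ CM N (sg d s))
    (hnp : ∀ d : ℤ, 0 < d → d < p → ¬ CM N (sg (-d) s)) : p = q := by
  have kq := CM_key_eq h0 hq (by omega) hqN
  have h0' : CM N (sg p (sg (-p) s)) := by rwa [sg_sg, add_neg_cancel, sg_zero]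
  have kp' := CM_key_eq hp h0' (by omega) hpN
  have kp : ∀ k : ℤ, 0 ≤ k → k < 2 * N → s k = s (k - p) := by
    intro k k0 k1
    have := kp' k k0 k1
    simp only [sg] at this
    rw [add_neg_cancel_right] at this
    rw [this, sub_eq_add_neg]
  rcases lt_trichotomy p q with h | h | h
  · exfalso
    apply hnq (q - p) (by omega) (by omega)
    apply CM_between h0 hq (by omega) (by omega) hqN
    intro k k0 k1
    by_cases hk : p ≤ k
    · have e1 := kq (k - p) (by omega) (by omega)
      rw [kp k k0 k1, ← e1]; congr 1; ring
    · have e1 := kp (k + q) (by omega) (by omega)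
      rw [← kq k k0 k1, e1]; congr 1; ring
  · exact h
  · exfalso
    apply hnp (p - q) (by omega) (by omega)
    have := CM_between (d := q) hp h0' (by omega) (by omega) hpN ?_
    · rw [sg_sg] at this
      convert this using 2
      ring
    · intro k k0 k1
      simp only [sg]
      by_cases hk : k + q < 2 * N
      · have e1 := kp (k + q) (by omega) (by omega)
        have e2 := kp k (by omega) (by omega)
        rw [← sub_eq_add_neg, ← e1, kq k k0 k1, e2, sub_eq_add_neg]
      · have e1 := kq (k - p) (by omega) (by omega)
        rw [← sub_eq_add_neg k, ← e1]; congr 1; ring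

end LLL

namespace LLL

variable {n : ℕ}

theorem CM_Cn {N : ℕ} {s : ℤ → Fin n} (h : CM N s) : ¬ Cn N s := h.1

theorem CM_Pr {N : ℕ} {s : ℤ → Fin n} (h : CM N s) : ¬ Pr N s := by
  have := (h.2 0 (by omega) (by omega)).1
  rwa [sg_zero] at this

theorem lab_CM {A : Type*} (cv : ℕ → A) (α : Fin n → Fin n → A) {N : ℕ}
    {s : ℤ → Fin n} (h : CM N s) : lab cv α N s = cv (dmin N s) := by
  have : ¬ AS N s := fun h' => CM_Pr h (Or.inr h')
  simp [lab, h, this]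

theorem lab_AS {A : Type*} (cv : ℕ → A) (α : Fin n → Fin n → A) {N : ℕ}
    {s : ℤ → Fin n} (h : AS N s) : lab cv α N s = cv 0 := by
  simp [lab, h]

theorem lab_AA {A : Type*} (cv : ℕ → A) (α : Fin n → Fin n → A) {N B : ℕ} (hB : 1 ≤ B)
    {s : ℤ → Fin n} (h : AA N B s) : lab cv α N s = α (s 0) (s (2 * N)) := by
  have h1 : ¬ AS N s := fun h' => h'.1 (h _ (by omega) (by omega))
  have h2 : ¬ CM N s := fun h' => h'.1 (fun k k0 k1 => h _ (by omega) (by omega))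
  simp [lab, h1, h2]

theorem lab_AE {A : Type*} (cv : ℕ → A) (α : Fin n → Fin n → A) {N : ℕ} (hN : 1 ≤ N)
    {s : ℤ → Fin n} (h : AE N s) : lab cv α N s = α (s 0) (s (2 * N)) := by
  have h1 : ¬ AS N s := fun h' => h.2 (h'.2 _ (by omega) (by omega))
  have h2 : ¬ CM N s := fun h' => h'.1 h.1
  simp [lab, h1, h2]

theorem dmin_spec {N : ℕ} {s : ℤ → Fin n} {g : ℕ} (h1 : 1 ≤ g) (h2 : g ≤ N)
    (h : CM N (sg g s) ∨ CM N (sg (-g) s)) :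
    1 ≤ dmin N s ∧ dmin N s ≤ g ∧
      (CM N (sg (dmin N s) s) ∨ CM N (sg (-(dmin N s : ℤ)) s)) ∧
      ∀ d : ℤ, 0 < d → d < dmin N s → ¬ CM N (sg d s) ∧ ¬ CM N (sg (-d) s) := by
  have hne : ({d : ℕ | 1 ≤ d ∧ d ≤ N ∧ (CM N (sg d s) ∨ CM N (sg (-d) s))} : Set ℕ).Nonempty :=
    ⟨g, h1, h2, h⟩
  have hm : dmin N s ∈ {d : ℕ | 1 ≤ d ∧ d ≤ N ∧ (CM N (sg d s) ∨ CM N (sg (-d) s))} :=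
    Nat.sInf_mem hne
  have hle : dmin N s ≤ g := Nat.sInf_le ⟨h1, h2, h⟩
  refine ⟨hm.1, hle, hm.2.2, ?_⟩
  intro d d0 d1
  have hnot : d.toNat ∉ {d : ℕ | 1 ≤ d ∧ d ≤ N ∧ (CM N (sg d s) ∨ CM N (sg (-d) s))} :=
    Nat.notMem_of_lt_sInf (by change d.toNat < dmin N s; omega)
  have hd : (d.toNat : ℤ) = d := Int.toNat_of_nonneg (by omega)
  simp only [Set.mem_ofPred_eq, hd] at hnot
  constructor
  · intro hc; exact hnot ⟨by omega, by omega, Or.inl hc⟩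
  · intro hc; exact hnot ⟨by omega, by omega, Or.inr hc⟩

/-- Walks between consecutive markers. -/
theorem gap_walk {A : Type*} {E : A → A → Prop} {cv : ℕ → A} {α : Fin n → Fin n → A} {N B : ℕ}
    (hcv : ∀ d, 2 ≤ d → HasWalk E (cv d) (cv d) d)
    (hw : ∀ a b, a ∈ Set.range cv ∪ Set.range (Function.uncurry α) →
        b ∈ Set.range cv ∪ Set.range (Function.uncurry α) →
        ∀ k, N ≤ k → HasWalk E a b k) (hNB : N ≤ B)
    {s : ℤ → Fin n} {g : ℕ} (h0 : M0 N s) (hg : M1 N B (sg g s)) (g1 : 1 ≤ g)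
    (hno : ∀ d : ℤ, 0 < d → d < g → ¬ M0 N (sg d s)) :
    HasWalk E (lab cv α N s) (lab cv α N (sg g s)) g := by
  by_cases hgN : N ≤ g
  · exact hw _ _ (lab_mem _ _ _ _) (lab_mem _ _ _ _) _ hgN
  have back : sg (-(g : ℤ)) (sg g s) = s := by rw [sg_sg, neg_add_cancel, sg_zero]
  rcases h0 with (h0 | h0) | h0
  · exfalso
    have e1 := h0.1 g (by omega) (by omega)
    rcases hg with ((h | h) | h) | h
    · apply h0.2
      have := h.1 (2 * N - g) (by omega) (by omega)
      simp only [sg, zero_add, sub_add_cancel] at this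
      rw [this, e1]
    · apply h.1
      simp only [sg, zero_add]
      rw [e1, h0.1 _ (by omega) (by omega)]
    · have := (h.2 (-g) (by omega) (by omega)).1
      rw [back] at this
      exact this (Or.inl h0)
    · apply h0.2
      have := h (2 * N - g) (by omega) (by omega)
      simp only [sg, zero_add, sub_add_cancel] at this
      rw [this, e1]
  · exfalso
    have e1 := h0.2 g (by omega) (by omega)
    rcases hg with ((h | h) | h) | h
    · apply h.2
      simp only [sg, zero_add]
      rw [e1, h0.2 _ (by omega) (by omega)]
    · apply h.1
      simp only [sg, zero_add]
      rw [e1, h0.2 _ (by omega) (by omega)]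
    · have := (h.2 (-g) (by omega) (by omega)).1
      rw [back] at this
      exact this (Or.inr h0)
    · apply h0.1
      have := h (-1 - g) (by omega) (by omega)
      simp only [sg, zero_add, sub_add_cancel] at this
      rw [this, e1]
  · rcases hg with (h | h) | h
    · exact absurd h (h0.2 g (by omega) (by omega)).1
    · have hke := CM_key_eq h0 h (by omega) (by omega)
      have g2 : 2 ≤ g := by
        by_contra hlt
        have hg1 : g = 1 := by omega
        subst hg1
        apply h0.1
        have : ∀ k : ℕ, k < 2 * N → s k = s 0 := by
          intro k
          induction k with
          | zero => intro _; rfl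
          | succ k ih =>
            intro hk
            rw [← ih (by omega)]
            have := hke k (by omega) (by omega)
            simpa using this
        intro k k0 k1
        have := this k.toNat (by omega)
        rwa [Int.toNat_of_nonneg k0] at this
      have h' : CM N (sg (-(g : ℤ)) (sg g s)) := by rwa [back]
      have d1 : dmin N s = g := by
        obtain ⟨a1, a2, a3, a4⟩ := dmin_spec (N := N) (s := s) g1 (by omega) (Or.inl h)
        by_contra hne
        have hlt : dmin N s < g := by omega
        have hn : ¬ CM N (sg (dmin N s) s) := fun hc =>
          hno _ (by omega) (by omega) (Or.inr hc)
        have hp := a3.resolve_left hn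
        have := gap_eq h0 h hp (by omega) (by omega) (by omega) (by omega)
          (fun d d0 d1 hc => hno d d0 d1 (Or.inr hc)) (fun d d0 d1 => (a4 d d0 d1).2)
        omega
      have d2 : dmin N (sg g s) = g := by
        obtain ⟨a1, a2, a3, a4⟩ := dmin_spec (N := N) (s := sg g s) g1 (by omega) (Or.inr h')
        by_contra hne
        have hlt : dmin N (sg g s) < g := by omega
        have hno' : ∀ d : ℤ, 0 < d → d < g → ¬ CM N (sg (-d) (sg g s)) := by
          intro d d0 d1 hc
          rw [sg_sg] at hc
          exact hno _ (by omega) (by omega) (Or.inr hc)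
        have hn := hno' (dmin N (sg g s)) (by omega) (by omega)
        have hp := a3.resolve_right hn
        have := gap_eq h hp h' (by omega) (by omega) (by omega) (by omega)
          (fun d d0 d1 => (a4 d d0 d1).1) hno'
        omega
      rw [lab_CM cv α h0, lab_CM cv α h, d1, d2]
      exact hcv g g2
    · exfalso
      apply h0.1
      have e1 := h (0 - g) (by omega) (by omega)
      intro k k0 k1
      have := h (k - g) (by omega) (by omega)
      simp only [sg, sub_add_cancel] at this e1
      rw [this, e1]

theorem chain (N : ℕ) : ∀ (m : ℕ) (s : ℤ → Fin n), cardK n N ≤ key N s + m →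
    ∃ y : ℤ, -((m + 1) * N : ℕ) ≤ y ∧ y ≤ ((m + 1) * N : ℕ) ∧
      (M0 N (sg y s) ∨ Cn N (sg y s)) := by
  intro m
  induction m with
  | zero => intro s h; have := key_lt N s; omega
  | succ m ih =>
    intro s h
    have hexp : (m + 1 + 1) * N = (m + 1) * N + N := by ring
    by_cases hc : Cn N s
    · exact ⟨0, by omega, by omega, Or.inr (by rwa [sg_zero])⟩
    by_cases hm : CM N s
    · exact ⟨0, by omega, by omega, Or.inl (Or.inr (by rwa [sg_zero]))⟩
    have : ∃ y : ℤ, -N ≤ y ∧ y ≤ N ∧ (Pr N (sg y s) ∨ key N s < key N (sg y s)) := by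
      by_contra hcon
      push Not at hcon
      exact hm ⟨hc, fun y y0 y1 => hcon y y0 y1⟩
    obtain ⟨y, y0, y1, hy | hy⟩ := this
    · refine ⟨y, ?_, ?_, Or.inl (Or.inl hy)⟩
      · have : 0 ≤ (m + 1) * N := by positivity
        omega
      · omega
    · obtain ⟨z, z0, z1, hz⟩ := ih (sg y s) (by omega)
      rw [sg_sg] at hz
      exact ⟨z + y, by omega, by omega, hz⟩

theorem chain' (N : ℕ) (s : ℤ → Fin n) :
    ∃ y : ℤ, -((cardK n N + 1) * N : ℕ) ≤ y ∧ y ≤ ((cardK n N + 1) * N : ℕ) ∧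
      (M0 N (sg y s) ∨ Cn N (sg y s)) := chain N _ s (by omega)

/-- Least element search in an integer interval. -/
theorem least_diff {P : ℤ → Prop} {y z : ℤ} (hz : y ≤ z) (hP : P z) :
    ∃ k, y ≤ k ∧ k ≤ z ∧ P k ∧ ∀ l, y ≤ l → l < k → ¬ P l := by
  classical
  have hex : ∃ m : ℕ, P (y + m) := ⟨(z - y).toNat, by
    rwa [Int.toNat_of_nonneg (by omega), add_sub_cancel]⟩
  have hle : Nat.find hex ≤ (z - y).toNat := Nat.find_min' hex (by
    rwa [Int.toNat_of_nonneg (by omega), add_sub_cancel])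
  refine ⟨y + Nat.find hex, by omega, by omega, Nat.find_spec hex, ?_⟩
  intro l l0 l1 hl
  refine Nat.find_min hex (m := (l - y).toNat) (by omega) ?_
  rwa [Int.toNat_of_nonneg (by omega), add_sub_cancel]

theorem greatest_diff {P : ℤ → Prop} {y z : ℤ} (hz : y ≤ z) (hP : P y) :
    ∃ k, y ≤ k ∧ k ≤ z ∧ P k ∧ ∀ l, k < l → l ≤ z → ¬ P l := by
  obtain ⟨k, k0, k1, k2, k3⟩ := least_diff (P := fun x => P (-x)) (y := -z) (z := -y) (by omega)
    (by simpa using hP)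
  refine ⟨-k, by omega, by omega, k2, ?_⟩
  intro l l0 l1 hl
  exact k3 (-l) (by omega) (by omega) (by simpa using hl)

/-- A constant block followed by a change yields a run end. -/
theorem exists_AE {N : ℕ} (hN : 1 ≤ N) {s : ℤ → Fin n} {y z : ℤ} (hc : Cn N (sg y s)) (hyz : y ≤ z)
    (hz : s z ≠ s y) : ∃ x, y ≤ x ∧ x + 2 * N ≤ z ∧ AE N (sg x s) := by
  obtain ⟨k, k0, k1, k2, k3⟩ := least_diff (P := fun k => s k ≠ s y) hyz hz
  push Not at k3
  have hk : y + 2 * N ≤ k := by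
    by_contra hlt
    apply k2
    have := hc (k - y) (by omega) (by omega)
    simpa [sg] using this
  refine ⟨k - 2 * N, by omega, by omega, ?_, ?_⟩
  · intro l l0 l1
    simp only [sg, zero_add]
    exact (k3 _ (by omega) (by omega)).trans (k3 _ (by omega) (by omega)).symm
  · simp only [sg, zero_add, add_sub_cancel]
    intro heq
    apply k2
    rw [heq]
    exact k3 _ (by omega) (by omega)

theorem past {N B : ℕ} (hN : 1 ≤ N) (hB : 2 * ((cardK n N + 1) * N) + 4 * N + 10 ≤ B) {s : ℤ → Fin n}
    (hs : ¬ AA N B s) : ∃ a : ℕ, M0 N (sg (-a) s) ∧ (a + 3 * N + 3 ≤ B ∨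
      (a + 1 ≤ B ∧ ∀ k : ℤ, -a ≤ k → k ≤ 2 * N → s k = s 0)) := by
  set R := (cardK n N + 1) * N with hR
  obtain ⟨y, y0, y1, hy⟩ := chain' N (sg (-(R + N : ℤ)) s)
  rw [← hR] at y0 y1
  rw [sg_sg] at hy
  set x := y + -(R + N : ℤ) with hx
  rcases hy with hy | hy
  · refine ⟨(-x).toNat, ?_, Or.inl (by omega)⟩
    rw [Int.toNat_of_nonneg (by omega), neg_neg]
    exact hy
  by_cases hcon : ∃ z, x ≤ z ∧ z ≤ 2 * N ∧ s z ≠ s x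
  · obtain ⟨z, z0, z1, hz⟩ := hcon
    obtain ⟨u, u0, u1, hu⟩ := exists_AE hN hy z0 hz
    refine ⟨(-u).toNat, ?_, Or.inl (by omega)⟩
    rw [Int.toNat_of_nonneg (by omega), neg_neg]
    exact Or.inl (Or.inl hu)
  · push Not at hcon
    have hx0 : s 0 = s x := hcon 0 (by omega) (by omega)
    have : ∃ k : ℤ, -B ≤ k ∧ k ≤ 2 * N ∧ s k ≠ s 0 := by
      by_contra h
      push Not at h
      exact hs h
    obtain ⟨k, k0, k1, k2⟩ := this
    have hkx : k < x := by
      by_contra h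
      exact k2 (by rw [hcon k (by omega) k1, hx0])
    obtain ⟨l, l0, l1, l2, l3⟩ := greatest_diff (P := fun k => s k ≠ s 0) (z := x) hkx.le k2
    push Not at l3
    have hlx : l ≠ x := by
      rintro rfl
      exact l2 hx0.symm
    have hall : ∀ m : ℤ, l < m → m ≤ 2 * N → s m = s 0 := by
      intro m m0 m1
      by_cases h : m ≤ x
      · exact l3 m m0 h
      · rw [hcon m (by omega) m1, hx0]
    refine ⟨(-(l + 1)).toNat, ?_, Or.inr ⟨by omega, ?_⟩⟩
    · rw [Int.toNat_of_nonneg (by omega), neg_neg]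
      refine Or.inl (Or.inr ⟨?_, ?_⟩)
      · simp only [sg, zero_add]
        rw [hall (l + 1) (by omega) (by omega)]
        simpa using l2
      · intro m m0 m1
        simp only [sg, zero_add]
        rw [hall (l + 1) (by omega) (by omega), hall _ (by omega) (by omega)]
    · intro m m0 m1
      exact hall m (by omega) m1

theorem future {N : ℕ} (hN : 1 ≤ N) (B : ℕ) (s : ℤ → Fin n) :
    ∃ b : ℕ, 1 ≤ b ∧ b ≤ 2 * ((cardK n N + 1) * N) + 1 + B ∧ M1 N B (sg b s) := by
  set R := (cardK n N + 1) * N with hR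
  obtain ⟨y, y0, y1, hy⟩ := chain' N (sg (R + 1 : ℤ) s)
  rw [← hR] at y0 y1
  rw [sg_sg] at hy
  set x := y + (R + 1 : ℤ) with hx
  rcases hy with hy | hy
  · refine ⟨x.toNat, by omega, by omega, Or.inl ?_⟩
    rwa [Int.toNat_of_nonneg (by omega)]
  by_cases hcon : ∃ z, x ≤ z ∧ z ≤ x + B + 2 * N ∧ s z ≠ s x
  · obtain ⟨z, z0, z1, hz⟩ := hcon
    obtain ⟨u, u0, u1, hu⟩ := exists_AE hN hy z0 hz
    refine ⟨u.toNat, by omega, by omega, Or.inl (Or.inl (Or.inl ?_))⟩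
    rwa [Int.toNat_of_nonneg (by omega)]
  · push Not at hcon
    refine ⟨(x + B).toNat, by omega, by omega, Or.inr ?_⟩
    rw [Int.toNat_of_nonneg (by omega)]
    intro k k0 k1
    simp only [sg]
    rw [hcon (k + _) (by omega) (by omega), hcon (0 + _) (by omega) (by omega)]

end LLL

namespace LLL

variable {n : ℕ}

/-- Agreement of two sequences on an integer interval. -/
def Ag (a b : ℤ) (s s' : ℤ → Fin n) : Prop := ∀ k, a ≤ k → k ≤ b → s k = s' k

theorem Ag.symm {a b : ℤ} {s s' : ℤ → Fin n} (h : Ag a b s s') : Ag a b s' s :=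
  fun k k0 k1 => (h k k0 k1).symm

theorem Ag.sg {a b : ℤ} {s s' : ℤ → Fin n} (h : Ag a b s s') {a' b' : ℤ} (y : ℤ)
    (h1 : a ≤ a' + y) (h2 : b' + y ≤ b) : Ag a' b' (sg y s) (sg y s') :=
  fun k k0 k1 => h _ (by omega) (by omega)

theorem AE_loc {N : ℕ} {s s' : ℤ → Fin n} (h : Ag (-1) (3 * N) s s') (hs : AE N s) :
    AE N s' := by
  refine ⟨fun k k0 k1 => ?_, ?_⟩
  · rw [← h k (by omega) (by omega), ← h 0 (by omega) (by omega)]; exact hs.1 k k0 k1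
  · rw [← h (2 * N) (by omega) (by omega), ← h 0 (by omega) (by omega)]; exact hs.2

theorem AS_loc {N : ℕ} {s s' : ℤ → Fin n} (h : Ag (-1) (3 * N) s s') (hs : AS N s) :
    AS N s' := by
  refine ⟨?_, fun k k0 k1 => ?_⟩
  · rw [← h (-1) (by omega) (by omega), ← h 0 (by omega) (by omega)]; exact hs.1
  · rw [← h k (by omega) (by omega), ← h 0 (by omega) (by omega)]; exact hs.2 k k0 k1

theorem Pr_loc {N : ℕ} {s s' : ℤ → Fin n} (h : Ag (-1) (3 * N) s s') (hs : Pr N s) :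
    Pr N s' := hs.imp (AE_loc h) (AS_loc h)

theorem key_loc {N : ℕ} {s s' : ℤ → Fin n} (h : Ag (-1) (3 * N) s s') : key N s = key N s' :=
  (key_eq_iff _ _ _).2 (fun k _ _ => h k (by omega) (by omega))

theorem CM_loc {N : ℕ} {s s' : ℤ → Fin n} (h : Ag (-1 - N) (4 * N) s s') (hs : CM N s) :
    CM N s' := by
  refine ⟨fun hc => hs.1 fun k k0 k1 => ?_, fun y y0 y1 => ⟨fun hp => ?_, ?_⟩⟩
  · rw [h k (by omega) (by omega), h 0 (by omega) (by omega)]; exact hc k k0 k1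
  · exact (hs.2 y y0 y1).1 (Pr_loc (h.symm.sg y (by omega) (by omega)) hp)
  · rw [← key_loc (h.sg y (by omega) (by omega)),
      ← key_loc (fun k k0 k1 => h k (by omega) (by omega))]
    exact (hs.2 y y0 y1).2

theorem M0_loc {N : ℕ} {s s' : ℤ → Fin n} (h : Ag (-1 - N) (4 * N) s s') (hs : M0 N s) :
    M0 N s' := hs.imp (Pr_loc fun k k0 k1 => h k (by omega) (by omega)) (CM_loc h)

theorem AA_loc {N B : ℕ} {s s' : ℤ → Fin n} (h : Ag (-B) (2 * N) s s') (hs : AA N B s) :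
    AA N B s' := by
  intro k k0 k1
  rw [← h k (by omega) (by omega), ← h 0 (by omega) (by omega)]; exact hs k k0 k1

theorem M1_loc {N B : ℕ} (hB : N + 1 ≤ B) {s s' : ℤ → Fin n} (h : Ag (-B) (4 * N) s s')
    (hs : M1 N B s) : M1 N B s' :=
  hs.imp (M0_loc fun k k0 k1 => h k (by omega) (by omega))
    (AA_loc fun k k0 k1 => h k (by omega) (by omega))

theorem lab_loc {A : Type*} (cv : ℕ → A) (α : Fin n → Fin n → A) {N : ℕ}
    {s s' : ℤ → Fin n} (h : Ag (-1 - 2 * N) (5 * N) s s') : lab cv α N s = lab cv α N s' := by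
  have e1 : AS N s ↔ AS N s' :=
    ⟨AS_loc fun k k0 k1 => h k (by omega) (by omega),
      AS_loc fun k k0 k1 => h.symm k (by omega) (by omega)⟩
  have e2 : ∀ y : ℤ, -N ≤ y → y ≤ N → (CM N (sg y s) ↔ CM N (sg y s')) := fun y y0 y1 =>
    ⟨CM_loc (h.sg y (by omega) (by omega)), CM_loc (h.symm.sg y (by omega) (by omega))⟩
  have e3 : CM N s ↔ CM N s' := by
    have := e2 0 (by omega) (by omega); rwa [sg_zero, sg_zero] at this
  have e4 : dmin N s = dmin N s' := by
    unfold dmin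
    congr 1
    ext d
    constructor
    · rintro ⟨d1, d2, d3⟩
      rw [e2 _ (by omega) (by omega), e2 _ (by omega) (by omega)] at d3
      exact ⟨d1, d2, d3⟩
    · rintro ⟨d1, d2, d3⟩
      rw [← e2 _ (by omega) (by omega), ← e2 _ (by omega) (by omega)] at d3
      exact ⟨d1, d2, d3⟩
  unfold lab
  rw [e4, h 0 (by omega) (by omega), h (2 * N) (by omega) (by omega)]
  by_cases c1 : AS N s'
  · rw [if_pos c1, if_pos (e1.2 c1)]
  · rw [if_neg c1, if_neg (fun h => c1 (e1.1 h))]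
    by_cases c2 : CM N s'
    · rw [if_pos c2, if_pos (e3.2 c2)]
    · rw [if_neg c2, if_neg (fun h => c2 (e3.1 h))]

/-- Distance to the last marker. -/
noncomputable def aS (N : ℕ) (s : ℤ → Fin n) : ℕ := sInf {a : ℕ | M0 N (sg (-a) s)}

/-- Distance to the next marker. -/
noncomputable def bS (N B : ℕ) (s : ℤ → Fin n) : ℕ := sInf {b : ℕ | 1 ≤ b ∧ M1 N B (sg b s)}

open Classical in
noncomputable def wf {A : Type*} (E : A → A → Prop) (a b : A) (k : ℕ) : ℕ → A :=
  if h : HasWalk E a b k then h.choose else fun _ => a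

theorem wf_spec {A : Type*} {E : A → A → Prop} {a b : A} {k : ℕ} (h : HasWalk E a b k) :
    wf E a b k 0 = a ∧ wf E a b k k = b ∧ ∀ i < k, E (wf E a b k i) (wf E a b k (i + 1)) := by
  have : wf E a b k = h.choose := by simp [wf, h]
  rw [this]
  exact h.choose_spec

open Classical in
/-- The value attached to a sequence. -/
noncomputable def rr {A : Type*} (E : A → A → Prop) (cv : ℕ → A) (α : Fin n → Fin n → A)
    (N B : ℕ) (s : ℤ → Fin n) : A :=
  if AA N B s then α (s 0) (s (2 * N)) else
    wf E (lab cv α N (sg (-(aS N s : ℤ)) s)) (lab cv α N (sg (bS N B s) s))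
      (aS N s + bS N B s) (aS N s)

theorem aS_spec {N B : ℕ} (hN : 1 ≤ N) (hB : 2 * ((cardK n N + 1) * N) + 4 * N + 10 ≤ B)
    {s : ℤ → Fin n} (hs : ¬ AA N B s) : M0 N (sg (-(aS N s : ℤ)) s) := by
  obtain ⟨a, ha, -⟩ := past hN hB hs
  exact Nat.sInf_mem (s := {a : ℕ | M0 N (sg (-a) s)}) ⟨a, ha⟩

theorem aS_min {N : ℕ} {s : ℤ → Fin n} {a : ℕ} (h : M0 N (sg (-a) s)) : aS N s ≤ a :=
  Nat.sInf_le h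

theorem bS_spec {N : ℕ} (hN : 1 ≤ N) (B : ℕ) (s : ℤ → Fin n) :
    1 ≤ bS N B s ∧ M1 N B (sg (bS N B s) s) := by
  obtain ⟨b, b1, -, hb⟩ := future hN B s
  exact Nat.sInf_mem (s := {b : ℕ | 1 ≤ b ∧ M1 N B (sg b s)}) ⟨b, b1, hb⟩

theorem bS_min {N B : ℕ} {s : ℤ → Fin n} {b : ℕ} (h1 : 1 ≤ b) (h : M1 N B (sg b s)) :
    bS N B s ≤ b := Nat.sInf_le ⟨h1, h⟩

theorem the_walk {A : Type*} {E : A → A → Prop} {cv : ℕ → A} {α : Fin n → Fin n → A} {N B : ℕ}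
    (hN : 1 ≤ N) (hB : 2 * ((cardK n N + 1) * N) + 4 * N + 10 ≤ B)
    (hcv : ∀ d, 2 ≤ d → HasWalk E (cv d) (cv d) d)
    (hw : ∀ a b, a ∈ Set.range cv ∪ Set.range (Function.uncurry α) →
        b ∈ Set.range cv ∪ Set.range (Function.uncurry α) →
        ∀ k, N ≤ k → HasWalk E a b k)
    {s : ℤ → Fin n} (hs : ¬ AA N B s) :
    HasWalk E (lab cv α N (sg (-(aS N s : ℤ)) s)) (lab cv α N (sg (bS N B s) s))
      (aS N s + bS N B s) := by
  have ha := aS_spec hN hB hs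
  obtain ⟨b1, hb⟩ := bS_spec hN B s
  have := gap_walk (α := α) (g := aS N s + bS N B s) hcv hw (by omega) ha (B := B)
    (by rw [sg_sg]; convert hb using 2; push_cast; ring) (by omega) (by
      intro d d0 d1 hd
      rw [sg_sg] at hd
      by_cases h : d ≤ aS N s
      · have := aS_min (N := N) (s := s) (a := (aS N s - d).toNat) (by
          rw [Int.toNat_of_nonneg (by omega)]; convert hd using 2; ring)
        omega
      · have := bS_min (N := N) (B := B) (s := s) (b := (d - aS N s).toNat) (by omega) (by
          rw [Int.toNat_of_nonneg (by omega)]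
          left; convert hd using 2; ring)
        omega)
  rw [sg_sg] at this
  convert this using 3
  push_cast; ring

theorem rr_M0 {A : Type*} {E : A → A → Prop} {cv : ℕ → A} {α : Fin n → Fin n → A} {N B : ℕ}
    (hN : 1 ≤ N) (hB : 2 * ((cardK n N + 1) * N) + 4 * N + 10 ≤ B)
    (hcv : ∀ d, 2 ≤ d → HasWalk E (cv d) (cv d) d)
    (hw : ∀ a b, a ∈ Set.range cv ∪ Set.range (Function.uncurry α) →
        b ∈ Set.range cv ∪ Set.range (Function.uncurry α) →
        ∀ k, N ≤ k → HasWalk E a b k)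
    {s : ℤ → Fin n} (hs : ¬ AA N B s) (h : M0 N s) : rr E cv α N B s = lab cv α N s := by
  have h0 : aS N s = 0 := by
    have := aS_min (N := N) (s := s) (a := 0) (by simpa [sg_zero] using h)
    omega
  have := (wf_spec (the_walk hN hB hcv hw hs)).1
  rw [rr, if_neg hs]
  rw [h0] at this ⊢
  rw [this]
  simp [sg_zero]

theorem rr_M1 {A : Type*} {E : A → A → Prop} {cv : ℕ → A} {α : Fin n → Fin n → A} {N B : ℕ}
    (hN : 1 ≤ N) (hB : 2 * ((cardK n N + 1) * N) + 4 * N + 10 ≤ B)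
    (hcv : ∀ d, 2 ≤ d → HasWalk E (cv d) (cv d) d)
    (hw : ∀ a b, a ∈ Set.range cv ∪ Set.range (Function.uncurry α) →
        b ∈ Set.range cv ∪ Set.range (Function.uncurry α) →
        ∀ k, N ≤ k → HasWalk E a b k)
    {s : ℤ → Fin n} (h : M1 N B s) : rr E cv α N B s = lab cv α N s := by
  by_cases hs : AA N B s
  · rw [rr, if_pos hs, lab_AA cv α (by omega) hs]
  · exact rr_M0 hN hB hcv hw hs (h.resolve_right hs)

theorem step {A : Type*} {E : A → A → Prop} {cv : ℕ → A} {α : Fin n → Fin n → A} {N B : ℕ}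
    (hN : 1 ≤ N) (hB : 2 * ((cardK n N + 1) * N) + 4 * N + 10 ≤ B)
    (hcv : ∀ d, 2 ≤ d → HasWalk E (cv d) (cv d) d)
    (hw : ∀ a b, a ∈ Set.range cv ∪ Set.range (Function.uncurry α) →
        b ∈ Set.range cv ∪ Set.range (Function.uncurry α) →
        ∀ k, N ≤ k → HasWalk E a b k)
    {s : ℤ → Fin n} (hs : ¬ AA N B s) :
    E (rr E cv α N B s) (rr E cv α N B (sg 1 s)) := by
  obtain ⟨b1, hb⟩ := bS_spec hN B s
  have hwk := wf_spec (the_walk hN hB hcv hw hs)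
  have he := hwk.2.2 (aS N s) (by omega)
  have hr : rr E cv α N B s = _ := if_neg hs
  rw [← hr] at he
  by_cases h1 : M1 N B (sg 1 s)
  · rw [rr_M1 hN hB hcv hw h1]
    have hb1 : bS N B s = 1 := by
      have := bS_min (N := N) (B := B) (s := s) (b := 1) le_rfl (by simpa using h1)
      omega
    have h2 := hwk.2.1
    rw [hb1] at he h2
    rw [h2] at he
    simpa using he
  · have h2 : ¬ AA N B (sg 1 s) := fun h => h1 (Or.inr h)
    have h3 : ¬ M0 N (sg 1 s) := fun h => h1 (Or.inl h)
    have ha1 : aS N (sg 1 s) = aS N s + 1 := by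
      apply le_antisymm
      · apply aS_min
        rw [sg_sg]
        convert aS_spec hN hB hs using 2
        push_cast; ring
      · have hm := aS_spec hN hB h2
        have hpos : aS N (sg 1 s) ≠ 0 := by
          intro h0
          rw [h0] at hm
          apply h3
          simpa [sg_zero] using hm
        rw [sg_sg] at hm
        have := aS_min (N := N) (s := s) (a := aS N (sg 1 s) - 1) (by
          convert hm using 2
          rw [Nat.cast_sub (by omega)]; push_cast; ring)
        omega
    have hb1 : bS N B (sg 1 s) + 1 = bS N B s := by
      apply le_antisymm
      · have hne : bS N B s ≠ 1 := by
          intro h; rw [h] at hb; exact h1 (by simpa using hb)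
        have := bS_min (N := N) (B := B) (s := sg 1 s) (b := bS N B s - 1) (by omega) (by
          rw [sg_sg]
          convert hb using 2
          rw [Nat.cast_sub (by omega)]; push_cast; ring)
        omega
      · apply bS_min (by omega)
        have := (bS_spec hN B (sg 1 s)).2
        rw [sg_sg] at this
        push_cast
        exact this
    have hr1 : rr E cv α N B (sg 1 s) = _ := if_neg h2
    rw [hr1, sg_sg, sg_sg, ha1]
    have e1 : -((aS N s + 1 : ℕ) : ℤ) + 1 = -(aS N s : ℤ) := by push_cast; ring
    have e2 : (bS N B (sg 1 s) : ℤ) + 1 = bS N B s := by rw [← hb1]; push_cast; ring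
    have e3 : aS N s + 1 + bS N B (sg 1 s) = aS N s + bS N B s := by omega
    rw [e1, e2, e3]
    exact he

theorem rr_const {A : Type*} {E : A → A → Prop} {cv : ℕ → A} {α : Fin n → Fin n → A} {N B : ℕ}
    (hN : 1 ≤ N) (hB : 2 * ((cardK n N + 1) * N) + 4 * N + 10 ≤ B)
    (hcv : ∀ d, 2 ≤ d → HasWalk E (cv d) (cv d) d)
    (hw : ∀ a b, a ∈ Set.range cv ∪ Set.range (Function.uncurry α) →
        b ∈ Set.range cv ∪ Set.range (Function.uncurry α) →
        ∀ k, N ≤ k → HasWalk E a b k)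
    {s : ℤ → Fin n} {i : Fin n} (h : ∀ k : ℤ, -B ≤ k → k < 2 * N → s k = i) :
    rr E cv α N B s = α i (s (2 * N)) := by
  have h0 : s 0 = i := h 0 (by omega) (by omega)
  by_cases hJ : s (2 * N) = i
  · have : AA N B s := by
      intro k k0 k1
      rw [h0]
      rcases eq_or_lt_of_le k1 with h' | h'
      · rw [h', hJ]
      · exact h k k0 h'
    rw [rr, if_pos this, h0]
  · have hAE : AE N s :=
      ⟨fun k k0 k1 => by rw [h0]; exact h k (by omega) k1, by rwa [h0]⟩
    rw [rr_M1 hN hB hcv hw (Or.inl (Or.inl (Or.inl hAE))), lab_AE cv α hN hAE, h0]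

theorem aS_loc_aux {A : Type*} {cv : ℕ → A} {α : Fin n → Fin n → A} {N B : ℕ}
    (hN : 1 ≤ N) (hB : 2 * ((cardK n N + 1) * N) + 4 * N + 10 ≤ B)
    {s s' : ℤ → Fin n} (h : Ag (-B) (5 * N) s s') (hs : ¬ AA N B s) :
    M0 N (sg (-(aS N s : ℤ)) s') ∧
      lab cv α N (sg (-(aS N s : ℤ)) s) = lab cv α N (sg (-(aS N s : ℤ)) s') := by
  have hm := aS_spec hN hB hs
  obtain ⟨a0, h0, hor⟩ := past hN hB hs
  have hle := aS_min h0
  by_cases hsm : aS N s + 3 * N + 3 ≤ B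
  · exact ⟨M0_loc (h.sg _ (by omega) (by omega)) hm,
      lab_loc cv α (h.sg _ (by omega) (by omega))⟩
  · have h1 := hor.resolve_left (by omega)
    have hc : ∀ k : ℤ, 0 ≤ k → k ≤ 2 * N → sg (-(aS N s : ℤ)) s k = s 0 := by
      intro k k0 k1
      exact h1.2 _ (by omega) (by omega)
    have hAS : AS N (sg (-(aS N s : ℤ)) s) := by
      rcases hm with (hm | hm) | hm
      · exact absurd ((hc _ (by omega) (by omega)).trans (hc 0 (by omega) (by omega)).symm) hm.2
      · exact hm
      · exact absurd (fun k k0 k1 => (hc k k0 (by omega)).trans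
          (hc 0 (by omega) (by omega)).symm) hm.1
    have hAS' : AS N (sg (-(aS N s : ℤ)) s') := AS_loc (h.sg _ (by omega) (by omega)) hAS
    exact ⟨Or.inl (Or.inr hAS'), by rw [lab_AS cv α hAS, lab_AS cv α hAS']⟩

theorem rr_loc {A : Type*} {E : A → A → Prop} {cv : ℕ → A} {α : Fin n → Fin n → A} {N B : ℕ}
    (hN : 1 ≤ N) (hB : 2 * ((cardK n N + 1) * N) + 4 * N + 10 ≤ B)
   {s s' : ℤ → Fin n}
    (h : Ag (-B) (2 * ((cardK n N + 1) * N) + 1 + B + 5 * N : ℕ) s s') :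
    rr E cv α N B s = rr E cv α N B s' := by
  set R := (cardK n N + 1) * N with hR
  by_cases hs : AA N B s
  · have hs' : AA N B s' := AA_loc (fun k k0 k1 => h k (by omega) (by omega)) hs
    rw [rr, rr, if_pos hs, if_pos hs', h 0 (by omega) (by omega),
      h (2 * N) (by omega) (by omega)]
  · have hs' : ¬ AA N B s' := fun h' =>
      hs (AA_loc (fun k k0 k1 => h.symm k (by omega) (by omega)) h')
    have hA : Ag (-B) (5 * N) s s' := fun k k0 k1 => h k (by omega) (by omega)
    have l1 := aS_loc_aux (cv := cv) (α := α) hN hB hA hs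
    have l2 := aS_loc_aux (cv := cv) (α := α) hN hB hA.symm hs'
    have ea : aS N s' = aS N s := le_antisymm (aS_min l1.1) (aS_min l2.1)
    have key : ∀ u u' : ℤ → Fin n, Ag (-B) (2 * R + 1 + B + 5 * N : ℕ) u u' →
        bS N B u ≤ 2 * R + 1 + B ∧ bS N B u' ≤ bS N B u := by
      intro u u' hu
      obtain ⟨b, b1, b2, b3⟩ := future hN B u
      rw [← hR] at b2
      have hb := bS_min b1 b3
      obtain ⟨c1, c2⟩ := bS_spec hN B u
      exact ⟨by omega, bS_min c1 (M1_loc (by omega) (hu.sg _ (by omega) (by omega)) c2)⟩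
    have k1 := key s s' h
    have k2 := key s' s h.symm
    have b1 := (bS_spec hN B s).1
    have eb : bS N B s' = bS N B s := le_antisymm k1.2 k2.2
    have lb : lab cv α N (sg (bS N B s) s) = lab cv α N (sg (bS N B s) s') :=
      lab_loc cv α (h.sg _ (by omega) (by omega))
    rw [rr, rr, if_neg hs, if_neg hs', ea, eb, l1.2, lb]

/-- The values at the nodes of the tree. -/
noncomputable def VV {A : Type*} (t : (Fin n → A) → A) (r : (ℤ → Fin n) → A) (H : ℕ) :
    ℕ → (ℤ → Fin n) → A
  | 0, s => r s
  | m + 1, s => t (fun j => VV t r H m (Function.update s ((H : ℤ) - (m + 1)) j))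

theorem VV_loc {A : Type*} {t : (Fin n → A) → A} {r : (ℤ → Fin n) → A} {H B : ℕ}
    (hr : ∀ s s', Ag (-B) (H - 1) s s' → r s = r s') (m : ℕ) :
    ∀ s s', Ag (-B) (H - m - 1) s s' → VV t r H m s = VV t r H m s' := by
  induction m with
  | zero => intro s s' h; exact hr s s' (fun k k0 k1 => h k k0 (by push_cast; omega))
  | succ m ih =>
    intro s s' h
    simp only [VV]
    congr 1
    funext j
    apply ih
    intro k k0 k1
    by_cases hk : k = (H : ℤ) - (m + 1)
    · rw [hk]; simp
    · rw [Function.update_of_ne hk, Function.update_of_ne hk]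
      exact h k k0 (by push_cast; omega)

theorem upd_sg (s : ℤ → Fin n) (z : ℤ) (j : Fin n) :
    Function.update (sg 1 s) z j = sg 1 (Function.update s (z + 1) j) := by
  funext k
  by_cases hk : k = z
  · subst hk; simp [sg]
  · rw [Function.update_of_ne hk]
    simp only [sg]
    rw [Function.update_of_ne (by omega)]

theorem tree {A : Type*} {t : (Fin n → A) → A} {E : A → A → Prop} {α : Fin n → Fin n → A}
    (hn : 0 < n)
    (hidem : ∀ a : A, t (fun _ => a) = a)
    (hcomp : ∀ u v : Fin n → A, (∀ i, E (u i) (v i)) → E (t u) (t v))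
    (hα : ∀ i : Fin n, E (α i i) (t (α i)))
    {r : (ℤ → Fin n) → A} {H B N : ℕ} (hH : 2 * N + 10 ≤ H)
    (hr : ∀ s s', Ag (-B) (H - 1) s s' → r s = r s')
    (hstep : ∀ s, ¬ AA N B s → E (r s) (r (sg 1 s)))
    (hconst : ∀ s i, (∀ k : ℤ, -B ≤ k → k < 2 * N → s k = i) → r s = α i (s (2 * N))) :
    ∃ a, E a a := by
  have hVA : ∀ (m : ℕ) s i, (∀ k : ℤ, -B ≤ k → k < 2 * N → s k = i) → 2 * N + 1 + m ≤ H →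
      VV t r H m s = α i (s (2 * N)) := by
    intro m
    induction m with
    | zero => intro s i h _; exact hconst s i h
    | succ m ih =>
      intro s i h hm
      simp only [VV]
      have : ∀ j, VV t r H m (Function.update s ((H : ℤ) - (m + 1)) j) = α i (s (2 * N)) := by
        intro j
        rw [ih _ i _ (by omega)]
        · rw [Function.update_of_ne (by omega)]
        · intro k k0 k1
          rw [Function.update_of_ne (by omega)]
          exact h k k0 k1
      simp only [this, hidem]
  have hAAu : ∀ (s : ℤ → Fin n) (z : ℤ) j, 2 * N < z → ¬ AA N B s →
      ¬ AA N B (Function.update s z j) := by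
    intro s z j hz hs h
    apply hs
    refine AA_loc ?_ h
    intro k k0 k1
    rw [Function.update_of_ne (by omega)]
  have claim : ∀ (m : ℕ) s, (H ≤ 2 * N + 1 + m ∨ ¬ AA N B s) →
      E (VV t r H m s) (VV t r H (m + 1) (sg 1 s)) := by
    intro m
    induction m with
    | zero =>
      intro s hs
      have hs := hs.resolve_left (by omega)
      rw [← hidem (VV t r H 0 s)]
      rw [VV]
      apply hcomp
      intro j
      rw [upd_sg]
      simp only [VV]
      rw [hr s (Function.update s ((H : ℤ) - ((0 : ℕ) + 1) + 1) j)]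
      · apply hstep
        apply hAAu _ _ _ _ hs
        push_cast; omega
      · intro k k0 k1
        rw [Function.update_of_ne]
        push_cast; omega
    | succ m ih =>
      intro s hs
      by_cases hsp : AA N B s ∧ H = 2 * N + 1 + (m + 1)
      · obtain ⟨h1, h2⟩ := hsp
        rw [hVA (m + 1) s (s 0) (fun k k0 k1 => h1 k k0 (by omega)) (by omega)]
        rw [h1 (2 * N) (by omega) le_rfl, VV]
        have : ∀ j, VV t r H (m + 1)
            (Function.update (sg 1 s) ((H : ℤ) - ((m + 1 : ℕ) + 1)) j) = α (s 0) j := by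
          intro j
          rw [hVA (m + 1) _ (s 0) _ (by omega)]
          · congr 1
            rw [show (2 * N : ℤ) = (H : ℤ) - ((m + 1 : ℕ) + 1) by push_cast; omega]
            simp
          · intro k k0 k1
            rw [Function.update_of_ne (by push_cast; omega)]
            exact h1 _ (by omega) (by omega)
        simp only [this]
        exact hα (s 0)
      · rw [VV, VV]
        apply hcomp
        intro j
        rw [upd_sg]
        have e : (H : ℤ) - ((m + 1 : ℕ) + 1) + 1 = (H : ℤ) - (m + 1) := by push_cast; ring
        rw [e]
        apply ih
        by_cases h : H ≤ 2 * N + 1 + m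
        · exact Or.inl h
        · right
          apply hAAu _ _ _ (by omega)
          rcases hs with hs | hs
          · intro h'; exact hsp ⟨h', by omega⟩
          · exact hs
  let s : ℤ → Fin n := fun _ => ⟨0, hn⟩
  obtain ⟨M, hM⟩ : ∃ M, M + 1 = H + B := ⟨H + B - 1, by omega⟩
  have hc : ∀ u u', VV t r H (M + 1) u = VV t r H (M + 1) u' := by
    intro u u'
    apply VV_loc hr
    intro k k0 k1
    push_cast at k1
    omega
  refine ⟨VV t r H (M + 1) s, ?_⟩
  have : E (VV t r H (M + 1) s) (t (fun _ => VV t r H (M + 1) s)) := by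
    conv_lhs => rw [VV]
    apply hcomp
    intro j
    rw [hc s (sg 1 (Function.update s ((H : ℤ) - (M + 1)) j))]
    apply claim
    left
    omega
  rwa [hidem] at this

end LLL

/-- Local loop lemma, directed version: if an idempotent `n`-ary operation `t` is compatible with
a strongly connected digraph `G` containing closed walks of all lengths `≥ 2`, and there are
vertices `α i j` with an edge `α i i → t (α i 0, …, α i (n-1))` for every `i`, then `G` has a
loop. -/
theorem local_loop_lemma_directed {A : Type*} {n : ℕ} (t : (Fin n → A) → A)
    (E : A → A → Prop)
    (hidem : ∀ a : A, t (fun _ => a) = a)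
    (hcomp : ∀ u v : Fin n → A, (∀ i, E (u i) (v i)) → E (t u) (t v))
    (hsc : ∀ u v : A, ∃ k, HasWalk E u v k)
    (hcyc : ∀ k : ℕ, 2 ≤ k → ∃ u : A, HasWalk E u u k)
    (α : Fin n → Fin n → A)
    (hα : ∀ i : Fin n, E (α i i) (t (α i))) :
    ∃ a : A, E a a := by
  rcases Nat.eq_zero_or_pos n with hn | hn
  · subst hn
    have h := hcomp (fun i => i.elim0) (fun i => i.elim0) (fun i => i.elim0)
    exact ⟨_, h⟩
  obtain ⟨cv, N, hN, hcv, hw⟩ := LLL.base_points hsc hcyc α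
  obtain ⟨B, hB⟩ : ∃ B, B = 2 * ((LLL.cardK n N + 1) * N) + 4 * N + 10 := ⟨_, rfl⟩
  obtain ⟨H, hH⟩ : ∃ H, H = 2 * ((LLL.cardK n N + 1) * N) + 1 + B + 5 * N + 10 := ⟨_, rfl⟩
  refine LLL.tree (t := t) (E := E) (α := α) (r := LLL.rr E cv α N B) (H := H) (B := B) (N := N)
    hn hidem hcomp hα (by omega) ?_ ?_ ?_
  · intro s s' h
    exact LLL.rr_loc (by omega) (by omega) (fun k k0 k1 => h k k0 (by omega))
  · intro s hs
    exact LLL.step (by omega) (by omega) hcv hw hs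
  · intro s i h
    exact LLL.rr_const (by omega) (by omega) hcv hw h
end

section
/- Let t: Aⁿ → A be idempotent and compatible with an undirected connected non-bipartite graph G on A, and suppose there are vertices α_{i,j} (i,j ∈ {0,…,n−1}) such that for every i there is an edge from α_{i,i} to t(α_{i,0},…,α_{i,n−1}). Then G contains a loop. (This can be derived from the corresponding statement for strongly connected digraphs with closed walks of all lengths ≥ 2, by passing to an odd relational power of G.) -/
/-! Proof idea: label infinite words over `Fin n` by a function `c` depending on finitely many
letters, such that `c w → c (tail w)` except on words starting with a long constant run `i^(m+1)`,
where `c w = α i i → t (α i)`.  Evaluating both sides along the `n`-ary tree gives a loop. -/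

namespace LocalLoop

/-! ### Walks -/

section walks
variable {A : Type*} {E : A → A → Prop}

theorem hw_refl (u : A) : HasWalk E u u 0 := ⟨fun _ => u, rfl, rfl, by simp⟩

theorem hw_cons {u v x : A} {k : ℕ} (h : E u v) (hw : HasWalk E v x k) : HasWalk E u x (k + 1) := by
  obtain ⟨w, h0, hk, hs⟩ := hw
  refine ⟨fun i => Nat.casesOn i u w, rfl, hk, ?_⟩
  intro i hi
  cases i with
  | zero => simpa [h0] using h
  | succ i => exact hs i (by omega)

theorem hw_uncons {u x : A} {k : ℕ} (hw : HasWalk E u x (k + 1)) :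
    ∃ v, E u v ∧ HasWalk E v x k := by
  obtain ⟨w, h0, hk, hs⟩ := hw
  exact ⟨w 1, h0 ▸ hs 0 (by omega), fun i => w (i + 1), rfl, hk, fun i hi => hs (i + 1) (by omega)⟩

theorem hw_trans {u v x : A} {k l : ℕ} (h : HasWalk E u v k) (h' : HasWalk E v x l) :
    HasWalk E u x (k + l) := by
  induction k generalizing u with
  | zero =>
    obtain ⟨w, h0, hk, -⟩ := h
    have : u = v := h0.symm.trans hk
    subst this
    simpa using h'
  | succ k ih =>
    obtain ⟨z, hz, hz'⟩ := hw_uncons h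
    have := hw_cons hz (ih hz')
    rwa [show k + 1 + l = k + l + 1 by omega]

theorem hw_one {u v : A} (h : E u v) : HasWalk E u v 1 := hw_cons h (hw_refl v)

theorem hw_symm (hs : ∀ u v : A, E u v → E v u) {u v : A} {k : ℕ} (h : HasWalk E u v k) :
    HasWalk E v u k := by
  induction k generalizing u with
  | zero =>
    obtain ⟨w, h0, hk, -⟩ := h
    have : u = v := h0.symm.trans hk
    subst this
    exact hw_refl u
  | succ k ih =>
    obtain ⟨z, hz, hz'⟩ := hw_uncons h
    exact hw_trans (ih hz') (hw_one (hs _ _ hz))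

theorem hw_odd (hs : ∀ u v : A, E u v → E v u) {u v : A} (h : E u v) (j : ℕ) :
    HasWalk E u v (2 * j + 1) := by
  induction j with
  | zero => exact hw_one h
  | succ j ih => exact hw_cons h (hw_cons (hs _ _ h) ih)

theorem hw_mono {E' : A → A → Prop} (hE : ∀ u v, E u v → E' u v) {u v : A} {k : ℕ}
    (h : HasWalk E u v k) : HasWalk E' u v k := by
  obtain ⟨w, h0, hk, h⟩ := h
  exact ⟨w, h0, hk, fun i hi => hE _ _ (h i hi)⟩

/-- Closed walks of all lengths at least two in a triangle. -/
theorem hw_tri (hs : ∀ u v : A, E u v → E v u) {x y z : A} (h1 : E x y) (h2 : E y z) (h3 : E z x)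
    (k : ℕ) : HasWalk E x x (k + 2) := by
  induction k using Nat.strong_induction_on with
  | _ k ih =>
    match k with
    | 0 => exact hw_cons h1 (hw_one (hs _ _ h1))
    | 1 => exact hw_cons h1 (hw_cons h2 (hw_one h3))
    | k + 2 => exact hw_cons h1 (hw_cons (hs _ _ h1) (ih k (by omega)))

theorem hw_unif (hs : ∀ u v : A, E u v → E v u) (hconn : ∀ u v : A, ∃ k, HasWalk E u v k)
    {x y z : A} (h1 : E x y) (h2 : E y z) (h3 : E z x) {ι : Type*} [Finite ι] (f g : ι → A) :
    ∃ K, ∀ k ≥ K, ∀ i, HasWalk E (f i) (g i) k := by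
  cases nonempty_fintype ι
  choose d hd using hconn
  refine ⟨∑ i, (d (f i) x + d x (g i) + 2), fun k hk i => ?_⟩
  have hi : d (f i) x + d x (g i) + 2 ≤ k :=
    le_trans (Finset.single_le_sum (f := fun i => d (f i) x + d x (g i) + 2)
      (fun _ _ => Nat.zero_le _) (Finset.mem_univ i)) hk
  have := hw_trans (hw_trans (hd (f i) x)
    (hw_tri hs h1 h2 h3 (k - (d (f i) x + d x (g i) + 2)))) (hd x (g i))
  convert this using 1
  omega

end walks

/-! ### Infinite words and functions depending on finitely many letters -/

/-- Removing the first letter. -/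
def T {n : ℕ} (w : ℕ → Fin n) : ℕ → Fin n := fun k => w (k + 1)

/-- Prepending a letter. -/
def cn {n : ℕ} (i : Fin n) (w : ℕ → Fin n) : ℕ → Fin n := fun k => Nat.casesOn k i w

/-- Removing `k` letters. -/
def S {n : ℕ} (k : ℕ) (w : ℕ → Fin n) : ℕ → Fin n := fun l => w (l + k)

/-- Dependence on the first `N` letters. -/
def LocN {n : ℕ} {β : Type*} (N : ℕ) (c : (ℕ → Fin n) → β) : Prop :=
  ∀ w w', (∀ k < N, w k = w' k) → c w = c w'

/-- Dependence on finitely many letters. -/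
def Loc {n : ℕ} {β : Type*} (c : (ℕ → Fin n) → β) : Prop := ∃ N, LocN N c

section loc
variable {n : ℕ} {β γ δ : Type*}

theorem loc_const (b : β) : Loc (fun _ : ℕ → Fin n => b) := ⟨0, fun _ _ _ => rfl⟩

theorem loc_letter (k : ℕ) : Loc (fun w : ℕ → Fin n => w k) :=
  ⟨k + 1, fun _ _ h => h k (by omega)⟩

theorem loc_comp2 {f : (ℕ → Fin n) → β} {g : (ℕ → Fin n) → γ} (hf : Loc f) (hg : Loc g)
    (h : β → γ → δ) : Loc (fun w => h (f w) (g w)) := by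
  obtain ⟨N, hN⟩ := hf
  obtain ⟨N', hN'⟩ := hg
  refine ⟨max N N', fun w w' hw => ?_⟩
  simp only
  rw [hN w w' (fun k hk => hw k (by omega)), hN' w w' (fun k hk => hw k (by omega))]

theorem loc_comp {f : (ℕ → Fin n) → β} (hf : Loc f) (h : β → γ) : Loc (fun w => h (f w)) :=
  loc_comp2 hf hf (fun a _ => h a)

theorem loc_S {f : (ℕ → Fin n) → β} (hf : Loc f) (k : ℕ) : Loc (fun w => f (S k w)) := by
  obtain ⟨N, hN⟩ := hf
  exact ⟨N + k, fun w w' hw => hN _ _ fun l hl => hw _ (by omega)⟩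

theorem loc_T {f : (ℕ → Fin n) → β} (hf : Loc f) : Loc (fun w => f (T w)) := loc_S hf 1

theorem loc_ite {p : (ℕ → Fin n) → Prop} [hd : ∀ w, Decidable (p w)]
    {f g : (ℕ → Fin n) → β} (hp : Loc p) (hf : Loc f)
    (hg : Loc g) : Loc (fun w => if p w then f w else g w) := by
  classical
  have := loc_comp2 hp (loc_comp2 hf hg Prod.mk) (fun p x => if p then x.1 else x.2)
  convert this

theorem loc_bdd {f : (ℕ → Fin n) → ℕ} (hf : Loc f) (B : ℕ) (hB : ∀ w, f w ≤ B)
    {g : ℕ → (ℕ → Fin n) → β} (hg : ∀ k, Loc (g k)) : Loc (fun w => g (f w) w) := by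
  obtain ⟨N, hN⟩ := hf
  choose K hK using hg
  refine ⟨N + ∑ k ∈ Finset.range (B + 1), K k, fun w w' hw => ?_⟩
  have e := hN w w' (fun k hk => hw k (by omega))
  simp only
  rw [← e]
  have : K (f w) ≤ ∑ k ∈ Finset.range (B + 1), K k :=
    Finset.single_le_sum (f := K) (fun _ _ => Nat.zero_le _)
      (Finset.mem_range.2 (Nat.lt_succ_of_le (hB w)))
  exact hK _ _ _ (fun k hk => hw k (by omega))

end loc

/-! ### Bounded search -/

open Classical in
/-- The first `k ≤ B` with `P k`, or `B`. -/
noncomputable def hit : (ℕ → Prop) → ℕ → ℕ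
  | _, 0 => 0
  | P, B + 1 => if P 0 then 0 else hit (fun k => P (k + 1)) B + 1

theorem hit_le (P : ℕ → Prop) (B : ℕ) : hit P B ≤ B := by
  induction B generalizing P with
  | zero => simp [hit]
  | succ B ih =>
    rw [hit]
    split_ifs
    · omega
    · have := ih (fun k => P (k + 1)); omega

theorem hit_lt {P : ℕ → Prop} {B k : ℕ} (h : k < hit P B) : ¬ P k := by
  induction B generalizing P k with
  | zero => simp [hit] at h
  | succ B ih =>
    rw [hit] at h
    split_ifs at h with h0
    · omega
    · cases k with
      | zero => exact h0
      | succ k => exact ih (P := fun k => P (k + 1)) (by omega)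

theorem hit_spec {P : ℕ → Prop} {B : ℕ} (h : hit P B < B) : P (hit P B) := by
  induction B generalizing P with
  | zero => omega
  | succ B ih =>
    rw [hit] at h ⊢
    split_ifs at h ⊢ with h0
    · exact h0
    · exact ih (P := fun k => P (k + 1)) (by omega)

theorem hit_eq {P : ℕ → Prop} {B h : ℕ} (hB : h ≤ B) (h1 : ∀ k < h, ¬ P k) (h2 : h < B → P h) :
    hit P B = h := by
  have a := hit_le P B
  rcases lt_trichotomy (hit P B) h with hl | hl | hl
  · exact absurd (hit_spec (lt_of_lt_of_le hl hB)) (h1 _ hl)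
  · exact hl
  · exact absurd (h2 (by omega)) (hit_lt hl)

open Classical in
theorem loc_hit {n : ℕ} {P : (ℕ → Fin n) → ℕ → Prop} (hP : ∀ k, Loc (fun w => P w k)) (B : ℕ) :
    Loc (fun w => hit (P w) B) := by
  induction B generalizing P with
  | zero => simpa [hit] using loc_const 0
  | succ B ih =>
    simp only [hit]
    exact loc_ite (hP 0) (loc_const 0)
      (loc_comp (ih (P := fun w k => P w (k + 1)) (fun k => hP (k + 1))) (· + 1))

/-! ### Run lengths -/

/-- Length of the initial constant run, capped at `B`. -/
noncomputable def rn {n : ℕ} (B : ℕ) (w : ℕ → Fin n) : ℕ := hit (fun k => w k ≠ w 0) B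

section rn
variable {n : ℕ} {B : ℕ} {w : ℕ → Fin n}

theorem rn_le : rn B w ≤ B := hit_le _ _

theorem rn_pos (hB : 0 < B) : 0 < rn B w := by
  by_contra h
  have h : rn B w = 0 := by omega
  have := hit_spec (P := fun k => w k ≠ w 0) (B := B) (by unfold rn at h; omega)
  unfold rn at h
  rw [h] at this
  exact this rfl

theorem rn_lt {k : ℕ} (h : k < rn B w) : w k = w 0 := by
  have := hit_lt h
  simpa using this

theorem rn_spec (h : rn B w < B) : w (rn B w) ≠ w 0 := hit_spec h

theorem rn_S {k : ℕ} (hk : k < rn B w) (h : rn B w < B) : rn B (S k w) = rn B w - k := by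
  have hs := rn_spec h
  refine hit_eq (by omega) ?_ ?_
  · intro l hl
    simp only [S, not_not, zero_add]
    rw [rn_lt (by omega : l + k < rn B w), rn_lt hk]
  · intro _
    simp only [S, zero_add]
    rw [rn_lt hk, show rn B w - k + k = rn B w by omega]
    exact hs

theorem rn_T (hk : 1 < rn B w) (h : rn B w < B) : rn B (T w) = rn B w - 1 := rn_S hk h

theorem loc_rn : Loc (fun w : ℕ → Fin n => rn B w) :=
  loc_hit (P := fun w k => w k ≠ w 0) (fun k => loc_comp2 (loc_letter k) (loc_letter 0) (· ≠ ·)) B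

end rn

/-! ### Three-colouring -/

open Classical in
/-- Greedy colouring, from the future. -/
noncomputable def col {n : ℕ} (X U : (ℕ → Fin n) → Prop) : ℕ → (ℕ → Fin n) → Fin 3
  | 0, _ => 1
  | f + 1, w => if X w then 1 else if U w then (if col X U f (T w) = 2 then 1 else 2)
      else (if col X U f (T w) = 0 then 1 else 0)

section col
variable {n : ℕ} {X U : (ℕ → Fin n) → Prop}

theorem col_X {f : ℕ} {w : ℕ → Fin n} (h : X w) : col X U f w = 1 := by
  cases f <;> simp [col, h]

theorem col_U {f : ℕ} {w : ℕ → Fin n} (h : U w) : col X U f w ≠ 0 := by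
  cases f <;> simp only [col, h, if_true] <;> (try split_ifs) <;> decide

theorem col_D {f : ℕ} {w : ℕ → Fin n} (h : ¬ U w) : col X U f w ≠ 2 := by
  cases f <;> simp only [col, h, if_false] <;> (try split_ifs) <;> decide

theorem col_ne {f : ℕ} {w : ℕ → Fin n} (h : ¬ X w) : col X U (f + 1) w ≠ col X U f (T w) := by
  simp only [col, h, if_false]
  generalize col X U f (T w) = x
  split_ifs with h1 h2 h2
  · rw [h2]; decide
  · exact fun h => h2 h.symm
  · rw [h2]; decide
  · exact fun h => h2 h.symm

theorem col_stab (μ : (ℕ → Fin n) → ℕ) (hpos : ∀ w, ¬ X w → 0 < μ w)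
    (hU : ∀ w, ¬ X w → ¬ X (T w) → U w → U (T w) → μ (T w) < μ w)
    (hD : ∀ w, ¬ X w → ¬ X (T w) → ¬ U w → ¬ U (T w) → μ (T w) < μ w) (f : ℕ) :
    ∀ w, (¬ X w → μ w ≤ f) → col X U f w = col X U (f + 1) w := by
  induction f with
  | zero =>
    intro w hw
    have : X w := by
      by_contra h
      have := hw h
      have := hpos w h
      omega
    rw [col_X this, col_X this]
  | succ f ih =>
    intro w hw
    by_cases hX : X w
    · rw [col_X hX, col_X hX]
    have hw := hw hX
    by_cases hX' : X (T w)
    · rw [col, col, col_X hX', col_X hX']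
    by_cases hu : U w <;> by_cases hu' : U (T w)
    · have := hU w hX hX' hu hu'
      rw [col, col, ih (T w) (fun _ => by omega)]
    · rw [col, col]
      simp only [hX, hu, if_false, if_true, col_D hu']
    · rw [col, col]
      simp only [hX, hu, if_false, col_U hu']
    · have := hD w hX hX' hu hu'
      rw [col, col, ih (T w) (fun _ => by omega)]

open Classical in
theorem loc_col (hX : Loc X) (hU : Loc U) (f : ℕ) : Loc (col X U f) := by
  induction f with
  | zero => exact loc_const 1
  | succ f ih =>
    have h1 := loc_comp (loc_T ih) (fun x : Fin 3 => if x = 2 then (1 : Fin 3) else 2)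
    have h2 := loc_comp (loc_T ih) (fun x : Fin 3 => if x = 0 then (1 : Fin 3) else 0)
    have := loc_ite hX (loc_const 1) (loc_ite hU h1 h2)
    obtain ⟨N, hN⟩ := this
    refine ⟨N, fun w w' h => ?_⟩
    simpa only [col] using hN w w' h

end col

/-! ### Evaluation on the `n`-ary tree -/

/-- Evaluation of a labelling. -/
def ev {A : Type*} {n : ℕ} (t : (Fin n → A) → A) (d : ℕ → Fin n) : ℕ → ((ℕ → Fin n) → A) → A
  | 0, c => c d
  | k + 1, c => t (fun i => ev t d k (fun w => c (cn i w)))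

section ev
variable {A : Type*} {n : ℕ} {t : (Fin n → A) → A} {d : ℕ → Fin n} {E : A → A → Prop}

theorem ev_const (hidem : ∀ a : A, t (fun _ => a) = a) (k : ℕ) (a : A) :
    ev t d k (fun _ => a) = a := by
  induction k with
  | zero => rfl
  | succ k ih => simp only [ev, ih, hidem]

theorem ev_edge (hcomp : ∀ u v : Fin n → A, (∀ i, E (u i) (v i)) → E (t u) (t v)) (k : ℕ)
    {c c' : (ℕ → Fin n) → A} (h : ∀ w, E (c w) (c' w)) : E (ev t d k c) (ev t d k c') := by
  induction k generalizing c c' with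
  | zero => exact h d
  | succ k ih => exact hcomp _ _ fun i => ih fun w => h _

theorem ev_loc (hidem : ∀ a : A, t (fun _ => a) = a) (N : ℕ) {c : (ℕ → Fin n) → A}
    (h : LocN N c) : ev t d (N + 1) c = ev t d N c := by
  induction N generalizing c with
  | zero =>
    have : c = fun _ => c d := by
      funext w
      exact h _ _ (by simp)
    rw [this, ev_const hidem, ev_const hidem]
  | succ N ih =>
    rw [ev, ev]
    congr 1
    funext i
    refine ih ?_
    intro w w' hw
    refine h _ _ ?_
    intro k hk
    cases k with
    | zero => rfl
    | succ k => exact hw k (by omega)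

theorem ev_cut (hidem : ∀ a : A, t (fun _ => a) = a) (a : Fin n → A) (i : Fin n) (m k : ℕ)
    {c g : (ℕ → Fin n) → A} (h1 : ∀ w, (∀ l < m, w l = i) → c w = a (w m) ∧ g w = t a)
    (h2 : ∀ w, ¬ (∀ l < m, w l = i) → c w = g w) :
    ev t d (m + 1 + k) c = ev t d (m + 1 + k) g := by
  induction m generalizing c g with
  | zero =>
    have hc : c = fun w => a (w 0) := funext fun w => (h1 w (by simp)).1
    have hg : g = fun w => t a := funext fun w => (h1 w (by simp)).2
    rw [hg, ev_const hidem, hc, show 0 + 1 + k = k + 1 by omega, ev]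
    congr 1
    funext j
    exact ev_const hidem k (a j)
  | succ m ih =>
    rw [show m + 1 + 1 + k = (m + 1 + k) + 1 by omega, ev, ev]
    congr 1
    funext j
    by_cases hj : j = i
    · subst hj
      refine ih ?_ ?_
      · intro w hw
        refine h1 (cn j w) ?_
        intro l hl
        cases l with
        | zero => rfl
        | succ l => exact hw l (by omega)
      · intro w hw
        refine h2 _ fun h => hw fun l hl => ?_
        exact h (l + 1) (by omega)
    · congr 1
      funext w
      exact h2 _ fun h => hj (h 0 (by omega))

/-- The abstract loop criterion. -/
theorem loop_of_label [NeZero n] (hidem : ∀ a : A, t (fun _ => a) = a)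
    (hcomp : ∀ u v : Fin n → A, (∀ i, E (u i) (v i)) → E (t u) (t v))
    (α : Fin n → Fin n → A) (hα : ∀ i : Fin n, E (α i i) (t (α i)))
    (m : ℕ) (c : (ℕ → Fin n) → A) (hloc : Loc c)
    (hc : ∀ w, (∀ l < m, w l = w 0) → c w = α (w 0) (w m)) (hm : 0 < m)
    (hE : ∀ w, ¬ (∀ l < m + 1, w l = w 0) → E (c w) (c (T w))) : ∃ a : A, E a a := by
  classical
  obtain ⟨N₀, hN₀⟩ := hloc
  set N := m + 1 + N₀ with hNdef
  have hN : LocN N c := fun w w' h => hN₀ w w' fun k hk => h k (by omega)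
  let d : ℕ → Fin n := fun _ => 0
  let H : (ℕ → Fin n) → A := fun w => if ∀ l < m + 1, w l = w 0 then t (α (w 0)) else c (T w)
  have hEH : ∀ w, E (c w) (H w) := by
    intro w
    by_cases h : ∀ l < m + 1, w l = w 0
    · simp only [H, if_pos h]
      rw [hc w fun l hl => h l (by omega), h m (by omega)]
      exact hα _
    · simp only [H, if_neg h]
      exact hE w h
  have h1 : E (ev t d (N + 1) c) (ev t d (N + 1) H) := ev_edge hcomp _ hEH
  have h2 : ev t d (N + 1) H = ev t d N c := by
    rw [ev]
    have : ∀ i, ev t d N (fun w => H (cn i w)) = ev t d N c := by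
      intro i
      symm
      have key : ∀ w : ℕ → Fin n, (∀ l < m + 1, cn i w l = cn i w 0) ↔ ∀ l < m, w l = i := by
        intro w
        constructor
        · intro h l hl
          exact h (l + 1) (by omega)
        · intro h l hl
          cases l with
          | zero => rfl
          | succ l => exact h l (by omega)
      refine ev_cut hidem (α i) i m N₀ ?_ ?_
      · intro w hw
        have h0 : w 0 = i := hw 0 hm
        constructor
        · rw [hc w (by rw [h0]; exact hw), h0]
        · simp only [H, if_pos ((key w).2 hw)]
          rfl
      · intro w hw
        simp only [H, if_neg (fun h => hw ((key w).1 h))]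
        rfl
    simp only [this, hidem]
  rw [h2, ev_loc hidem N hN] at h1
  exact ⟨_, h1⟩

end ev

/-! ### The labelling -/

section main
variable {A : Type*} {n : ℕ}

/-- Distance to the first run of length at least `M + 1`, capped at `k1 + 1`. -/
noncomputable def ee {n : ℕ} (B M k1 : ℕ) (w : ℕ → Fin n) : ℕ :=
  hit (fun k => M + 1 ≤ rn B (S k w)) (k1 + 1)

/-- Close to a long run. -/
def XX {n : ℕ} (B M k1 : ℕ) (w : ℕ → Fin n) : Prop := ee B M k1 w ≤ k1

/-- The first change of letter goes up. -/
def UU {n : ℕ} (B : ℕ) (w : ℕ → Fin n) : Prop := w 0 < w (rn B w)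

theorem loc_ee (B M k1 : ℕ) : Loc (fun w : ℕ → Fin n => ee B M k1 w) :=
  loc_hit (P := fun w k => M + 1 ≤ rn B (S k w))
    (fun k => loc_comp (loc_S loc_rn k) (fun x => M + 1 ≤ x)) _

theorem loc_XX (B M k1 : ℕ) : Loc (fun w : ℕ → Fin n => XX B M k1 w) :=
  loc_comp (loc_ee B M k1) (· ≤ k1)

theorem loc_rnletter (B : ℕ) : Loc (fun w : ℕ → Fin n => w (rn B w)) :=
  loc_bdd loc_rn B (fun _ => rn_le) (g := fun k w => w k) loc_letter

theorem loc_UU (B : ℕ) : Loc (fun w : ℕ → Fin n => UU B w) :=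
  loc_comp2 (loc_letter 0) (loc_rnletter B) (· < ·)

theorem ee_zero {B M k1 : ℕ} {w : ℕ → Fin n} (h : M + 1 ≤ rn B w) : ee B M k1 w = 0 :=
  hit_eq (by omega) (by simp) (fun _ => h)

theorem rn_of_ee_zero {B M k1 : ℕ} {w : ℕ → Fin n} (h : ee B M k1 w = 0) : M + 1 ≤ rn B w := by
  have := hit_spec (P := fun k => M + 1 ≤ rn B (S k w)) (B := k1 + 1)
    (by unfold ee at h; omega)
  unfold ee at h
  rw [h] at this
  exact this

theorem ee_T {B M k1 : ℕ} {w : ℕ → Fin n} (h : 0 < ee B M k1 w) (h' : ee B M k1 w ≤ k1) :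
    ee B M k1 (T w) = ee B M k1 w - 1 := by
  have hs : M + 1 ≤ rn B (S (ee B M k1 w) w) :=
    hit_spec (P := fun k => M + 1 ≤ rn B (S k w)) (B := k1 + 1) (by unfold ee at h'; omega)
  refine hit_eq (by omega) ?_ ?_
  · intro k hk
    exact hit_lt (P := fun k => M + 1 ≤ rn B (S k w)) (B := k1 + 1) (k := k + 1)
      (by unfold ee at hk h; omega)
  · intro _
    have : S (ee B M k1 w - 1) (T w) = S (ee B M k1 w) w := by
      funext l
      simp only [S, T]
      congr 1
      omega
    rw [this]
    exact hs

theorem ee_T' {B M k1 : ℕ} {w : ℕ → Fin n} (h : k1 < ee B M k1 w) :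
    k1 ≤ ee B M k1 (T w) := by
  by_contra hlt
  have hs : M + 1 ≤ rn B (S (ee B M k1 (T w)) (T w)) :=
    hit_spec (P := fun k => M + 1 ≤ rn B (S k (T w))) (B := k1 + 1) (by unfold ee at hlt; omega)
  exact hit_lt (P := fun k => M + 1 ≤ rn B (S k w)) (B := k1 + 1) (k := ee B M k1 (T w) + 1)
      (by unfold ee at *; omega) hs

theorem ee_le {B M k1 : ℕ} {w : ℕ → Fin n} : ee B M k1 w ≤ k1 + 1 := hit_le _ _

theorem rn_le_of_not_XX {B M k1 : ℕ} {w : ℕ → Fin n} (h : ¬ XX B M k1 w) : rn B w ≤ M := by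
  by_contra h'
  exact h (by unfold XX; rw [ee_zero (by omega)]; omega)

/-- Potential bounding the length of monotone blocks. -/
noncomputable def pot {n : ℕ} (B : ℕ) (w : ℕ → Fin n) : ℕ :=
  open Classical in
  (if UU B w then n - (w 0 : ℕ) else (w 0 : ℕ)) * (B + 1) + rn B w

theorem pot_le (B : ℕ) (w : ℕ → Fin n) : pot B w ≤ n * (B + 1) + B := by
  unfold pot
  have := rn_le (B := B) (w := w)
  have h2 := (w 0).2
  refine Nat.add_le_add (Nat.mul_le_mul_right _ ?_) this
  split_ifs <;> omega

theorem pot_U {B : ℕ} {w : ℕ → Fin n} (hB : 0 < B) (h : rn B w < B) (hu : UU B w)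
    (hu' : UU B (T w)) : pot B (T w) < pot B w := by
  have hp := rn_pos (w := w) hB
  unfold pot
  rw [if_pos hu, if_pos hu']
  rcases Nat.lt_or_ge 1 (rn B w) with h1 | h1
  · rw [rn_T h1 h]
    have : T w 0 = w 0 := rn_lt h1
    rw [this]
    omega
  · have h1 : rn B w = 1 := by omega
    unfold UU at hu
    rw [h1] at hu
    have e : T w 0 = w 1 := rfl
    have := rn_le (B := B) (w := T w)
    rw [e, h1]
    have hu : (w 0 : ℕ) < w 1 := hu
    have h2 := (w 1).2
    have : (n - (w 1 : ℕ) + 1) * (B + 1) ≤ (n - (w 0 : ℕ)) * (B + 1) :=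
      Nat.mul_le_mul_right _ (by omega)
    rw [Nat.add_mul] at this
    omega

theorem pot_D {B : ℕ} {w : ℕ → Fin n} (hB : 0 < B) (h : rn B w < B) (hu : ¬ UU B w)
    (hu' : ¬ UU B (T w)) : pot B (T w) < pot B w := by
  have hp := rn_pos (w := w) hB
  have hs := rn_spec h
  unfold pot
  rw [if_neg hu, if_neg hu']
  rcases Nat.lt_or_ge 1 (rn B w) with h1 | h1
  · rw [rn_T h1 h]
    have : T w 0 = w 0 := rn_lt h1
    rw [this]
    omega
  · have h1 : rn B w = 1 := by omega
    unfold UU at hu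
    rw [h1] at hu hs
    have hu : w 1 < w 0 := lt_of_le_of_ne (not_lt.1 hu) hs
    have e : T w 0 = w 1 := rfl
    have := rn_le (B := B) (w := T w)
    rw [e, h1]
    have hu : (w 1 : ℕ) < w 0 := hu
    have : ((w 1 : ℕ) + 1) * (B + 1) ≤ (w 0 : ℕ) * (B + 1) :=
      Nat.mul_le_mul_right _ (by omega)
    rw [Nat.add_mul] at this
    omega

/-- The final colouring. -/
noncomputable def cl {n : ℕ} (B M k1 : ℕ) (w : ℕ → Fin n) : Fin 3 :=
  col (XX B M k1) (UU B) (n * (B + 1) + B) w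

theorem loc_cl (B M k1 : ℕ) : Loc (fun w : ℕ → Fin n => cl B M k1 w) :=
  loc_col (loc_XX B M k1) (loc_UU B) _

theorem cl_ne {B M k1 : ℕ} (hB : M < B) {w : ℕ → Fin n} (h : ¬ XX B M k1 w) :
    cl B M k1 w ≠ cl B M k1 (T w) := by
  unfold cl
  rw [col_stab (pot B) ?_ ?_ ?_ _ w (fun _ => pot_le B w)]
  · exact col_ne h
  · intro w _
    have := rn_pos (B := B) (w := w) (by omega)
    unfold pot
    omega
  · intro w hw _ hu hu'
    have := rn_le_of_not_XX hw
    exact pot_U (by omega) (by omega) hu hu'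
  · intro w hw _ hu hu'
    have := rn_le_of_not_XX hw
    exact pot_D (by omega) (by omega) hu hu'

open Classical in
/-- Labels of words starting with a long run. -/
noncomputable def c1 (V : A → A → ℕ → ℕ → A) (α : Fin n → Fin n → A) (tri : Fin 3 → A)
    (B M k0 k1 : ℕ) (w : ℕ → Fin n) : A :=
  if rn B w = B then V (α (w 0) (w 0)) (tri 1) k0 0
  else V (α (w 0) (w (rn B w))) (tri (cl B M k1 (S (rn B w - M) w))) k0 (M + k0 - rn B w)

open Classical in
/-- Labels of all words. -/
noncomputable def cc (V : A → A → ℕ → ℕ → A) (α : Fin n → Fin n → A) (tri : Fin 3 → A)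
    (B M k0 k1 : ℕ) (w : ℕ → Fin n) : A :=
  if ee B M k1 w ≤ k1 then
    V (tri 1) (c1 V α tri B M k0 k1 (S (ee B M k1 w) w)) k1 (k1 - ee B M k1 w)
  else tri (cl B M k1 w)

theorem loc_c1 (V : A → A → ℕ → ℕ → A) (α : Fin n → Fin n → A) (tri : Fin 3 → A)
    (B M k0 k1 : ℕ) : Loc (c1 V α tri B M k0 k1) := by
  unfold c1
  refine loc_ite (p := fun w => rn B w = B) (loc_comp loc_rn (· = B))
    (loc_comp (loc_letter 0) (fun i => V (α i i) (tri 1) k0 0)) ?_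
  have h1 : Loc (fun w : ℕ → Fin n => cl B M k1 (S (rn B w - M) w)) :=
    loc_bdd loc_rn B (fun _ => rn_le) (g := fun k w => cl B M k1 (S (k - M) w))
      (fun k => loc_S (loc_cl B M k1) _)
  exact loc_comp2 (loc_comp2 (loc_letter 0) (loc_rnletter B) α)
    (loc_comp2 h1 loc_rn Prod.mk) (fun a x => V a (tri x.1) k0 (M + k0 - x.2))

theorem loc_cc (V : A → A → ℕ → ℕ → A) (α : Fin n → Fin n → A) (tri : Fin 3 → A)
    (B M k0 k1 : ℕ) : Loc (cc V α tri B M k0 k1) := by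
  unfold cc
  refine loc_ite (p := fun w => ee B M k1 w ≤ k1) (loc_XX B M k1) ?_ (loc_comp (loc_cl B M k1) tri)
  exact loc_bdd (loc_ee B M k1) (k1 + 1) (fun _ => ee_le)
    (g := fun k w => V (tri 1) (c1 V α tri B M k0 k1 (S k w)) k1 (k1 - k))
    (fun k => loc_comp (loc_S (loc_c1 V α tri B M k0 k1) k) (fun x => V (tri 1) x k1 (k1 - k)))

theorem S_T (w : ℕ → Fin n) (k : ℕ) : S k (T w) = S (k + 1) w := rfl

/-- The loop lemma for symmetric graphs with a triangle. -/
theorem loop_tri [NeZero n] (t : (Fin n → A) → A) (E : A → A → Prop)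
    (hsymm : ∀ u v : A, E u v → E v u)
    (hidem : ∀ a : A, t (fun _ => a) = a)
    (hcomp : ∀ u v : Fin n → A, (∀ i, E (u i) (v i)) → E (t u) (t v))
    (hconn : ∀ u v : A, ∃ k, HasWalk E u v k)
    {x y z : A} (h1 : E x y) (h2 : E y z) (h3 : E z x)
    (α : Fin n → Fin n → A)
    (hα : ∀ i : Fin n, E (α i i) (t (α i))) :
    ∃ a : A, E a a := by
  classical
  let tri : Fin 3 → A := ![x, y, z]
  have htri : ∀ p q : Fin 3, p ≠ q → E (tri p) (tri q) := by
    intro p q hpq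
    fin_cases p <;> fin_cases q <;> simp_all [tri]
  obtain ⟨V, hV⟩ : ∃ V : A → A → ℕ → ℕ → A, ∀ a b k, HasWalk E a b k →
      V a b k 0 = a ∧ V a b k k = b ∧ ∀ i < k, E (V a b k i) (V a b k (i + 1)) := by
    refine ⟨fun a b k => if h : HasWalk E a b k then h.choose else fun _ => a, ?_⟩
    intro a b k h
    simp only [dif_pos h]
    exact h.choose_spec
  obtain ⟨K0, hK0⟩ := hw_unif hsymm hconn h1 h2 h3
    (ι := Fin n × Fin n × Fin 3) (fun p => α p.1 p.2.1) (fun p => tri p.2.2)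
  let k0 := K0 + 1
  have hk0 : ∀ i j p, HasWalk E (α i j) (tri p) k0 := fun i j p => hK0 k0 (by omega) (i, j, p)
  obtain ⟨k1, hK1⟩ := hw_unif hsymm hconn h1 h2 h3
    (ι := (Fin n × Fin n × Fin 3) × Fin (k0 + 1)) (fun _ => tri 1)
    (fun p => V (α p.1.1 p.1.2.1) (tri p.1.2.2) k0 p.2)
  have hk1 : ∀ i j p q, q ≤ k0 → HasWalk E (tri 1) (V (α i j) (tri p) k0 q) k1 :=
    fun i j p q hq => hK1 k1 le_rfl ((i, j, p), ⟨q, by omega⟩)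
  obtain ⟨M, hM⟩ : ∃ M, M = k1 + 1 := ⟨_, rfl⟩
  obtain ⟨B, hB⟩ : ∃ B, B = M + k0 + 1 := ⟨_, rfl⟩
  have hk0pos : 0 < k0 := Nat.succ_pos _
  clear_value k0
  have hw1 : ∀ w : ℕ → Fin n, M + 1 ≤ rn B w →
      HasWalk E (tri 1) (c1 V α tri B M k0 k1 w) k1 := by
    intro w hw
    unfold c1
    split_ifs
    · exact hk1 _ _ _ _ (by omega)
    · exact hk1 _ _ _ _ (by omega)
  have hwe : ∀ w : ℕ → Fin n, ee B M k1 w ≤ k1 →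
      HasWalk E (tri 1) (c1 V α tri B M k0 k1 (S (ee B M k1 w) w)) k1 := by
    intro w hw
    exact hw1 _ (hit_spec (P := fun k => M + 1 ≤ rn B (S k w)) (B := k1 + 1)
      (by unfold ee at hw; omega))
  have hcc0 : ∀ w : ℕ → Fin n, M + 1 ≤ rn B w →
      cc V α tri B M k0 k1 w = c1 V α tri B M k0 k1 w := by
    intro w hw
    unfold cc
    rw [ee_zero hw, if_pos (by omega)]
    exact (hV _ _ _ (hw1 w hw)).2.1
  have hrun : ∀ (w : ℕ → Fin n) (l : ℕ), l ≤ B → (∀ k < l, w k = w 0) → l ≤ rn B w := by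
    intro w l hl h
    by_contra hlt
    exact rn_spec (by omega) (h _ (not_le.1 hlt))
  refine loop_of_label hidem hcomp α hα (M + k0) (cc V α tri B M k0 k1)
    (loc_cc V α tri B M k0 k1) ?_ (by omega) ?_
  · intro w hw
    have hr := hrun w _ (by omega) hw
    rw [hcc0 w (by omega)]
    unfold c1
    split_ifs with hrB
    · rw [(hV _ _ _ (hk0 _ _ _)).1, rn_lt (by omega : M + k0 < rn B w)]
    · have := rn_le (B := B) (w := w)
      have hr : rn B w = M + k0 := by omega
      rw [hr, Nat.sub_self, (hV _ _ _ (hk0 _ _ _)).1]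
  · intro w hw
    have hr : rn B w ≤ M + k0 := by
      by_contra h
      exact hw fun l hl => rn_lt (B := B) (by omega)
    have hle := ee_le (B := B) (M := M) (k1 := k1) (w := w)
    rcases Nat.lt_or_ge k1 (ee B M k1 w) with he | he
    · have hX : ¬ XX B M k1 w := by unfold XX; omega
      have hne := cl_ne (by omega) hX
      have hT := ee_T' he
      have hleT := ee_le (B := B) (M := M) (k1 := k1) (w := T w)
      have hcw : cc V α tri B M k0 k1 w = tri (cl B M k1 w) := by
        unfold cc; rw [if_neg (by omega)]
      rw [hcw]
      rcases Nat.lt_or_ge k1 (ee B M k1 (T w)) with he' | he'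
      · have : cc V α tri B M k0 k1 (T w) = tri (cl B M k1 (T w)) := by
          unfold cc; rw [if_neg (by omega)]
        rw [this]
        exact htri _ _ hne
      · have hc : cl B M k1 (T w) = 1 := col_X he'
        have : cc V α tri B M k0 k1 (T w) = tri 1 := by
          unfold cc
          rw [if_pos he', show k1 - ee B M k1 (T w) = 0 by omega]
          exact (hV _ _ _ (hwe _ he')).1
        rw [this]
        rw [hc] at hne
        exact htri _ _ hne
    · rcases Nat.eq_zero_or_pos (ee B M k1 w) with h0 | h0
      · have hrM := rn_of_ee_zero h0
        rw [hcc0 w hrM]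
        have hrT : rn B (T w) = rn B w - 1 := rn_T (by omega) (by omega)
        have hw0 : T w 0 = w 0 := rn_lt (B := B) (by omega : 1 < rn B w)
        have hwk := hV _ _ _ (hk0 (w 0) (w (rn B w)) (cl B M k1 (S (rn B w - M) w)))
        have hstep := hwk.2.2 (M + k0 - rn B w) (by omega)
        have e1 : c1 V α tri B M k0 k1 w = V (α (w 0) (w (rn B w)))
            (tri (cl B M k1 (S (rn B w - M) w))) k0 (M + k0 - rn B w) := by
          unfold c1; rw [if_neg (by omega)]
        rw [e1]
        rcases Nat.lt_or_ge (M + 1) (rn B w) with h5 | h5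
        · rw [hcc0 (T w) (by omega)]
          have e2 : c1 V α tri B M k0 k1 (T w) = V (α (w 0) (w (rn B w)))
              (tri (cl B M k1 (S (rn B w - M) w))) k0 (M + k0 - rn B w + 1) := by
            unfold c1
            rw [if_neg (by omega), hw0, hrT, S_T,
              show rn B w - 1 - M + 1 = rn B w - M by omega,
              show M + k0 - (rn B w - 1) = M + k0 - rn B w + 1 by omega]
            have : T w (rn B w - 1) = w (rn B w) := by
              unfold T
              rw [show rn B w - 1 + 1 = rn B w by omega]
            rw [this]
          rw [e2]
          exact hstep
        · have h5 : rn B w = M + 1 := by omega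
          have heT : ee B M k1 (T w) = k1 + 1 := by
            refine hit_eq le_rfl ?_ (by omega)
            intro k hk
            rw [rn_S (by omega) (by omega)]
            omega
          have e2 : cc V α tri B M k0 k1 (T w) = tri (cl B M k1 (T w)) := by
            unfold cc; rw [if_neg (by omega)]
          rw [show M + k0 - rn B w + 1 = k0 by omega, hwk.2.1] at hstep
          rw [e2]
          have : S (rn B w - M) w = T w := by
            rw [show rn B w - M = 1 by omega]; rfl
          rw [this] at hstep ⊢
          exact hstep
      · have hT := ee_T h0 he
        have e2 : cc V α tri B M k0 k1 (T w) =
            V (tri 1) (c1 V α tri B M k0 k1 (S (ee B M k1 w) w)) k1 (k1 - ee B M k1 w + 1) := by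
          unfold cc
          rw [hT, if_pos (by omega), S_T, show ee B M k1 w - 1 + 1 = ee B M k1 w by omega,
            show k1 - (ee B M k1 w - 1) = k1 - ee B M k1 w + 1 by omega]
        have e1 : cc V α tri B M k0 k1 w =
            V (tri 1) (c1 V α tri B M k0 k1 (S (ee B M k1 w) w)) k1 (k1 - ee B M k1 w) := by
          unfold cc
          rw [if_pos he]
        rw [e1, e2]
        exact (hV _ _ _ (hwe w he)).2.2 _ (by omega)

end main

end LocalLoop

/-- Local loop lemma, undirected version: if an idempotent `n`-ary operation `t` is compatible
with a connected non-bipartite undirected graph `G`, and there are vertices `α i j` with an edge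
from `α i i` to `t (α i 0, …, α i (n-1))` for every `i`, then `G` has a loop. -/
theorem local_loop_lemma_undirected {A : Type*} {n : ℕ} (t : (Fin n → A) → A)
    (E : A → A → Prop)
    (hsymm : ∀ u v : A, E u v → E v u)
    (hidem : ∀ a : A, t (fun _ => a) = a)
    (hcomp : ∀ u v : Fin n → A, (∀ i, E (u i) (v i)) → E (t u) (t v))
    (hconn : ∀ u v : A, ∃ k, HasWalk E u v k)
    (hodd : ∃ u : A, ∃ k, Odd k ∧ HasWalk E u u k)
    (α : Fin n → Fin n → A)
    (hα : ∀ i : Fin n, E (α i i) (t (α i))) :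
    ∃ a : A, E a a := by
  classical
  rcases Nat.eq_zero_or_pos n with hn | hn
  · subst hn
    exact ⟨_, hcomp Fin.elim0 Fin.elim0 (fun i => i.elim0)⟩
  have : NeZero n := ⟨by omega⟩
  have hex : ∃ k, Odd k ∧ ∃ u, HasWalk E u u k := by
    obtain ⟨u, k, hk, h⟩ := hodd
    exact ⟨k, hk, u, h⟩
  obtain ⟨hko, u, hu⟩ := Nat.find_spec hex
  have hmin := fun l => Nat.find_min hex (m := l)
  generalize Nat.find hex = k at hko hu hmin
  obtain ⟨j, rfl⟩ := hko
  cases j with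
  | zero =>
    obtain ⟨w, h0, h1, h⟩ := hu
    have := h 0 (by omega)
    rw [h0, show w (0 + 1) = u from h1] at this
    exact ⟨u, this⟩
  | succ j =>
    exfalso
    have hE : ∀ a b, E a b → HasWalk E a b (2 * j + 1) := fun a b h =>
      LocalLoop.hw_odd hsymm h j
    obtain ⟨v, huv, hv⟩ := LocalLoop.hw_uncons hu
    obtain ⟨x, hvx, hx⟩ := LocalLoop.hw_uncons
      (show HasWalk E v u (2 * j + 1 + 1) from hv)
    obtain ⟨a, ha⟩ := LocalLoop.loop_tri t (fun a b => HasWalk E a b (2 * j + 1))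
      (fun a b h => LocalLoop.hw_symm hsymm h) hidem
      (by
        intro p q h
        choose w h0 h1 h2 using h
        refine ⟨fun l => t (fun i => w i l), ?_, ?_, ?_⟩
        · simp only [h0]
        · simp only [h1]
        · intro l hl
          exact hcomp _ _ fun i => h2 i l hl)
      (by
        intro a b
        obtain ⟨k, hk⟩ := hconn a b
        exact ⟨k, LocalLoop.hw_mono hE hk⟩)
      (hE _ _ huv) (hE _ _ hvx) hx α (fun i => hE _ _ (hα i))
    exact hmin (2 * j + 1) (by omega) ⟨⟨j, rfl⟩, a, ha⟩
end

section
/- Let G be an undirected graph on a set A containing a cycle of odd length, and let t be an idempotent operation compatible with G. Suppose some vertex a lying on an odd cycle has the property that its neighborhood N(a) absorbs {a} with respect to t (i.e., applying t to any tuple of neighbors of a with at most one entry replaced by a yields a neighbor of a). Then G contains a loop. -/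
namespace LLQ

/-- Prepend a letter to an infinite word. -/
def cons {α : Type*} (i : α) (x : ℕ → α) : ℕ → α
  | 0 => i
  | j + 1 => x j

/-- Drop `k` letters. -/
def sh {α : Type*} (k : ℕ) (x : ℕ → α) : ℕ → α := fun j => x (k + j)

/-- The word is constant on the first `r` letters. -/
def Cst {n : ℕ} (r : ℕ) (x : ℕ → Fin n) : Prop := ∀ j < r, x j = x 0

/-- Marker. -/
def Mk {n : ℕ} (h : ℕ) (x : ℕ → Fin n) : Prop :=
  x (h + 2) < x (h + 1) ∧ x (h + 2) ≤ x (h + 3)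

/-- Event at the head of the word. -/
def Ev {n : ℕ} (h : ℕ) (x : ℕ → Fin n) : Prop := Cst (h + 4) x ∨ Mk h x

theorem cst_congr {n : ℕ} {r : ℕ} {x y : ℕ → Fin n} (hxy : ∀ j < r, x j = y j) (hx : Cst r x) :
    Cst r y := by
  intro j hj
  rw [← hxy j hj, ← hxy 0 (by omega)]
  exact hx j hj

theorem ev_congr {n : ℕ} {h : ℕ} {x y : ℕ → Fin n} (hxy : ∀ j < h + 4, x j = y j) (hx : Ev h x) :
    Ev h y := by
  rcases hx with hx | hx
  · exact Or.inl (cst_congr hxy hx)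
  · right
    unfold Mk at *
    rw [← hxy _ (by omega), ← hxy _ (by omega), ← hxy _ (by omega)]
    exact hx

theorem exists_ev {n : ℕ} (h : ℕ) (x : ℕ → Fin n) :
    ∃ k, k ≤ n * (h + 4) + n + h + 4 ∧ Ev h (sh k x) := by
  by_contra hcon
  push Not at hcon
  have hM : ∀ k ≤ n * (h + 4) + n + h + 4, ¬ Mk h (sh k x) :=
    fun k hk hm => hcon k hk (Or.inr hm)
  have hC : ∀ k ≤ n * (h + 4) + n + h + 4, ¬ Cst (h + 4) (sh k x) :=
    fun k hk hm => hcon k hk (Or.inl hm)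
  have hM' : ∀ k ≤ n * (h + 4) + n, x (k + h + 2) < x (k + h + 1) →
      x (k + h + 3) < x (k + h + 2) := by
    intro k hk h1
    by_contra h2
    apply hM k (by omega)
    unfold Mk sh
    exact ⟨h1, not_lt.1 h2⟩
  -- no descents
  have hnd : ∀ k ≤ n * (h + 4), x (k + h + 1) ≤ x (k + h + 2) := by
    intro k hk
    by_contra h1
    have h1 := not_le.1 h1
    have key : ∀ m ≤ n, x (k + m + h + 2) < x (k + m + h + 1) ∧
        (x (k + m + h + 1) : ℕ) + m ≤ x (k + h + 1) := by
      intro m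
      induction m with
      | zero => intro _; exact ⟨h1, le_rfl⟩
      | succ m ih =>
        intro hm
        obtain ⟨i1, i2⟩ := ih (by omega)
        have := hM' (k + m) (by omega) i1
        have e1 : k + (m + 1) + h + 2 = k + m + h + 3 := by omega
        have e2 : k + (m + 1) + h + 1 = k + m + h + 2 := by omega
        rw [e1, e2]
        refine ⟨this, ?_⟩
        have : (x (k + m + h + 2) : ℕ) < x (k + m + h + 1) := i1
        omega
    have := (key n le_rfl).2
    have := (x (k + h + 1)).2
    omega
  have hmono : ∀ k m, k + m ≤ n * (h + 4) + 1 → x (k + h + 1) ≤ x (k + m + h + 1) := by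
    intro k m
    induction m with
    | zero => intro _; exact le_rfl
    | succ m ih =>
      intro hm
      have h2 := hnd (k + m) (by omega)
      rw [show k + (m + 1) + h + 1 = k + m + h + 2 by omega]
      exact (ih (by omega)).trans h2
  have hgrow : ∀ m ≤ n, m ≤ (x (m * (h + 4) + h + 1) : ℕ) := by
    intro m
    induction m with
    | zero => intro _; exact Nat.zero_le _
    | succ m ih =>
      intro hm
      have i1 := ih (by omega)
      have hmn : (m + 1) * (h + 4) ≤ n * (h + 4) := Nat.mul_le_mul_right _ hm
      rw [Nat.add_mul, Nat.one_mul] at hmn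
      have hc := hC (m * (h + 4) + h + 1) (by omega)
      unfold Cst sh at hc
      push Not at hc
      obtain ⟨j, hj, hne⟩ := hc
      have m1 := hmono (m * (h + 4)) j (by omega)
      have m2 := hmono (m * (h + 4) + j) (h + 4 - j) (by omega)
      have e1 : m * (h + 4) + j + (h + 4 - j) + h + 1 = (m + 1) * (h + 4) + h + 1 := by
        rw [Nat.add_mul]; omega
      rw [e1] at m2
      have e2 : m * (h + 4) + h + 1 + j = m * (h + 4) + j + h + 1 := by omega
      rw [e2, Nat.add_zero] at hne
      have m3 : x (m * (h + 4) + h + 1) < x (m * (h + 4) + j + h + 1) :=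
        lt_of_le_of_ne m1 (Ne.symm hne)
      have m4 : (x (m * (h + 4) + h + 1) : ℕ) < x ((m + 1) * (h + 4) + h + 1) :=
        lt_of_lt_of_le m3 m2
      omega
  have := hgrow n le_rfl
  have := (x (n * (h + 4) + h + 1)).2
  omega

open Classical in
/-- offset of the first event -/
noncomputable def fe {n : ℕ} (h : ℕ) (x : ℕ → Fin n) : ℕ :=
  Nat.find (p := fun k => Ev h (sh k x)) ((exists_ev h x).imp fun _ hk => hk.2)

open Classical in
theorem fe_eq {n : ℕ} {h : ℕ} {x : ℕ → Fin n} {k : ℕ} (hk : Ev h (sh k x))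
    (hlt : ∀ j < k, ¬ Ev h (sh j x)) : fe h x = k := by
  unfold fe
  rw [Nat.find_eq_iff]
  exact ⟨hk, hlt⟩

open Classical in
theorem fe_spec {n : ℕ} (h : ℕ) (x : ℕ → Fin n) : Ev h (sh (fe h x) x) := by
  unfold fe
  exact Nat.find_spec (p := fun k => Ev h (sh k x)) _

open Classical in
theorem fe_min {n : ℕ} (h : ℕ) (x : ℕ → Fin n) {j : ℕ} (hj : j < fe h x) : ¬ Ev h (sh j x) := by
  unfold fe at hj
  exact Nat.find_min (p := fun k => Ev h (sh k x)) _ hj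

theorem fe_le {n : ℕ} (h : ℕ) (x : ℕ → Fin n) : fe h x ≤ n * (h + 4) + n + h + 4 := by
  obtain ⟨k, hk, hE⟩ := exists_ev h x
  by_contra hlt
  exact fe_min h x (j := k) (by omega) hE

open Classical in
/-- index of the event at the head -/
noncomputable def ei {n : ℕ} (h : ℕ) (x : ℕ → Fin n) : ℕ :=
  Nat.find (p := fun e => h ≤ e ∨ Cst (2 * h + 4 - e) x) ⟨h, Or.inl le_rfl⟩

open Classical in
theorem ei_eq {n : ℕ} {h : ℕ} {x : ℕ → Fin n} {e : ℕ} (he : h ≤ e ∨ Cst (2 * h + 4 - e) x)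
    (hlt : ∀ j < e, ¬ (h ≤ j ∨ Cst (2 * h + 4 - j) x)) : ei h x = e := by
  unfold ei
  rw [Nat.find_eq_iff]
  exact ⟨he, hlt⟩

open Classical in
theorem ei_spec {n : ℕ} (h : ℕ) (x : ℕ → Fin n) :
    h ≤ ei h x ∨ Cst (2 * h + 4 - ei h x) x := by
  unfold ei
  exact Nat.find_spec (p := fun e => h ≤ e ∨ Cst (2 * h + 4 - e) x) _

open Classical in
theorem ei_min {n : ℕ} (h : ℕ) (x : ℕ → Fin n) {j : ℕ} (hj : j < ei h x) :
    ¬ (h ≤ j ∨ Cst (2 * h + 4 - j) x) := by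
  unfold ei at hj
  exact Nat.find_min (p := fun e => h ≤ e ∨ Cst (2 * h + 4 - e) x) _ hj

theorem ei_le {n : ℕ} (h : ℕ) (x : ℕ → Fin n) : ei h x ≤ h := by
  by_contra hlt
  exact ei_min h x (j := h) (by omega) (Or.inl le_rfl)

theorem ei_congr {n : ℕ} {h : ℕ} {x y : ℕ → Fin n} (hxy : ∀ j < 2 * h + 4, x j = y j) :
    ei h x = ei h y := by
  symm
  apply ei_eq
  · rcases ei_spec h x with h1 | h1
    · exact Or.inl h1
    · exact Or.inr (cst_congr (fun j hj => hxy j (by omega)) h1)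
  · intro j hj h1
    apply ei_min h x hj
    rcases h1 with h1 | h1
    · exact Or.inl h1
    · exact Or.inr (cst_congr (fun j hj => (hxy j (by omega)).symm) h1)

/-- the label index -/
noncomputable def ind {n : ℕ} (h : ℕ) (x : ℕ → Fin n) : ℕ := ei h (sh (fe h x) x) + fe h x

theorem ind_congr {n : ℕ} {h : ℕ} {x y : ℕ → Fin n}
    (hxy : ∀ j < n * (h + 4) + n + h + 4 + (2 * h + 4), x j = y j) : ind h x = ind h y := by
  have hb := fe_le h x
  have hf : fe h y = fe h x := by
    apply fe_eq
    · exact ev_congr (fun j hj => hxy _ (by omega)) (fe_spec h x)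
    · intro j hj h1
      exact fe_min h x hj (ev_congr (fun i hi => (hxy _ (by omega)).symm) h1)
  unfold ind
  rw [hf, ei_congr (x := sh (fe h x) x) (y := sh (fe h x) y)]
  intro j hj
  exact hxy _ (by omega)

theorem sh_zero {α : Type*} (x : ℕ → α) : sh 0 x = x := by
  funext j; simp [sh]

theorem sh_succ {α : Type*} (k : ℕ) (x : ℕ → α) : sh (k + 1) x = sh k (sh 1 x) := by
  funext j; simp only [sh]; congr 1; omega

theorem ind_of_ev {n : ℕ} {h : ℕ} {x : ℕ → Fin n} (hx : Ev h x) : ind h x = ei h x := by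
  have : fe h x = 0 := fe_eq (by rwa [sh_zero]) (by intro j hj; omega)
  unfold ind
  rw [this, sh_zero]; rfl

theorem ind_of_not_ev {n : ℕ} {h : ℕ} {x : ℕ → Fin n} (hx : ¬ Ev h x) :
    ind h x = ind h (sh 1 x) + 1 := by
  have : fe h x = fe h (sh 1 x) + 1 := by
    apply fe_eq
    · rw [sh_succ]; exact fe_spec h _
    · intro j hj
      cases j with
      | zero => rwa [sh_zero]
      | succ j => rw [sh_succ]; exact fe_min h _ (by omega)
  unfold ind
  rw [this, sh_succ]; omega

theorem cst_mono {n : ℕ} {r s : ℕ} {x : ℕ → Fin n} (hrs : r ≤ s) (hx : Cst s x) : Cst r x :=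
  fun j hj => hx j (by omega)

/-- Main combinatorial step. -/
theorem ind_step {n : ℕ} {h : ℕ} (h1 : 1 ≤ h) (x : ℕ → Fin n) (hx : ¬ Cst (2 * h + 4) x) :
    ind h x = ind h (sh 1 x) + 1 ∨ ind h (sh 1 x) = ind h x + 1 ∨
      (ind h x = h ∧ h < ind h (sh 1 x)) := by
  by_cases hE : Ev h x
  · right
    rw [ind_of_ev hE]
    rcases Nat.lt_or_ge (ei h x) h with hlt | hge
    · left
      have hc : Cst (2 * h + 4 - ei h x) x := by
        rcases ei_spec h x with h2 | h2
        · omega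
        · exact h2
      have hpos : ei h x ≠ 0 := by
        intro h0
        rw [h0] at hc
        exact hx hc
      have hs : Cst (2 * h + 4 - (ei h x + 1)) (sh 1 x) := by
        intro j hj
        simp only [sh]
        rw [hc _ (by omega), hc (1 + 0) (by omega)]
      have hE' : Ev h (sh 1 x) := Or.inl (cst_mono (by omega) hs)
      rw [ind_of_ev hE']
      apply ei_eq
      · exact Or.inr hs
      · intro j hj h2
        rcases h2 with h2 | h2
        · omega
        · apply ei_min h x (j := ei h x - 1) (by omega)
          right
          intro i hi
          cases i with
          | zero => rfl
          | succ i =>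
            have a1 := h2 i (by omega)
            simp only [sh] at a1
            rw [Nat.add_comm i 1, a1]
            exact hc (1 + 0) (by omega)
    · right
      have hei : ei h x = h := le_antisymm (ei_le h x) hge
      refine ⟨hei, ?_⟩
      have hnc : ¬ Cst (h + 5) x := by
        intro hc
        apply ei_min h x (j := h - 1) (by omega)
        right
        exact cst_mono (by omega) hc
      have hs := fe_spec h (sh 1 x)
      unfold ind
      generalize fe h (sh 1 x) = k at *
      by_cases hC : Cst (h + 4) (sh k (sh 1 x))
      · by_contra hle
        have hk : k ≤ h := by omega
        have hC' : ∀ j < h + 4, x (1 + (k + j)) = x (1 + (k + 0)) := hC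
        rcases hE with hE | hE
        · apply hnc
          intro j hj
          rcases Nat.lt_or_ge j (h + 4) with h3 | h3
          · exact hE j h3
          · have := hC' (j - 1 - k) (by omega)
            rw [show 1 + (k + (j - 1 - k)) = j by omega] at this
            rw [this]
            exact hE _ (by omega)
        · have a1 := hC' (h - k) (by omega)
          have a2 := hC' (h - k + 1) (by omega)
          rw [show 1 + (k + (h - k)) = h + 1 by omega] at a1
          rw [show 1 + (k + (h - k + 1)) = h + 2 by omega] at a2
          have := hE.1
          rw [a1, a2] at this
          exact lt_irrefl _ this
      · have hM : Mk h (sh k (sh 1 x)) := by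
          rcases hs with hs | hs
          · exact absurd hs hC
          · exact hs
        have e1 : ei h (sh k (sh 1 x)) = h := by
          apply ei_eq (Or.inl le_rfl)
          intro j hj h2
          rcases h2 with h2 | h2
          · omega
          · exact hC (cst_mono (by omega) h2)
        rw [e1]
        have hk : k ≠ 0 := by
          rintro rfl
          rw [sh_zero] at hM
          have a1 : x (1 + (h + 2)) < x (1 + (h + 1)) := hM.1
          rw [show 1 + (h + 2) = h + 3 by omega, show 1 + (h + 1) = h + 2 by omega] at a1
          rcases hE with hE | hE
          · rw [hE (h + 3) (by omega), hE (h + 2) (by omega)] at a1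
            exact lt_irrefl _ a1
          · exact absurd hE.2 (not_le.2 a1)
        omega
  · left
    exact ind_of_not_ev hE

/-- Evaluation of the full `t`-tree of height `k` below the prefix of length `m` of `x`. -/
noncomputable def eva {A : Type*} {n : ℕ} (t : (Fin n → A) → A) (F : (ℕ → Fin n) → A) :
    ℕ → ℕ → (ℕ → Fin n) → A
  | 0, _, x => F x
  | k + 1, m, x => t fun l => eva t F k (m + 1) (Function.update x m l)

theorem eva_const {A : Type*} {n : ℕ} {t : (Fin n → A) → A} (hidem : ∀ b : A, t (fun _ => b) = b)
    {F : (ℕ → Fin n) → A} {c : A} (k m : ℕ) (x : ℕ → Fin n)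
    (hF : ∀ y, (∀ j < m, y j = x j) → F y = c) : eva t F k m x = c := by
  induction k generalizing m x with
  | zero => exact hF x (fun _ _ => rfl)
  | succ k ih =>
    simp only [eva]
    have : (fun l => eva t F k (m + 1) (Function.update x m l)) = fun _ => c := by
      funext l
      apply ih
      intro y hy
      apply hF
      intro j hj
      rw [hy j (by omega), Function.update_of_ne (by omega)]
    rw [this, hidem]

theorem eva_mem {A : Type*} {n : ℕ} {t : (Fin n → A) → A}
    {F : (ℕ → Fin n) → A} {S : A → Prop} (hS : ∀ u : Fin n → A, (∀ i, S (u i)) → S (t u))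
    (hF : ∀ y, S (F y)) (k m : ℕ) (x : ℕ → Fin n) : S (eva t F k m x) := by
  induction k generalizing m x with
  | zero => exact hF x
  | succ k ih => exact hS _ fun l => ih _ _

theorem cons_update {α : Type*} (i l : α) (x : ℕ → α) (m : ℕ) :
    Function.update (cons i x) (m + 1) l = cons i (Function.update x m l) := by
  funext j
  cases j with
  | zero => rw [Function.update_of_ne (by omega)]; rfl
  | succ j =>
    by_cases hj : j = m
    · subst hj; simp [cons]
    · rw [Function.update_of_ne (by omega)]; simp [cons, hj]

theorem sh_cons {α : Type*} (i : α) (x : ℕ → α) : sh 1 (cons i x) = x := by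
  funext j
  simp only [sh]
  rw [Nat.add_comm]; rfl

theorem core {A : Type*} {n : ℕ} (E : A → A → Prop)
    (hsymm : ∀ u v : A, E u v → E v u)
    (t : (Fin n → A) → A)
    (hidem : ∀ b : A, t (fun _ => b) = b)
    (hcomp : ∀ u v : Fin n → A, (∀ i, E (u i) (v i)) → E (t u) (t v))
    (S : A → Prop) (hS : ∀ u : Fin n → A, (∀ i, S (u i)) → S (t u))
    (p : ℕ → A) (h : ℕ) (h1 : 1 ≤ h) (hpS : ∀ j, S (p j))
    (hp : ∀ j, E (p j) (p (j + 1))) (hz : ∀ j, h < j → E (p h) (p j))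
    (hab : ∀ i, E (p 0) (t (fun j => if j = i then p 0 else p 1))) : ∃ u, S u ∧ E u u := by
  rcases Nat.eq_zero_or_pos n with hn | hn
  · subst hn
    have e : p 0 = p 1 := by
      rw [← hidem (p 0), ← hidem (p 1)]
      congr 1
      funext i
      exact i.elim0
    refine ⟨p 0, hpS 0, ?_⟩
    have := hp 0
    rwa [← e] at this
  set F : (ℕ → Fin n) → A := fun x => p (ind h x) with hFdef
  have hFstep : ∀ i x, ¬ Cst (2 * h + 4) (cons i x) → E (F (cons i x)) (F x) := by
    intro i x hx
    have := ind_step h1 (cons i x) hx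
    rw [sh_cons] at this
    simp only [hFdef]
    rcases this with h2 | h2 | ⟨h2, h3⟩
    · rw [h2]; exact hsymm _ _ (hp _)
    · rw [h2]; exact hp _
    · rw [h2]; exact hz _ h3
  have hmain : ∀ k m i x, m + 1 + k = n * (h + 4) + n + h + 4 + (2 * h + 4) →
      (m + 1 = 2 * h + 4 ∨ ¬ Cst (2 * h + 4) (cons i x) ∨ m + 1 < 2 * h + 4) →
      E (eva t F k (m + 1) (cons i x)) (eva t F (k + 1) m x) := by
    intro k
    induction k with
    | zero =>
      intro m i x hm hc
      have hc : ¬ Cst (2 * h + 4) (cons i x) := by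
        rcases hc with hc | hc | hc
        · omega
        · exact hc
        · omega
      simp only [eva]
      rw [← hidem (F (cons i x))]
      apply hcomp
      intro l
      have e : F (cons i x) = F (cons i (Function.update x m l)) := by
        simp only [hFdef]
        rw [ind_congr (y := cons i (Function.update x m l))]
        intro j hj
        rw [← cons_update, Function.update_of_ne (by omega)]
      rw [e]
      apply hFstep
      intro h2
      apply hc
      refine cst_congr ?_ h2
      intro j hj
      rw [← cons_update, Function.update_of_ne (by omega)]
    | succ k ih =>
      intro m i x hm hc
      by_cases hsp : m + 1 = 2 * h + 4 ∧ Cst (2 * h + 4) (cons i x)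
      · obtain ⟨hm', hcst⟩ := hsp
        have hxi : ∀ j < m, x j = i := fun j hj => hcst (j + 1) (by omega)
        have hzero : ∀ y : ℕ → Fin n, Cst (2 * h + 4) y → F y = p 0 := by
          intro y hy
          simp only [hFdef]
          rw [ind_of_ev (Or.inl (cst_mono (by omega) hy))]
          rw [ei_eq (e := 0) (Or.inr hy) (by intro j hj; omega)]
        have e1 : eva t F (k + 1) (m + 1) (cons i x) = p 0 := by
          apply eva_const hidem
          intro y hy
          apply hzero
          exact cst_congr (fun j hj => (hy j (by omega)).symm) hcst
        have e2 : eva t F (k + 1 + 1) m x = t (fun j => if j = i then p 0 else p 1) := by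
          rw [eva]
          congr 1
          funext l
          apply eva_const hidem
          intro y hy
          have hy1 : ∀ j < m, y j = i := by
            intro j hj
            rw [hy j (by omega), Function.update_of_ne (by omega), hxi j hj]
          have hy2 : y m = l := by
            rw [hy m (by omega), Function.update_self]
          split_ifs with hl
          · apply hzero
            intro j hj
            rw [hy1 0 (by omega)]
            rcases Nat.lt_or_ge j m with h3 | h3
            · exact hy1 j h3
            · have : j = m := by omega
              rw [this, hy2, hl]
          · have hc1 : Cst (2 * h + 4 - 1) y := by
              intro j hj
              rw [hy1 0 (by omega), hy1 j (by omega)]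
            simp only [hFdef]
            rw [ind_of_ev (Or.inl (cst_mono (by omega) hc1))]
            rw [ei_eq (e := 1) (Or.inr hc1)]
            intro j hj h3
            have : j = 0 := by omega
            subst this
            rcases h3 with h3 | h3
            · omega
            · have := h3 m (by omega)
              rw [hy2, hy1 0 (by omega)] at this
              exact hl this
        rw [e1, e2]
        exact hab i
      · rw [eva, eva]
        apply hcomp
        intro l
        rw [cons_update]
        apply ih
        · omega
        · rcases Nat.lt_or_ge (m + 1) (2 * h + 4) with h3 | h3
          · omega
          · right; left
            have hc' : ¬ Cst (2 * h + 4) (cons i x) := by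
              rcases hc with hc | hc | hc
              · exact fun h4 => hsp ⟨hc, h4⟩
              · exact hc
              · omega
            intro h4
            apply hc'
            refine cst_congr ?_ h4
            intro j hj
            rw [← cons_update, Function.update_of_ne (by omega)]
  obtain ⟨k, hk⟩ : ∃ k, 0 + 1 + k = n * (h + 4) + n + h + 4 + (2 * h + 4) :=
    ⟨n * (h + 4) + n + h + 4 + (2 * h + 3), by omega⟩
  let x : ℕ → Fin n := fun _ => ⟨0, hn⟩
  refine ⟨eva t F (k + 1) 0 x, eva_mem hS (fun y => hpS _) _ _ _, ?_⟩
  have e : eva t F (k + 1) 0 x = t fun l => eva t F k (0 + 1) (cons l x) := by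
    rw [eva]
    congr 1
    funext l
    congr 1
    funext j
    cases j with
    | zero => simp [cons]
    | succ j => rw [Function.update_of_ne (by omega)]; rfl
  have := hcomp (fun l => eva t F k (0 + 1) (cons l x)) (fun _ => eva t F (k + 1) 0 x)
    (fun l => hmain k 0 l x hk (Or.inr (Or.inr (by omega))))
  rwa [hidem, ← e] at this

/-- Recursive walks. -/
def W {A : Type*} (E : A → A → Prop) : ℕ → A → A → Prop
  | 0, u, v => u = v
  | k + 1, u, v => ∃ w, E u w ∧ W E k w v

section
variable {A : Type*} {E : A → A → Prop}

theorem W_add {k l : ℕ} {u v w : A} (h1 : W E k u v) (h2 : W E l v w) : W E (k + l) u w := by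
  induction k generalizing u with
  | zero => cases h1; rwa [Nat.zero_add]
  | succ k ih =>
    obtain ⟨x, hx, h3⟩ := h1
    rw [Nat.add_right_comm]
    exact ⟨x, hx, ih h3⟩

theorem W_split {k l : ℕ} {u w : A} (h1 : W E (k + l) u w) : ∃ v, W E k u v ∧ W E l v w := by
  induction k generalizing u with
  | zero => rw [Nat.zero_add] at h1; exact ⟨u, rfl, h1⟩
  | succ k ih =>
    rw [Nat.add_right_comm] at h1
    obtain ⟨x, hx, h3⟩ := h1
    obtain ⟨v, hv, h4⟩ := ih h3
    exact ⟨v, ⟨x, hx, hv⟩, h4⟩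

theorem W_one {u v : A} : W E 1 u v ↔ E u v := by
  constructor
  · rintro ⟨w, hw, rfl⟩; exact hw
  · intro h; exact ⟨v, h, rfl⟩

theorem W_symm (hsymm : ∀ u v : A, E u v → E v u) {k : ℕ} {u v : A} (h : W E k u v) :
    W E k v u := by
  induction k generalizing u with
  | zero => exact h.symm
  | succ k ih =>
    obtain ⟨x, hx, h3⟩ := h
    exact W_add (ih h3) (W_one.2 (hsymm _ _ hx))

theorem W_ext (hsymm : ∀ u v : A, E u v → E v u) {k : ℕ} {u v : A} (h : W E (k + 1) u v) (j : ℕ) :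
    W E (k + 1 + 2 * j) u v := by
  induction j with
  | zero => exact h
  | succ j ih =>
    obtain ⟨x, hx, _⟩ := h
    have : W E 2 u u := ⟨x, hx, u, hsymm _ _ hx, rfl⟩
    have := W_add this ih
    rwa [show k + 1 + 2 * (j + 1) = 2 + (k + 1 + 2 * j) by omega]

theorem W_comp {n : ℕ} {t : (Fin n → A) → A}
    (hcomp : ∀ u v : Fin n → A, (∀ i, E (u i) (v i)) → E (t u) (t v)) {k : ℕ}
    (u v : Fin n → A) (h : ∀ i, W E k (u i) (v i)) : W E k (t u) (t v) := by
  induction k generalizing u with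
  | zero => exact congrArg t (funext h)
  | succ k ih =>
    choose w hw h2 using h
    exact ⟨t w, hcomp _ _ hw, ih w h2⟩

theorem W_mul {m k : ℕ} {u v : A} (h : W E (m * k) u v) : W (W E m) k u v := by
  induction k generalizing u with
  | zero => exact h
  | succ k ih =>
    rw [Nat.mul_succ, Nat.add_comm] at h
    obtain ⟨w, h1, h2⟩ := W_split h
    exact ⟨w, h1, ih h2⟩

theorem W_of_hasWalk {k : ℕ} {u v : A} (h : HasWalk E u v k) : W E k u v := by
  obtain ⟨w, rfl, rfl, hw⟩ := h
  induction k with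
  | zero => rfl
  | succ k ih => exact W_add (ih fun i hi => hw i (by omega)) (W_one.2 (hw k (by omega)))

theorem W_path {k : ℕ} {u v : A} (h : W E k u v) (q : ℕ → A) (hq0 : q 0 = v)
    (hq : ∀ j, E (q j) (q (j + 1))) :
    ∃ p : ℕ → A, p 0 = u ∧ (∀ j, E (p j) (p (j + 1))) ∧ ∀ j, p (k + j) = q j := by
  induction k generalizing u with
  | zero => exact ⟨q, hq0.trans h.symm, hq, fun j => by rw [Nat.zero_add]⟩
  | succ k ih =>
    obtain ⟨x, hx, h3⟩ := h
    obtain ⟨p, hp0, hp, hpq⟩ := ih h3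
    refine ⟨cons u p, rfl, ?_, ?_⟩
    · intro j
      cases j with
      | zero => change E u (p 0); rwa [hp0]
      | succ j => exact hp j
    · intro j
      rw [Nat.add_right_comm]
      exact hpq j

end

end LLQ

open LLQ in
/-- Positive answer to the local loop question: let `G = (A, E)` be an undirected graph
compatible with an idempotent operation `t`, let `a` be a vertex lying on a closed walk of odd
length, and suppose the neighborhood `N(a) = {b | E a b}` absorbs `{a}` with respect to `t`.
Then `G` has a loop. -/
theorem local_loop_question {A : Type*} {n : ℕ} (E : A → A → Prop)
    (hsymm : ∀ u v : A, E u v → E v u)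
    (t : (Fin n → A) → A)
    (hidem : ∀ b : A, t (fun _ => b) = b)
    (hcomp : ∀ u v : Fin n → A, (∀ i, E (u i) (v i)) → E (t u) (t v))
    (a : A) (k : ℕ) (hk : Odd k) (hcyc : HasWalk E a a k)
    (habs : ∀ (i : Fin n) (x : Fin n → A),
      (∀ j, j ≠ i → E a (x j)) → x i = a → E a (t x)) :
    ∃ b : A, E b b := by
  classical
  have hw := W_of_hasWalk hcyc
  obtain ⟨c, rfl⟩ := hk
  obtain ⟨b, hab, _⟩ := id hw
  have hba := hsymm _ _ hab
  have hbb2 : W E 2 b b := ⟨a, hba, b, hab, rfl⟩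
  have hbb3 : W E (2 * c + 3) b b := by
    have := W_add (W_add (W_one.2 hba) hw) (W_one.2 hab)
    rwa [show 1 + (2 * c + 1) + 1 = 2 * c + 3 by omega] at this
  let S : A → Prop := fun v => ∃ m0, ∀ m, m0 ≤ m → W E m b v
  have hSb : S b := by
    refine ⟨2 * c + 3, fun m hm => ?_⟩
    rcases Nat.even_or_odd' m with ⟨d, hd | hd⟩
    · have := W_ext hsymm hbb2 (d - 1)
      rwa [show 1 + 1 + 2 * (d - 1) = m by omega] at this
    · have := W_ext hsymm hbb3 (d - c - 1)
      rwa [show 2 * c + 2 + 1 + 2 * (d - c - 1) = m by omega] at this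
  have hSW : ∀ l u v, W E l u v → S u → S v := by
    rintro l u v h1 ⟨m0, h2⟩
    refine ⟨m0 + l, fun m hm => ?_⟩
    have := W_add (h2 (m - l) (by omega)) h1
    rwa [show m - l + l = m by omega] at this
  have hSt : ∀ u : Fin n → A, (∀ i, S (u i)) → S (t u) := by
    intro u hu
    choose m0 hm0 using hu
    refine ⟨∑ i, m0 i, fun m hm => ?_⟩
    have := W_comp hcomp (fun _ => b) u (k := m) fun i =>
      hm0 i m ((Finset.single_le_sum (fun _ _ => Nat.zero_le _) (Finset.mem_univ i)).trans hm)
    rwa [hidem] at this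
  have hex : ∃ d, ∃ v, S v ∧ W E (2 * d + 1) v v := ⟨c + 1, b, hSb, hbb3⟩
  obtain ⟨z, hSz, hzz⟩ := Nat.find_spec hex
  have hmin := fun d hd => Nat.find_min hex (m := d) hd
  generalize Nat.find hex = d at *
  cases d with
  | zero => exact ⟨z, W_one.1 hzz⟩
  | succ d =>
    exfalso
    -- the relation of walks of length `2 * d + 1`
    have hsymm' : ∀ u v : A, W E (2 * d + 1) u v → W E (2 * d + 1) v u :=
      fun u v h => W_symm hsymm h
    have h3 : W E ((2 * d + 1) + ((2 * d + 1) + (2 * d + 1))) z z := by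
      have := W_ext hsymm hzz (2 * d)
      rwa [show 2 * (d + 1) + 1 + 2 * (2 * d) = (2 * d + 1) + ((2 * d + 1) + (2 * d + 1))
        by omega] at this
    obtain ⟨x, hzx, h4⟩ := W_split h3
    obtain ⟨y, hxy, hyz⟩ := W_split h4
    have hE' : ∀ u v, E u v → W E (2 * d + 1) u v := by
      intro u v huv
      have := W_ext hsymm (k := 0) (W_one.2 huv) d
      rwa [show 0 + 1 + 2 * d = 2 * d + 1 by omega] at this
    obtain ⟨m0, hm0⟩ := id hSz
    have hbz : W (W E (2 * d + 1)) m0 b z := by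
      apply W_mul
      apply hm0
      exact Nat.le_mul_of_pos_left _ (by omega)
    have haz : W (W E (2 * d + 1)) (m0 + 1) a z := ⟨b, hE' _ _ hab, hbz⟩
    let q : ℕ → A := cons z fun j => if Even j then x else y
    have hq : ∀ j, W E (2 * d + 1) (q j) (q (j + 1)) := by
      intro j
      cases j with
      | zero => simpa [q, cons] using hzx
      | succ j =>
        simp only [q, cons]
        by_cases hj : Even j
        · simpa [hj, Nat.even_add_one] using hxy
        · simpa [hj, Nat.even_add_one] using hsymm' _ _ hxy
    have hzq : ∀ j, W E (2 * d + 1) z (q (j + 1)) := by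
      intro j
      simp only [q, cons]
      split_ifs
      · exact hzx
      · exact hsymm' _ _ hyz
    obtain ⟨p', hp0, hp, hpq⟩ := W_path hbz q rfl hq
    have hSp' : ∀ j, S (p' j) := by
      intro j
      induction j with
      | zero => rwa [hp0]
      | succ j ih => exact hSW _ _ _ (hp j) ih
    obtain ⟨u, hSu, hu⟩ := core (W E (2 * d + 1)) hsymm' t hidem
      (fun u v h => W_comp hcomp u v h) S hSt (cons a p') (m0 + 1) (by omega)
      (by
        intro j
        cases j with
        | zero => exact hSW 1 b a (W_one.2 hba) hSb
        | succ j => exact hSp' j)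
      (by
        intro j
        cases j with
        | zero => change W E (2 * d + 1) a (p' 0); rw [hp0]; exact hE' _ _ hab
        | succ j => exact hp j)
      (by
        intro j hj
        obtain ⟨i, rfl⟩ : ∃ i, j = m0 + (i + 1) + 1 := ⟨j - m0 - 2, by omega⟩
        change W E (2 * d + 1) (p' (m0 + 0)) (p' (m0 + (i + 1)))
        rw [hpq, hpq]
        exact hzq i)
      (by
        intro i
        apply hE'
        change E a (t fun j => if j = i then a else p' 0)
        rw [hp0]
        apply habs i
        · intro j hj
          rw [if_neg hj]; exact hab
        · rw [if_pos rfl])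
    exact hmin d (by omega) ⟨u, hSu, hu⟩
end

section
/- Let A be a set, t: Aⁿ → A idempotent, and G a digraph on A compatible with t which is strongly connected and contains closed walks of all lengths ≥ 2. Suppose there exist vertices aᵢ, bᵢ (i ∈ {0,…,n−1}) such that aᵢ → bᵢ is an edge of G and there is a walk from aᵢ to bᵢ in the digraph P(t,i), where P(t,i) has edges xᵢ → t(x₀,…,x_{n−1}) for all tuples. Then G contains a loop. -/
/-- The digraph `P(t, i)` on `A`: an edge `u → v` iff some tuple `x` with `x i = u` satisfies
`t x = v`. -/
def Pdig {A : Type*} {n : ℕ} (t : (Fin n → A) → A) (i : Fin n) (u v : A) : Prop :=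
  ∃ x : Fin n → A, x i = u ∧ t x = v


namespace SLL

section Walks
variable {A : Type*} {E : A → A → Prop}

theorem hw_refl (u : A) : HasWalk E u u 0 := ⟨fun _ => u, rfl, rfl, by intro i hi; omega⟩

theorem hw_trans {u v w : A} {j k : ℕ} (h1 : HasWalk E u v j) (h2 : HasWalk E v w k) :
    HasWalk E u w (j + k) := by
  obtain ⟨f, f0, fj, fe⟩ := h1
  obtain ⟨g, g0, gk, ge⟩ := h2
  refine ⟨fun i => if i ≤ j then f i else g (i - j), by simp [f0], ?_, ?_⟩
  · by_cases hk : k = 0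
    · subst hk; simp [fj]; rw [← g0, gk]
    · simp [hk, gk]
  · intro i hi
    by_cases h : i < j
    · have h' : i + 1 ≤ j := h
      have h'' : i ≤ j := h.le
      simpa [h', h''] using fe i h
    · by_cases h2 : i = j
      · subst h2
        have := ge 0 (by omega)
        simpa [fj, ← g0] using this
      · have a1 : ¬ i ≤ j := by omega
        have a2 : ¬ i + 1 ≤ j := by omega
        have := ge (i - j) (by omega)
        have e : i + 1 - j = i - j + 1 := by omega
        simpa [a1, a2, e] using this

theorem hw_mul {u : A} {k : ℕ} (h : HasWalk E u u k) (m : ℕ) : HasWalk E u u (k * m) := by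
  induction m with
  | zero => exact hw_refl u
  | succ m ih => exact hw_trans ih h

theorem reach (hsc : ∀ u v : A, ∃ k, HasWalk E u v k)
    (hcyc : ∀ k : ℕ, 2 ≤ k → ∃ u : A, HasWalk E u u k) (u v : A) :
    ∃ N, ∀ s, N ≤ s → HasWalk E u v s := by
  obtain ⟨p, hp⟩ := hcyc 2 le_rfl
  obtain ⟨r, hr⟩ := hcyc 3 (by norm_num)
  obtain ⟨k1, h1⟩ := hsc u p
  obtain ⟨k2, h2⟩ := hsc p r
  obtain ⟨k3, h3⟩ := hsc r v
  refine ⟨k1 + k2 + k3 + 3, fun s hs => ?_⟩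
  obtain ⟨a, b, hab⟩ : ∃ a b, s = k1 + 2 * a + k2 + 3 * b + k3 := by
    rcases Nat.even_or_odd' (s - (k1 + k2 + k3)) with ⟨m, hm | hm⟩
    · exact ⟨m, 0, by omega⟩
    · exact ⟨m - 1, 1, by omega⟩
  rw [hab]
  exact hw_trans (hw_trans (hw_trans (hw_trans h1 (hw_mul hp a)) h2) (hw_mul hr b)) h3

theorem reach_fin (hR : ∀ u v : A, ∃ N, ∀ s, N ≤ s → HasWalk E u v s) (S : Set A)
    (hS : S.Finite) : ∃ N, ∀ s, N ≤ s → ∀ u ∈ S, ∀ v ∈ S, HasWalk E u v s := by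
  choose N hN using hR
  have hf : ((fun p : A × A => N p.1 p.2) '' (S ×ˢ S)).Finite := (hS.prod hS).image _
  obtain ⟨M, hM⟩ := hf.bddAbove
  refine ⟨M, fun s hs u hu v hv => hN u v s (le_trans (hM ?_) hs)⟩
  exact ⟨(u, v), ⟨hu, hv⟩, rfl⟩

end Walks

section CodeDefs
variable {A : Type*}

def Loc (R : ℕ) (Y : Set ℤ → ℤ → A) : Prop :=
  ∀ (s s' : Set ℤ) (t t' : ℤ), (∀ i : ℤ, -(R : ℤ) ≤ i → i ≤ R → (t + i ∈ s ↔ t' + i ∈ s')) →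
    Y s t = Y s' t'

def Sep (L : ℕ) (s : Set ℤ) : Prop := ∀ i ∈ s, ∀ j ∈ s, i < j → i + L ≤ j

def Cov (B : ℕ) (s : Set ℤ) (t : ℤ) : Prop :=
  ∃ m1 ∈ s, ∃ m2 ∈ s, m1 ≤ t ∧ t < m2 ∧ m2 ≤ m1 + B

def Code (E : A → A → Prop) (L : ℕ) : Prop :=
  ∃ F : Set A, F.Finite ∧ ∃ B0 : ℕ, ∀ B, B0 ≤ B → ∃ (Y : Set ℤ → ℤ → A) (R : ℕ), Loc R Y ∧
    (∀ s, Sep L s → ∀ t, Cov B s t → E (Y s t) (Y s (t + 1))) ∧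
    (∀ s, Sep L s → ∀ m ∈ s,
      ((∀ i ∈ s, m < i → m + B < i) ∨ (∀ i ∈ s, i < m → i + B < m)) → Y s m ∈ F)

/-- distance to the last mark, at or before `t` -/
noncomputable def pv (B : ℕ) (s : Set ℤ) (t : ℤ) : ℕ := sInf {a : ℕ | a ≤ B ∧ t - a ∈ s}
/-- distance to the next mark strictly after `t` -/
noncomputable def nx1 (B : ℕ) (s : Set ℤ) (t : ℤ) : ℕ := sInf {a : ℕ | 1 ≤ a ∧ a ≤ B ∧ t + a ∈ s}
/-- distance to the next mark, at or after `t` -/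
noncomputable def nx (B : ℕ) (s : Set ℤ) (t : ℤ) : ℕ := sInf {a : ℕ | a ≤ B ∧ t + a ∈ s}

theorem sInf_eq_of {S : Set ℕ} {a : ℕ} (h : a ∈ S) (h2 : ∀ b ∈ S, a ≤ b) : sInf S = a :=
  le_antisymm (Nat.sInf_le h) (h2 _ (Nat.sInf_mem ⟨a, h⟩))

open Classical in
noncomputable def Ybase (z : A) (pw : ℕ → ℕ → A) (B : ℕ) (s : Set ℤ) (t : ℤ) : A :=
  if ∃ a b : ℕ, 1 ≤ b ∧ a + b ≤ B ∧ t - a ∈ s ∧ t + b ∈ s then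
    pw (pv B s t + nx1 B s t) (pv B s t) else z

theorem code_base {E : A → A → Prop} (z : A) (D : ℕ) (hD : 1 ≤ D)
    (h : ∀ s, D ≤ s → HasWalk E z z s) : Code E D := by
  classical
  have h' : ∀ g, ∃ w : ℕ → A, D ≤ g → (w 0 = z ∧ w g = z ∧ ∀ i < g, E (w i) (w (i + 1))) := by
    intro g
    by_cases hg : D ≤ g
    · obtain ⟨w, hw⟩ := h g hg
      exact ⟨w, fun _ => hw⟩
    · exact ⟨fun _ => z, fun h => absurd h hg⟩
  choose pw hpw using h'
  -- value at covered points
  have key : ∀ B (s : Set ℤ), Sep D s → ∀ (t : ℤ) (a b : ℕ), 1 ≤ b → a + b ≤ B → t - a ∈ s →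
      t + b ∈ s → (∀ i ∈ s, t - a < i → t + b ≤ i) → Ybase z pw B s t = pw (a + b) a := by
    intro B s hs t a b hb hab ha hb' hno
    have e1 : pv B s t = a := by
      unfold pv
      refine sInf_eq_of ⟨by omega, ha⟩ ?_
      rintro a' ⟨_, ha'⟩
      by_contra hlt
      have := hno _ ha' (by omega)
      omega
    have e2 : nx1 B s t = b := by
      unfold nx1
      refine sInf_eq_of ⟨by omega, by omega, hb'⟩ ?_
      rintro b' ⟨h1, _, hb''⟩
      have := hno _ hb'' (by omega)
      omega
    unfold Ybase
    rw [if_pos ⟨a, b, hb, hab, ha, hb'⟩, e1, e2]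
  have least : ∀ B (s : Set ℤ) (t : ℤ), (∃ a b : ℕ, 1 ≤ b ∧ a + b ≤ B ∧ t - a ∈ s ∧ t + b ∈ s) →
      ∃ a b : ℕ, 1 ≤ b ∧ a + b ≤ B ∧ t - a ∈ s ∧ t + b ∈ s ∧ (∀ i ∈ s, t - a < i → t + b ≤ i) := by
    rintro B s t ⟨a, b, hb, hab, ha, hb'⟩
    have ex1 : ∃ a : ℕ, t - a ∈ s := ⟨a, ha⟩
    have ex2 : ∃ b : ℕ, 1 ≤ b ∧ t + b ∈ s := ⟨b, hb, hb'⟩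
    have l1 := Nat.find_min' ex1 ha
    have l2 := Nat.find_min' ex2 ⟨hb, hb'⟩
    refine ⟨Nat.find ex1, Nat.find ex2, (Nat.find_spec ex2).1, by omega, Nat.find_spec ex1,
      (Nat.find_spec ex2).2, ?_⟩
    intro i hi hlt
    by_contra hc
    by_cases hit : i ≤ t
    · have := Nat.find_min' ex1 (m := (t - i).toNat) (by
        have : t - ((t - i).toNat : ℤ) = i := by omega
        rw [this]; exact hi)
      omega
    · have := Nat.find_min' ex2 (m := (i - t).toNat) ⟨by omega, by
        have : t + ((i - t).toNat : ℤ) = i := by omega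
        rw [this]; exact hi⟩
      omega
  have atmark : ∀ B (s : Set ℤ), Sep D s → ∀ t ∈ s, Ybase z pw B s t = z := by
    intro B s hs t ht
    by_cases hex : ∃ a b : ℕ, 1 ≤ b ∧ a + b ≤ B ∧ t - a ∈ s ∧ t + b ∈ s
    · obtain ⟨a, b, hb, hab, ha, hb', hno⟩ := least B s t hex
      have a0 : a = 0 := by
        by_contra h0
        have := hno t ht (by omega)
        omega
      subst a0
      rw [key B s hs t 0 b hb hab ha hb' hno]
      have := hs t ht _ hb' (by omega)
      exact (hpw (0 + b) (by omega)).1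
    · unfold Ybase; rw [if_neg hex]
  refine ⟨{z}, Set.finite_singleton z, 0, fun B _ => ⟨Ybase z pw B, B, ?_, ?_, ?_⟩⟩
  · intro s s' t t' hh
    have g1 : ∀ a : ℕ, a ≤ B → (t - a ∈ s ↔ t' - a ∈ s') := by
      intro a ha
      have := hh (-(a : ℤ)) (by omega) (by omega)
      simpa [sub_eq_add_neg] using this
    have g2 : ∀ a : ℕ, a ≤ B → (t + a ∈ s ↔ t' + a ∈ s') := by
      intro a ha
      exact hh (a : ℤ) (by omega) (by omega)
    have e1 : pv B s t = pv B s' t' := by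
      unfold pv; congr 1; ext a
      exact and_congr_right (fun h => g1 a h)
    have e2 : nx1 B s t = nx1 B s' t' := by
      unfold nx1; congr 1; ext a
      exact and_congr_right (fun _ => and_congr_right (fun h => g2 a h))
    have e3 : (∃ a b : ℕ, 1 ≤ b ∧ a + b ≤ B ∧ t - a ∈ s ∧ t + b ∈ s) ↔
        (∃ a b : ℕ, 1 ≤ b ∧ a + b ≤ B ∧ t' - a ∈ s' ∧ t' + b ∈ s') := by
      constructor
      · rintro ⟨a, b, h1, h2, h3, h4⟩
        exact ⟨a, b, h1, h2, (g1 a (by omega)).1 h3, (g2 b (by omega)).1 h4⟩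
      · rintro ⟨a, b, h1, h2, h3, h4⟩
        exact ⟨a, b, h1, h2, (g1 a (by omega)).2 h3, (g2 b (by omega)).2 h4⟩
    unfold Ybase
    rw [e1, e2]
    simp only [e3]
  · rintro s hs t ⟨m1, hm1, m2, hm2, h1, h2, h3⟩
    obtain ⟨a, b, hb, hab, ha, hb', hno⟩ := least B s t ⟨(t - m1).toNat, (m2 - t).toNat, by omega,
      by omega, by
        have : t - ((t - m1).toNat : ℤ) = m1 := by omega
        rw [this]; exact hm1, by
        have : t + ((m2 - t).toNat : ℤ) = m2 := by omega
        rw [this]; exact hm2⟩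
    have hg := hs _ ha _ hb' (by omega)
    obtain ⟨w0, w1, w2⟩ := hpw (a + b) (by omega)
    rw [key B s hs t a b hb hab ha hb' hno]
    by_cases hb1 : b = 1
    · subst hb1
      rw [atmark B s hs (t + 1) (by simpa using hb')]
      have := w2 a (by omega)
      rwa [w1] at this
    · have k2 := key B s hs (t + 1) (a + 1) (b - 1) (by omega) (by omega)
        (by have : t + 1 - ((a + 1 : ℕ) : ℤ) = t - a := by push_cast; ring
            rw [this]; exact ha)
        (by have : t + 1 + ((b - 1 : ℕ) : ℤ) = t + b := by omega
            rw [this]; exact hb')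
        (by intro i hi hlt
            have := hno i hi (by push_cast at hlt; omega)
            omega)
      rw [k2]
      have e : a + 1 + (b - 1) = a + b := by omega
      rw [e]
      exact w2 a (by omega)
  · intro s hs m hm _
    rw [atmark B s hs m hm]; rfl

end CodeDefs
end SLL

namespace SLL

section Glue
variable {A : Type*}

def Q1 (C : ℕ) (I : Set ℤ) (t m : ℤ) : Prop :=
  m ∈ I ∧ m < t ∧ t < m + C ∧ ∀ j ∈ I, m < j → m + 2 * C ≤ j
def Q2 (C : ℕ) (I : Set ℤ) (t m : ℤ) : Prop :=
  m ∈ I ∧ t < m ∧ m < t + C ∧ ∀ j ∈ I, j < m → j + 2 * C ≤ m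
def Q3 (C : ℕ) (I : Set ℤ) (t : ℤ) : Prop :=
  ∀ j ∈ I, j + C ≤ t ∨ t + C ≤ j

open Classical in
noncomputable def glue (C : ℕ) (I : Set ℤ) (y ψ : ℤ → A) (pth : A → A → ℕ → A) (t : ℤ) : A :=
  if h : ∃ m, Q1 C I t m then pth (y h.choose) (ψ (h.choose + C)) (t - h.choose).toNat
  else if h : ∃ m, Q2 C I t m then
    pth (ψ (h.choose - C)) (y h.choose) (t - (h.choose - C)).toNat
  else if Q3 C I t then ψ t else y t

theorem Q1_uniq {C : ℕ} {I : Set ℤ} {t m m' : ℤ} (h : Q1 C I t m) (h' : Q1 C I t m') :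
    m = m' := by
  obtain ⟨a, b, c, d⟩ := h
  obtain ⟨a', b', c', d'⟩ := h'
  rcases lt_trichotomy m m' with hl | hl | hl
  · have := d _ a' hl; omega
  · exact hl
  · have := d' _ a hl; omega

theorem Q2_uniq {C : ℕ} {I : Set ℤ} {t m m' : ℤ} (h : Q2 C I t m) (h' : Q2 C I t m') :
    m = m' := by
  obtain ⟨a, b, c, d⟩ := h
  obtain ⟨a', b', c', d'⟩ := h'
  rcases lt_trichotomy m m' with hl | hl | hl
  · have := d' _ a hl; omega
  · exact hl
  · have := d _ a' hl; omega

theorem Q12 {C : ℕ} {I : Set ℤ} {t m m' : ℤ} (h : Q1 C I t m) (h' : Q2 C I t m') : False := by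
  obtain ⟨a, b, c, d⟩ := h
  obtain ⟨a', b', c', d'⟩ := h'
  have := d _ a' (by omega)
  omega

theorem Q13 {C : ℕ} {I : Set ℤ} {t m : ℤ} (h : Q1 C I t m) (h' : Q3 C I t) : False := by
  obtain ⟨a, b, c, d⟩ := h
  have := h' _ a
  omega

theorem Q23 {C : ℕ} {I : Set ℤ} {t m : ℤ} (h : Q2 C I t m) (h' : Q3 C I t) : False := by
  obtain ⟨a, b, c, d⟩ := h
  have := h' _ a
  omega

variable {C : ℕ} {I : Set ℤ} {y ψ : ℤ → A} {pth : A → A → ℕ → A} {t m : ℤ}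

theorem glue1 (h : Q1 C I t m) :
    glue C I y ψ pth t = pth (y m) (ψ (m + C)) (t - m).toNat := by
  have hex : ∃ m, Q1 C I t m := ⟨m, h⟩
  have e := Q1_uniq hex.choose_spec h
  unfold glue
  rw [dif_pos hex, e]

theorem glue2 (h : Q2 C I t m) :
    glue C I y ψ pth t = pth (ψ (m - C)) (y m) (t - (m - C)).toNat := by
  have hex : ∃ m, Q2 C I t m := ⟨m, h⟩
  have e := Q2_uniq hex.choose_spec h
  unfold glue
  rw [dif_neg (fun ⟨_, h1⟩ => Q12 h1 h), dif_pos hex, e]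

theorem glue3 (h : Q3 C I t) : glue C I y ψ pth t = ψ t := by
  unfold glue
  rw [dif_neg (fun ⟨_, h1⟩ => Q13 h1 h), dif_neg (fun ⟨_, h1⟩ => Q23 h1 h), if_pos h]

theorem glue4 (h1 : ∀ m, ¬ Q1 C I t m) (h2 : ∀ m, ¬ Q2 C I t m) (h3 : ¬ Q3 C I t) :
    glue C I y ψ pth t = y t := by
  unfold glue
  rw [dif_neg (fun ⟨_, h⟩ => h1 _ h), dif_neg (fun ⟨_, h⟩ => h2 _ h), if_neg h3]

theorem glue_mem (hC : 1 ≤ C) (h : t ∈ I) : glue C I y ψ pth t = y t := by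
  apply glue4
  · rintro m ⟨a, b, c, d⟩
    have := d _ h b
    omega
  · rintro m ⟨a, b, c, d⟩
    have := d _ h b
    omega
  · intro h3
    have := h3 _ h
    omega

theorem glue_edge {E : A → A → Prop} {S : Set A} (hC : 2 ≤ C)
    (hψ : t ∉ I → E (ψ t) (ψ (t + 1)))
    (hy : Cov (2 * C - 1) I t → E (y t) (y (t + 1)))
    (hy1 : ∀ m ∈ I, (∀ j ∈ I, m < j → m + 2 * C ≤ j) → y m ∈ S)
    (hy2 : ∀ m ∈ I, (∀ j ∈ I, j < m → j + 2 * C ≤ m) → y m ∈ S)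
    (hψS : ∀ τ, ψ τ ∈ S)
    (hp : ∀ u ∈ S, ∀ v ∈ S, pth u v 0 = u ∧ pth u v C = v ∧
      ∀ i < C, E (pth u v i) (pth u v (i + 1))) :
    E (glue C I y ψ pth t) (glue C I y ψ pth (t + 1)) := by
  classical
  by_cases c1 : ∃ m, Q1 C I t m
  · obtain ⟨m, hm⟩ := c1
    rw [glue1 hm]
    obtain ⟨a, b, c, d⟩ := hm
    obtain ⟨p0, pC, pe⟩ := hp _ (hy1 m a d) _ (hψS (m + C))
    have e := pe (t - m).toNat (by omega)
    have ee : (t - m).toNat + 1 = (t + 1 - m).toNat := by omega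
    rw [ee] at e
    by_cases hl : t + 1 < m + C
    · rw [glue1 (m := m) ⟨a, by omega, hl, d⟩]
      exact e
    · have h3 : Q3 C I (t + 1) := by
        intro j hj
        by_cases hjm : m < j
        · have := d j hj hjm; omega
        · omega
      rw [glue3 h3]
      have e1 : (t + 1 - m).toNat = C := by omega
      have e2 : m + C = t + 1 := by omega
      rw [e1, pC] at e
      rwa [e2] at e ⊢
  by_cases c2 : ∃ m, Q2 C I t m
  · obtain ⟨m, hm⟩ := c2
    rw [glue2 hm]
    obtain ⟨a, b, c, d⟩ := hm
    obtain ⟨p0, pC, pe⟩ := hp _ (hψS (m - C)) _ (hy2 m a d)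
    have e := pe (t - (m - C)).toNat (by omega)
    have ee : (t - (m - C)).toNat + 1 = (t + 1 - (m - C)).toNat := by omega
    rw [ee] at e
    by_cases hl : t + 1 < m
    · rw [glue2 (m := m) ⟨a, by omega, by omega, d⟩]
      exact e
    · have e2 : t + 1 = m := by omega
      have e1 : (t + 1 - (m - C)).toNat = C := by omega
      rw [e1, pC] at e
      rw [e2, glue_mem (by omega) a]
      exact e
  by_cases c3 : Q3 C I t
  · rw [glue3 c3]
    have htI : t ∉ I := fun h => by have := c3 _ h; omega
    by_cases d2 : ∃ m, Q2 C I (t + 1) m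
    · obtain ⟨m, hm⟩ := d2
      rw [glue2 hm]
      obtain ⟨a, b, c, d⟩ := hm
      have hm := c3 m a
      have e1 : m - C = t := by omega
      obtain ⟨p0, pC, pe⟩ := hp _ (hψS (m - C)) _ (hy2 m a d)
      have e := pe 0 (by omega)
      rw [p0] at e
      have e3 : (t + 1 - (m - C)).toNat = 0 + 1 := by omega
      rw [e3]
      rwa [e1] at e ⊢
    have d3 : Q3 C I (t + 1) := by
      intro j hj
      by_contra hc
      have h1 := c3 j hj
      apply d2
      refine ⟨j, hj, by omega, by omega, ?_⟩
      intro i hi hij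
      have := c3 i hi
      omega
    rw [glue3 d3]
    exact hψ htI
  rw [glue4 (fun m h => c1 ⟨m, h⟩) (fun m h => c2 ⟨m, h⟩) c3]
  by_cases d1 : ∃ m, Q1 C I (t + 1) m
  · obtain ⟨m, hm⟩ := d1
    rw [glue1 hm]
    obtain ⟨a, b, c, d⟩ := hm
    by_cases hmt : m < t
    · exact absurd ⟨m, a, hmt, by omega, d⟩ c1
    · have e1 : m = t := by omega
      subst e1
      obtain ⟨p0, pC, pe⟩ := hp _ (hy1 m a d) _ (hψS (m + C))
      have e := pe 0 (by omega)
      rw [p0] at e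
      have e3 : (m + 1 - m).toNat = 0 + 1 := by omega
      rw [e3]
      exact e
  by_cases d2 : ∃ m, Q2 C I (t + 1) m
  · exfalso
    obtain ⟨m, a, b, c, d⟩ := d2
    by_cases hl : m < t + C
    · exact c2 ⟨m, a, by omega, hl, d⟩
    · apply c3
      intro j hj
      by_cases hjm : j < m
      · have := d j hj hjm; omega
      · omega
  by_cases d3 : Q3 C I (t + 1)
  · exfalso
    -- some mark within distance < C of t, must be t + 1 - C
    have : ∃ j ∈ I, ¬ (j + C ≤ t ∨ t + C ≤ j) := by
      unfold Q3 at c3; push Not at c3 ⊢; exact c3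
    obtain ⟨j, hj, hc⟩ := this
    have h1 := d3 j hj
    apply c1
    refine ⟨j, hj, by omega, by omega, ?_⟩
    intro i hi hij
    have := d3 i hi
    omega
  rw [glue4 (fun m h => d1 ⟨m, h⟩) (fun m h => d2 ⟨m, h⟩) d3]
  apply hy
  -- find the marks
  have : ∃ j ∈ I, ¬ (j + C ≤ t ∨ t + C ≤ j) := by
    unfold Q3 at c3; push Not at c3 ⊢; exact c3
  obtain ⟨j, hj, hc⟩ := this
  by_cases hjt : j ≤ t
  · -- greatest mark at or below t
    have ex : ∃ a : ℕ, t - a ∈ I := ⟨(t - j).toNat, by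
      have : t - ((t - j).toNat : ℤ) = j := by omega
      rw [this]; exact hj⟩
    have hs := Nat.find_spec ex
    have hmin : ∀ i ∈ I, i ≤ t → i ≤ t - (Nat.find ex : ℤ) := by
      intro i hi hit
      have := Nat.find_min' ex (m := (t - i).toNat) (by
        have : t - ((t - i).toNat : ℤ) = i := by omega
        rw [this]; exact hi)
      omega
    set a := Nat.find ex
    have haj := hmin j hj hjt
    by_contra hcov
    have hgap : ∀ i ∈ I, t - (a : ℤ) < i → t - (a : ℤ) + 2 * C ≤ i := by
      intro i hi hai
      by_contra hlt
      apply hcov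
      refine ⟨_, hs, i, hi, by omega, ?_, by omega⟩
      by_contra hh
      have := hmin i hi (by omega)
      omega
    by_cases ha0 : a = 0
    · apply d1
      exact ⟨_, hs, by omega, by omega, hgap⟩
    · apply c1
      exact ⟨_, hs, by omega, by omega, hgap⟩
  · have ex : ∃ a : ℕ, 1 ≤ a ∧ t + a ∈ I := ⟨(j - t).toNat, by omega, by
      have : t + ((j - t).toNat : ℤ) = j := by omega
      rw [this]; exact hj⟩
    obtain ⟨hs1, hs⟩ := Nat.find_spec ex
    have hmin : ∀ i ∈ I, t < i → t + (Nat.find ex : ℤ) ≤ i := by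
      intro i hi hit
      have := Nat.find_min' ex (m := (i - t).toNat) ⟨by omega, by
        have : t + ((i - t).toNat : ℤ) = i := by omega
        rw [this]; exact hi⟩
      omega
    set a := Nat.find ex
    have haj := hmin j hj (by omega)
    by_contra hcov
    apply c2
    refine ⟨_, hs, by omega, by omega, ?_⟩
    intro i hi hai
    by_contra hlt
    apply hcov
    refine ⟨i, hi, _, hs, ?_, by omega, by omega⟩
    by_contra hh
    have := hmin i hi (by omega)
    omega

theorem glue_F {S : Set A} (htI : t ∉ I) (hprev : ∀ j ∈ I, j < t → j + 2 * C ≤ t)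
    (hψ : ψ t ∈ S)
    (hp : ∀ m ∈ I, (∀ j ∈ I, j < m → j + 2 * C ≤ m) → ∀ n ≤ C, pth (ψ (m - C)) (y m) n ∈ S) :
    glue C I y ψ pth t ∈ S := by
  classical
  by_cases c2 : ∃ m, Q2 C I t m
  · obtain ⟨m, hm⟩ := c2
    rw [glue2 hm]
    obtain ⟨a, b, c, d⟩ := hm
    exact hp m a d _ (by omega)
  by_cases c3 : Q3 C I t
  · rw [glue3 c3]; exact hψ
  exfalso
  have : ∃ j ∈ I, ¬ (j + C ≤ t ∨ t + C ≤ j) := by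
    unfold Q3 at c3; push Not at c3 ⊢; exact c3
  obtain ⟨j, hj, hc⟩ := this
  have hjt : t < j := by
    rcases lt_trichotomy t j with h | h | h
    · exact h
    · subst h; exact absurd hj htI
    · have := hprev j hj h; omega
  have ex : ∃ a : ℕ, 1 ≤ a ∧ t + a ∈ I := ⟨(j - t).toNat, by omega, by
    have : t + ((j - t).toNat : ℤ) = j := by omega
    rw [this]; exact hj⟩
  obtain ⟨hs1, hs⟩ := Nat.find_spec ex
  have hmin : ∀ i ∈ I, t < i → t + (Nat.find ex : ℤ) ≤ i := by
    intro i hi hit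
    have := Nat.find_min' ex (m := (i - t).toNat) ⟨by omega, by
      have : t + ((i - t).toNat : ℤ) = i := by omega
      rw [this]; exact hi⟩
    omega
  set a := Nat.find ex
  have haj := hmin j hj (by omega)
  apply c2
  refine ⟨_, hs, by omega, by omega, ?_⟩
  intro i hi hai
  rcases lt_trichotomy t i with h | h | h
  · have := hmin i hi h; omega
  · subst h; exact absurd hi htI
  · have := hprev i hi h; omega

theorem Q1_shift {I' : Set ℤ} {t' : ℤ}
    (hI : ∀ i : ℤ, -(2 * C : ℤ) ≤ i → i ≤ 2 * C → (t + i ∈ I ↔ t' + i ∈ I')) (h : Q1 C I t m) :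
    Q1 C I' t' (t' + (m - t)) := by
  obtain ⟨a, b, c, d⟩ := h
  refine ⟨(hI _ (by omega) (by omega)).1 (by simpa using a), by omega, by omega, ?_⟩
  intro j hj hlt
  by_contra hc
  have := d (t + (j - t')) ((hI _ (by omega) (by omega)).2 (by simpa using hj)) (by omega)
  omega

theorem Q2_shift {I' : Set ℤ} {t' : ℤ}
    (hI : ∀ i : ℤ, -(2 * C : ℤ) ≤ i → i ≤ 2 * C → (t + i ∈ I ↔ t' + i ∈ I')) (h : Q2 C I t m) :
    Q2 C I' t' (t' + (m - t)) := by
  obtain ⟨a, b, c, d⟩ := h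
  refine ⟨(hI _ (by omega) (by omega)).1 (by simpa using a), by omega, by omega, ?_⟩
  intro j hj hlt
  by_contra hc
  have := d (t + (j - t')) ((hI _ (by omega) (by omega)).2 (by simpa using hj)) (by omega)
  omega

theorem Q3_shift {I' : Set ℤ} {t' : ℤ}
    (hI : ∀ i : ℤ, -(2 * C : ℤ) ≤ i → i ≤ 2 * C → (t + i ∈ I ↔ t' + i ∈ I')) (h : Q3 C I t) :
    Q3 C I' t' := by
  intro j hj
  by_contra hc
  have := h (t + (j - t')) ((hI _ (by omega) (by omega)).2 (by simpa using hj))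
  omega

theorem glue_loc {I' : Set ℤ} {t' : ℤ} {y' ψ' : ℤ → A}
    (hI : ∀ i : ℤ, -(2 * C : ℤ) ≤ i → i ≤ 2 * C → (t + i ∈ I ↔ t' + i ∈ I'))
    (hy : ∀ i : ℤ, -(2 * C : ℤ) ≤ i → i ≤ 2 * C → y (t + i) = y' (t' + i))
    (hψ : ∀ i : ℤ, -(2 * C : ℤ) ≤ i → i ≤ 2 * C → ψ (t + i) = ψ' (t' + i)) :
    glue C I y ψ pth t = glue C I' y' ψ' pth t' := by
  classical
  have hI' : ∀ i : ℤ, -(2 * C : ℤ) ≤ i → i ≤ 2 * C → (t' + i ∈ I' ↔ t + i ∈ I) :=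
    fun i h1 h2 => (hI i h1 h2).symm
  by_cases c1 : ∃ m, Q1 C I t m
  · obtain ⟨m, hm⟩ := c1
    rw [glue1 hm, glue1 (Q1_shift hI hm)]
    obtain ⟨a, b, c, d⟩ := hm
    have h1 := hy (m - t) (by omega) (by omega)
    have h2 := hψ (m - t + C) (by omega) (by omega)
    have e1 : t + (m - t) = m := by ring
    have e2 : t + (m - t + C) = m + C := by ring
    have e3 : t' + (m - t + C) = t' + (m - t) + C := by ring
    have e4 : (t' - (t' + (m - t))) = t - m := by ring
    rw [e1] at h1; rw [e2, e3] at h2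
    rw [h1, h2, e4]
  by_cases c2 : ∃ m, Q2 C I t m
  · obtain ⟨m, hm⟩ := c2
    rw [glue2 hm, glue2 (Q2_shift hI hm)]
    obtain ⟨a, b, c, d⟩ := hm
    have h1 := hy (m - t) (by omega) (by omega)
    have h2 := hψ (m - t - C) (by omega) (by omega)
    have e1 : t + (m - t) = m := by ring
    have e2 : t + (m - t - C) = m - C := by ring
    have e3 : t' + (m - t - C) = t' + (m - t) - C := by ring
    have e4 : (t' - (t' + (m - t) - C)) = t - (m - C) := by ring
    rw [e1] at h1; rw [e2, e3] at h2
    rw [h1, h2, e4]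
  by_cases c3 : Q3 C I t
  · rw [glue3 c3, glue3 (Q3_shift hI c3)]
    simpa using hψ 0 (by omega) (by omega)
  · rw [glue4 (fun m h => c1 ⟨m, h⟩) (fun m h => c2 ⟨m, h⟩) c3,
      glue4 (fun m h => c1 ⟨_, Q1_shift hI' h⟩) (fun m h => c2 ⟨_, Q2_shift hI' h⟩)
        (fun h => c3 (Q3_shift hI' h))]
    simpa using hy 0 (by omega) (by omega)

end Glue
end SLL

namespace SLL

section Step
variable {A : Type*}

def irr (L : ℕ) (s : Set ℤ) : Set ℤ := {i | i ∈ s ∧ i + L ∉ s}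

theorem irr_sep {L : ℕ} {s : Set ℤ} (h : Sep L s) : Sep (L + 1) (irr L s) := by
  rintro i ⟨hi, hi'⟩ j ⟨hj, hj'⟩ hlt
  have := h i hi j hj hlt
  have : i + L ≠ j := fun e => hi' (e ▸ hj)
  push_cast
  omega

theorem nx_eq {B : ℕ} {s : Set ℤ} {t : ℤ} {a : ℕ} (ha : a ≤ B) (h : t + a ∈ s)
    (hno : ∀ i ∈ s, t ≤ i → t + a ≤ i) : nx B s t = a := by
  unfold nx
  refine sInf_eq_of ⟨ha, h⟩ ?_
  rintro b ⟨_, hb⟩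
  have := hno _ hb (by omega)
  omega

theorem psi_edge {E : A → A → Prop} {c : ℤ → A} {L B : ℕ} (hL : 1 ≤ L) (hLB : L ≤ B)
    (hper : ∀ n, c (n + L) = c n)
    (hc : ∀ n, E (c n) (c (n + 1))) {s : Set ℤ} (hs : Sep L s) {t : ℤ} (hcov : Cov B s t)
    (ht : t ∉ irr L s) : E (c (-(nx B s t))) (c (-(nx B s (t + 1)))) := by
  classical
  by_cases hts : t ∈ s
  · have hL' : t + L ∈ s := by
      by_contra h; exact ht ⟨hts, h⟩
    rw [nx_eq (a := 0) (by omega) (by simpa using hts) (by intro i _ h; simpa using h),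
      nx_eq (t := t + 1) (a := L - 1) (by omega) (by
        have : t + 1 + ((L - 1 : ℕ) : ℤ) = t + L := by omega
        rw [this]; exact hL') (by
        intro i hi hti
        have := hs t hts i hi (by omega)
        omega)]
    have e := hc 0
    have e1 := hper (-((L - 1 : ℕ) : ℤ))
    have e2 : -((L - 1 : ℕ) : ℤ) + L = 0 + 1 := by omega
    rw [e2] at e1
    rw [e1] at e
    simpa using e
  · obtain ⟨m1, hm1, m2, hm2, h1, h2, h3⟩ := hcov
    have ex : ∃ a : ℕ, t + a ∈ s := ⟨(m2 - t).toNat, by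
      have : t + ((m2 - t).toNat : ℤ) = m2 := by omega
      rw [this]; exact hm2⟩
    have hsp := Nat.find_spec ex
    have hmin : ∀ i ∈ s, t ≤ i → t + (Nat.find ex : ℤ) ≤ i := by
      intro i hi hit
      have := Nat.find_min' ex (m := (i - t).toNat) (by
        have : t + ((i - t).toNat : ℤ) = i := by omega
        rw [this]; exact hi)
      omega
    set a := Nat.find ex
    have h2' := hmin m2 hm2 (by omega)
    have ha : a ≠ 0 := by
      intro h0; rw [h0] at hsp; apply hts; simpa using hsp
    rw [nx_eq (a := a) (by omega) hsp hmin, nx_eq (t := t + 1) (a := a - 1) (by omega) (by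
        have : t + 1 + ((a - 1 : ℕ) : ℤ) = t + a := by omega
        rw [this]; exact hsp) (by
        intro i hi hti
        have := hmin i hi (by omega)
        omega)]
    have e := hc (-(a : ℤ))
    have e2 : -(a : ℤ) + 1 = -((a - 1 : ℕ) : ℤ) := by omega
    rwa [e2] at e

theorem exists_per {E : A → A → Prop} {L : ℕ} (hL : 1 ≤ L) {u : A} (h : HasWalk E u u L) :
    ∃ c : ℤ → A, (∀ n, c (n + L) = c n) ∧ (∀ n, E (c n) (c (n + 1))) ∧ (Set.range c).Finite := by
  obtain ⟨w, w0, wL, we⟩ := h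
  have hpos : (0 : ℤ) < L := by omega
  refine ⟨fun n => w (n % L).toNat, ?_, ?_, ?_⟩
  · intro n; simp
  · intro n
    have h1 := Int.emod_nonneg n hpos.ne'
    have h2 := Int.emod_lt_of_pos n hpos
    have e := we (n % L).toNat (by omega)
    by_cases h : n % L + 1 < L
    · have e1 : (n + 1) % L = n % L + 1 := by
        rw [← Int.emod_add_mul_ediv n L]
        rw [show n % L + L * (n / L) + 1 = (n % L + 1) + L * (n / L) by ring]
        rw [Int.add_mul_emod_self_left, Int.emod_eq_of_lt (by omega) h,
          Int.add_mul_emod_self_left, Int.emod_eq_of_lt h1 h2]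
      have e2 : (n % L).toNat + 1 = ((n + 1) % L).toNat := by rw [e1]; omega
      rw [e2] at e
      exact e
    · have e1 : (n + 1) % L = 0 := by
        rw [← Int.emod_add_mul_ediv n L]
        rw [show n % L + L * (n / L) + 1 = (n % L + 1) + L * (n / L) by ring]
        rw [Int.add_mul_emod_self_left, show n % L + 1 = L by omega, Int.emod_self]
      have e2 : (n % L).toNat + 1 = L := by omega
      rw [e2, wL, ← w0] at e
      show E _ (w ((n + 1) % L).toNat)
      rw [e1]
      exact e
  · apply ((Set.finite_Iio L).image w).subset
    rintro _ ⟨n, rfl⟩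
    have h1 := Int.emod_nonneg n hpos.ne'
    have h2 := Int.emod_lt_of_pos n hpos
    exact ⟨_, by simp only [Set.mem_Iio]; omega, rfl⟩

theorem code_step {E : A → A → Prop} (hR : ∀ u v : A, ∃ N, ∀ s, N ≤ s → HasWalk E u v s)
    {L : ℕ} (hL : 1 ≤ L) {u : A} (hu : HasWalk E u u L) (hcode : Code E (L + 1)) : Code E L := by
  classical
  obtain ⟨c, cper, ce, cfin⟩ := exists_per hL hu
  obtain ⟨F', hF', B0', hB⟩ := hcode
  set S := F' ∪ Set.range c with hS
  have hSfin : S.Finite := hF'.union cfin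
  obtain ⟨N, hN⟩ := reach_fin hR S hSfin
  set C := N + B0' + 2 with hCdef
  obtain ⟨Y', R', hloc, hedge, hmark⟩ := hB (2 * C - 1) (by omega)
  have hw : ∀ x y, ∃ p : ℕ → A, x ∈ S → y ∈ S →
      (p 0 = x ∧ p C = y ∧ ∀ i < C, E (p i) (p (i + 1))) := by
    intro x y
    by_cases h : x ∈ S ∧ y ∈ S
    · obtain ⟨p, hp⟩ := hN C (by omega) x h.1 y h.2
      exact ⟨p, fun _ _ => hp⟩
    · exact ⟨fun _ => x, fun h1 h2 => absurd ⟨h1, h2⟩ h⟩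
  choose pth hpth using hw
  set F := F' ∪ Set.range c ∪
    ((fun p : (A × A) × ℕ => pth p.1.1 p.1.2 p.2) '' ((Set.range c ×ˢ F') ×ˢ Set.Iic C)) with hF
  have hFfin : F.Finite := (hF'.union cfin).union
    (((cfin.prod hF').prod (Set.finite_Iic C)).image _)
  have mark1 : ∀ s, Sep L s → ∀ m ∈ irr L s,
      (∀ j ∈ irr L s, m < j → m + 2 * C ≤ j) → Y' (irr L s) m ∈ F' := by
    intro s hs m hm h
    refine hmark _ (irr_sep hs) m hm (Or.inl ?_)
    intro i hi hlt
    have := h i hi hlt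
    omega
  have mark2 : ∀ s, Sep L s → ∀ m ∈ irr L s,
      (∀ j ∈ irr L s, j < m → j + 2 * C ≤ m) → Y' (irr L s) m ∈ F' := by
    intro s hs m hm h
    refine hmark _ (irr_sep hs) m hm (Or.inr ?_)
    intro i hi hlt
    have := h i hi hlt
    omega
  refine ⟨F, hFfin, 2 * C + L, fun B hBB => ⟨fun s t => glue C (irr L s) (Y' (irr L s))
    (fun τ => c (-(nx B s τ))) pth t, 4 * C + L + R' + B, ?_, ?_, ?_⟩⟩
  · intro s s' t t' h
    have hirr : ∀ i : ℤ, -(2 * C + R' : ℤ) ≤ i → i ≤ 2 * C + R' →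
        (t + i ∈ irr L s ↔ t' + i ∈ irr L s') := by
      intro i h1 h2
      have a1 := h i (by push_cast; omega) (by push_cast; omega)
      have a2 := h (i + L) (by push_cast; omega) (by push_cast; omega)
      simp only [irr, Set.mem_ofPred_eq, add_assoc] at *
      rw [a1, a2]
    apply glue_loc
    · intro i h1 h2
      exact hirr i (by omega) (by omega)
    · intro i h1 h2
      apply hloc
      intro k k1 k2
      simpa [add_assoc] using hirr (i + k) (by omega) (by omega)
    · intro i h1 h2
      have : nx B s (t + i) = nx B s' (t' + i) := by
        unfold nx
        congr 1; ext a
        refine and_congr_right (fun ha => ?_)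
        simpa [add_assoc] using h (i + a) (by push_cast; omega) (by push_cast; omega)
      simp only [this]
  · intro s hs t hcov
    refine glue_edge (S := S) (by omega) ?_ ?_ ?_ ?_ ?_ ?_
    · intro ht
      exact psi_edge hL (by omega) cper ce hs hcov ht
    · intro hc
      exact hedge _ (irr_sep hs) t hc
    · intro m hm h
      exact Or.inl (mark1 s hs m hm h)
    · intro m hm h
      exact Or.inl (mark2 s hs m hm h)
    · intro τ; exact Or.inr ⟨_, rfl⟩
    · intro x hx y hy; exact hpth x y hx hy
  · intro s hs m hm hgap
    show glue C (irr L s) (Y' (irr L s)) (fun τ => c (-(nx B s τ))) pth m ∈ F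
    by_cases hmI : m ∈ irr L s
    · rw [glue_mem (by omega) hmI]
      refine Or.inl (Or.inl ?_)
      rcases hgap with h | h
      · apply mark1 s hs m hmI
        intro j hj hlt
        have := h j hj.1 hlt; omega
      · apply mark2 s hs m hmI
        intro j hj hlt
        have := h j hj.1 hlt; omega
    · rcases hgap with h | h
      · exfalso
        apply hmI
        refine ⟨hm, fun h' => ?_⟩
        have := h _ h' (by omega)
        omega
      · apply glue_F hmI
        · intro j hj hlt
          have := h j hj.1 hlt; omega
        · exact Or.inl (Or.inr ⟨_, rfl⟩)
        · intro k hk hk' n hn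
          exact Or.inr ⟨((_, _), n), ⟨⟨⟨_, rfl⟩, mark2 s hs k hk hk'⟩, hn⟩, rfl⟩

theorem code_two {E : A → A → Prop} (hsc : ∀ u v : A, ∃ k, HasWalk E u v k)
    (hcyc : ∀ k : ℕ, 2 ≤ k → ∃ u : A, HasWalk E u u k) :
    ∃ (R : ℕ) (Y : Set ℤ → ℤ → A), Loc R Y ∧
      ∀ s, Sep 2 s → (∀ t, Cov 3 s t) → ∀ t, E (Y s t) (Y s (t + 1)) := by
  have hR := reach hsc hcyc
  obtain ⟨z, -⟩ := hcyc 2 le_rfl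
  obtain ⟨N, hN⟩ := hR z z
  have hb : Code E (N + 2) := code_base z (N + 2) (by omega) (fun s hs => hN s (by omega))
  have hall : ∀ k, k ≤ N → Code E (N + 2 - k) := by
    intro k
    induction k with
    | zero => intro _; exact hb
    | succ k ih =>
      intro hk
      obtain ⟨u, hu⟩ := hcyc (N + 2 - (k + 1)) (by omega)
      refine code_step hR (by omega) hu ?_
      have : N + 2 - (k + 1) + 1 = N + 2 - k := by omega
      rw [this]
      exact ih (by omega)
  have h2 := hall N le_rfl
  rw [show N + 2 - N = 2 by omega] at h2
  obtain ⟨F, -, B0, hB⟩ := h2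
  obtain ⟨Y, R, hloc, hedge, -⟩ := hB (B0 + 3) (by omega)
  refine ⟨R, Y, hloc, fun s hs hcov t => hedge s hs t ?_⟩
  obtain ⟨m1, h1, m2, h2, h3, h4, h5⟩ := hcov t
  exact ⟨m1, h1, m2, h2, h3, h4, by push_cast at *; omega⟩

end Step
end SLL

namespace SLL

section Marks

def mk : List ℕ → ℤ → Prop
  | [], i => Even i
  | c :: u, i =>
    (Even ((c : ℤ) + 2) → mk u (i - (c + 2))) ∧
    (¬ Even ((c : ℤ) + 2) → ((i < 3 → (i ≤ 0 ∧ Even i)) ∧ (3 ≤ i → mk u (i - (c + 2)))))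

def sg : List ℕ → ℤ
  | [] => 0
  | c :: u => (c + 2) + sg u

def St (u : List ℕ) : Set ℤ := {i | mk u i}

theorem sg_ge (u : List ℕ) : 2 * (u.length : ℤ) ≤ sg u := by
  induction u with
  | nil => simp [sg]
  | cons c u ih => simp only [sg, List.length_cons]; push_cast; omega

theorem K1 (c : ℕ) (u : List ℕ) (i : ℤ) (hi : 3 ≤ i) : mk (c :: u) i ↔ mk u (i - (c + 2)) := by
  simp only [mk]
  have : ¬ i < 3 := by omega
  tauto

theorem K2 (u : List ℕ) (i : ℤ) (hi : i ≤ 1) : mk u i ↔ Even i := by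
  induction u generalizing i with
  | nil => simp [mk]
  | cons c u ih =>
    simp only [mk]
    have h1 := ih (i - (c + 2)) (by omega)
    rw [h1]
    simp only [Int.even_iff]
    omega

theorem K3 (u v : List ℕ) (i : ℤ) (hi : i ≤ 2 * u.length + 1) : mk (u ++ v) i ↔ mk u i := by
  induction u generalizing i with
  | nil => simpa [mk] using K2 v i (by simpa using hi)
  | cons c u ih =>
    simp only [List.cons_append, mk]
    have h1 := ih (i - (c + 2)) (by simp only [List.length_cons] at hi; push_cast at hi; omega)
    rw [h1]

theorem K4 (u : List ℕ) (i : ℤ) (hi : sg u + 3 ≤ i) : mk u i ↔ Even (i - sg u) := by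
  induction u generalizing i with
  | nil => simp [mk, sg]
  | cons c u ih =>
    simp only [sg] at hi ⊢
    have := sg_ge u
    rw [K1 c u i (by omega), ih _ (by omega)]
    rw [show i - (c + 2) - sg u = i - (c + 2 + sg u) by ring]

theorem mk_sep (u : List ℕ) : ∀ i j : ℤ, mk u i → mk u j → i < j → i + 2 ≤ j := by
  induction u with
  | nil =>
    intro i j hi hj h
    simp only [mk, Int.even_iff] at hi hj
    omega
  | cons c u ih =>
    intro i j hi hj h
    simp only [mk] at hi hj
    have key : ∀ hi' : mk u (i - (c + 2)), ∀ hj' : mk u (j - (c + 2)), i + 2 ≤ j := by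
      intro h1 h2
      have := ih _ _ h1 h2 (by omega)
      omega
    by_cases hc : Even ((c : ℤ) + 2)
    · exact key (hi.1 hc) (hj.1 hc)
    · have hi := hi.2 hc
      have hj := hj.2 hc
      by_cases h1 : i < 3
      · have a1 := hi.1 h1
        by_cases h2 : j < 3
        · have a2 := hj.1 h2
          simp only [Int.even_iff] at a1 a2
          omega
        · omega
      · exact key (hi.2 (by omega)) (hj.2 (by omega))

theorem mk_cov (u : List ℕ) : ∀ t : ℤ, ∃ i j : ℤ, mk u i ∧ mk u j ∧ i ≤ t ∧ t < j ∧ j ≤ i + 3 := by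
  induction u with
  | nil =>
    intro t
    refine ⟨t - t % 2, t - t % 2 + 2, ?_, ?_, ?_, ?_, ?_⟩ <;> (try simp only [mk, Int.even_iff]) <;> omega
  | cons c u ih =>
    intro t
    by_cases hc : Even ((c : ℤ) + 2)
    · obtain ⟨i, j, h1, h2, h3, h4, h5⟩ := ih (t - (c + 2))
      refine ⟨i + (c + 2), j + (c + 2), ?_, ?_, by omega, by omega, by omega⟩
      · simp only [mk]; refine ⟨fun _ => by simpa using h1, fun h => absurd hc h⟩
      · simp only [mk]; refine ⟨fun _ => by simpa using h2, fun h => absurd hc h⟩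
    · by_cases h0 : t < 0
      · refine ⟨t - t % 2, t - t % 2 + 2, ?_, ?_, ?_, ?_, ?_⟩
        · rw [K2 _ _ (by omega)]; simp only [Int.even_iff]; omega
        · rw [K2 _ _ (by omega)]; simp only [Int.even_iff]; omega
        all_goals omega
      · have m3 : mk (c :: u) 3 := by
          rw [K1 _ _ _ le_rfl, K2 _ _ (by omega)]
          simp only [Int.even_iff] at hc ⊢
          omega
        by_cases h3 : t < 3
        · exact ⟨0, 3, by rw [K2 _ _ (by omega)]; simp, m3, by omega, by omega, by omega⟩
        · obtain ⟨i, j, h1, h2, g3, h4, h5⟩ := ih (t - (c + 2))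
          by_cases hi : 3 ≤ i + (c + 2)
          · refine ⟨i + (c + 2), j + (c + 2), ?_, ?_, by omega, by omega, by omega⟩
            · rw [K1 _ _ _ hi]; simpa using h1
            · rw [K1 _ _ _ (by omega)]; simpa using h2
          · refine ⟨3, j + (c + 2), m3, ?_, by omega, by omega, by omega⟩
            rw [K1 _ _ _ (by omega)]; simpa using h2

end Marks

section Catch
variable {A : Type*}

/-- the path ending in `f` -/
noncomputable def Pf (Y : Set ℤ → ℤ → A) (e : ℤ) (g : ℤ → A) (u : List ℕ) (τ : ℤ) : A :=
  if τ ≤ e + sg u then Y (St u) τ else g (τ - sg u)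

noncomputable def Zf {Λ : Type*} (Y : Set ℤ → ℤ → A) (e : ℤ) (g : Λ → ℤ → A)
    (Θ : (ℕ → A) → (Λ → A) → A) : ℕ → List ℕ → ℤ → A
  | 0, u, τ => Y (St u) τ
  | k + 1, u, τ => Θ (fun c => Zf Y e g Θ k (u ++ [c]) τ) (fun l => Pf Y e (g l) u τ)

theorem catch_lemma {E : A → A → Prop} (hsc : ∀ u v : A, ∃ k, HasWalk E u v k)
    (hcyc : ∀ k : ℕ, 2 ≤ k → ∃ u : A, HasWalk E u u k) (Λ : Type*) [Finite Λ] :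
    ∃ q0 q1 : A, E q0 q1 ∧ E q1 q0 ∧ ∀ f : Λ → A, ∃ J : ℕ, Even J ∧ 2 ≤ J ∧
      ∀ Θ : (ℕ → A) → (Λ → A) → A, (∀ a, Θ (fun _ => a) (fun _ => a) = a) →
        (∀ y y' f f', (∀ c, E (y c) (y' c)) → (∀ l, E (f l) (f' l)) → E (Θ y f) (Θ y' f')) →
        ∃ x : ℤ → A, x 0 = q0 ∧ (∀ j : ℤ, 0 ≤ j → j < J → E (x j) (x (j + 1))) ∧
          x J = Θ (fun c => x (J - 2 - c)) f := by
  classical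
  obtain ⟨R, Y, hloc, hedge⟩ := code_two hsc hcyc
  have hYE : ∀ u τ, E (Y (St u) τ) (Y (St u) (τ + 1)) := by
    intro u τ
    apply hedge
    · intro i hi j hj h
      exact mk_sep u i j hi hj h
    · intro t
      obtain ⟨i, j, h1, h2, h3, h4, h5⟩ := mk_cov u t
      exact ⟨i, h1, j, h2, h3, h4, h5⟩
  set q : ℤ → A := Y (St []) with hq
  have hq2 : ∀ τ τ', Even (τ - τ') → q τ = q τ' := by
    intro τ τ' h
    apply hloc
    intro i _ _
    show Even _ ↔ Even _
    simp only [Int.even_iff] at *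
    omega
  have Ylow : ∀ u (τ : ℤ), τ ≤ 1 - R → Y (St u) τ = q τ := by
    intro u τ h
    apply hloc
    intro i h1 h2
    exact K2 u _ (by omega)
  have Yhigh : ∀ u τ, sg u + 3 + R ≤ τ → Y (St u) τ = q (τ - sg u) := by
    intro u τ h
    apply hloc
    intro i h1 h2
    show mk u (τ + i) ↔ Even _
    rw [K4 u _ (by omega), show τ + i - sg u = τ - sg u + i by ring]
  have Yshift : ∀ (c : ℕ) u (τ : ℤ), 3 + R ≤ τ → Y (St (c :: u)) τ = Y (St u) (τ - (c + 2)) := by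
    intro c u τ h
    apply hloc
    intro i h1 h2
    show mk _ _ ↔ mk _ _
    rw [K1 c u _ (by omega), show τ + i - (c + 2) = τ - (c + 2) + i by ring]
  have Yapp : ∀ u v τ, τ + R ≤ 2 * (u.length : ℤ) + 1 → Y (St (u ++ v)) τ = Y (St u) τ := by
    intro u v τ h
    apply hloc
    intro i h1 h2
    exact K3 u v _ (by omega)
  refine ⟨q 0, q 1, hYE [] 0, ?_, ?_⟩
  · have := hYE [] 1
    rwa [show Y (St []) (1 + 1) = q 0 from hq2 _ _ (by norm_num)] at this
  intro f
  set e : ℤ := 2 * (R + 2) with he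
  obtain ⟨N, hN⟩ := reach_fin (reach hsc hcyc) ({q e} ∪ Set.range f)
    ((Set.finite_singleton _).union (Set.finite_range f))
  set D : ℕ := 2 * N + 2 with hD
  have hw : ∀ l, ∃ g : ℤ → A, g e = q e ∧ g (e + D) = f l ∧
      ∀ τ, e ≤ τ → τ < e + D → E (g τ) (g (τ + 1)) := by
    intro l
    obtain ⟨w, w0, w1, w2⟩ := hN D (by omega) (q e) (Or.inl rfl) (f l) (Or.inr ⟨l, rfl⟩)
    refine ⟨fun τ => w (τ - e).toNat, by simp [w0], by simp [w1], ?_⟩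
    intro τ h1 h2
    have := w2 (τ - e).toNat (by omega)
    rwa [show (τ - e).toNat + 1 = (τ + 1 - e).toNat by omega] at this
  choose g ge gT gE using hw
  set T : ℤ := e + D with hT
  set M : ℕ := T.toNat + R + 2 with hM
  have Pedge : ∀ l u τ, τ + 1 - sg u ≤ T → E (Pf Y e (g l) u τ) (Pf Y e (g l) u (τ + 1)) := by
    intro l u τ h
    unfold Pf
    by_cases h1 : τ + 1 ≤ e + sg u
    · rw [if_pos (by omega), if_pos h1]; exact hYE u τ
    · rw [if_neg h1]
      by_cases h2 : τ ≤ e + sg u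
      · rw [if_pos h2, Yhigh u τ (by omega), show τ - sg u = e by omega, ← ge l,
          show τ + 1 - sg u = e + 1 by omega]
        exact gE l e le_rfl (by omega)
      · rw [if_neg h2, show τ + 1 - sg u = τ - sg u + 1 by ring]
        exact gE l _ (by omega) (by omega)
  have Pshift : ∀ l (c : ℕ) u (τ : ℤ), 3 + R ≤ τ → Pf Y e (g l) (c :: u) τ = Pf Y e (g l) u (τ - (c + 2)) := by
    intro l c u τ h
    have hsg : sg (c :: u) = c + 2 + sg u := rfl
    unfold Pf
    rw [hsg]
    by_cases h1 : τ ≤ e + (c + 2 + sg u)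
    · rw [if_pos h1, if_pos (by omega), Yshift c u τ h]
    · rw [if_neg h1, if_neg (by omega), show τ - (c + 2 + sg u) = τ - (c + 2) - sg u by ring]
  refine ⟨(T + 2 * R).toNat, ?_, by omega, ?_⟩
  · rw [Nat.even_iff]; omega
  intro Θ hid hco
  have Zwalk : ∀ k u τ, τ + 1 ≤ T → E (Zf Y e g Θ k u τ) (Zf Y e g Θ k u (τ + 1)) := by
    intro k
    induction k with
    | zero => intro u τ _; exact hYE u τ
    | succ k ih =>
      intro u τ h
      simp only [Zf]
      apply hco
      · intro c; exact ih _ _ h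
      · intro l
        have := sg_ge u
        exact Pedge l u τ (by omega)
  have Zlow : ∀ k u (τ : ℤ), τ ≤ 1 - R → Zf Y e g Θ k u τ = q τ := by
    intro k
    induction k with
    | zero => intro u τ h; exact Ylow u τ h
    | succ k ih =>
      intro u τ h
      simp only [Zf]
      have e1 : (fun c => Zf Y e g Θ k (u ++ [c]) τ) = fun _ => q τ := by
        funext c; exact ih _ _ h
      have e2 : (fun l => Pf Y e (g l) u τ) = fun _ => q τ := by
        funext l
        have := sg_ge u
        unfold Pf
        rw [if_pos (by omega), Ylow u τ h]
      rw [e1, e2, hid]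
  have Zmain : ∀ k (c : ℕ) u, u.length + 1 + k = M →
      E (Zf Y e g Θ k (c :: u) (T - 1)) (Zf Y e g Θ (k + 1) u (T - (c + 2))) := by
    intro k
    induction k with
    | zero =>
      intro c u hu
      have hs := sg_ge u
      have e3 : Zf Y e g Θ (0 + 1) u (T - (c + 2)) = Y (St u) (T - (c + 2)) := by
        simp only [Zf]
        have e1 : (fun c' => Y (St (u ++ [c'])) (T - (c + 2))) =
            fun _ => Y (St u) (T - (c + 2)) := by
          funext c'
          exact Yapp _ _ _ (by omega)
        have e2 : (fun l => Pf Y e (g l) u (T - (c + 2))) = fun _ => Y (St u) (T - (c + 2)) := by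
          funext l
          unfold Pf
          rw [if_pos (by omega)]
        rw [e1, e2, hid]
      rw [e3]
      simp only [Zf]
      rw [Yshift c u (T - 1) (by omega)]
      have := hYE u (T - 1 - (c + 2))
      rwa [show T - 1 - ((c : ℤ) + 2) + 1 = T - (c + 2) by ring] at this
    | succ k ih =>
      intro c u hu
      rw [Zf.eq_2, Zf.eq_2 (k := k + 1)]
      apply hco
      · intro c'
        exact ih c (u ++ [c']) (by simp; omega)
      · intro l
        rw [Pshift l c u (T - 1) (by omega)]
        have := sg_ge u
        have := Pedge l u (T - 1 - (c + 2)) (by omega)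
        rwa [show T - 1 - ((c : ℤ) + 2) + 1 = T - (c + 2) by ring] at this
  set X : ℤ → A := Zf Y e g Θ M [] with hX
  have hlast : E (X (T - 1)) (Θ (fun c => X (T - (c + 2))) f) := by
    have e0 : M = (M - 1) + 1 := by omega
    have : X (T - 1) = Θ (fun c => Zf Y e g Θ (M - 1) ([] ++ [c]) (T - 1))
        (fun l => Pf Y e (g l) [] (T - 1)) := by
      rw [hX, e0]; rfl
    rw [this]
    apply hco
    · intro c
      have := Zmain (M - 1) c [] (by simp; omega)
      rw [← e0] at this
      exact this
    · intro l
      have h := Pedge l [] (T - 1) (by simp [sg])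
      have : Pf Y e (g l) [] (T - 1 + 1) = f l := by
        unfold Pf
        rw [if_neg (by simp only [sg]; omega), ← gT l]
        simp [sg]
      rwa [this] at h
  have hJ : (((T + 2 * R).toNat : ℕ) : ℤ) = T + 2 * R := by omega
  rw [hJ]
  refine ⟨fun j => if j < T + 2 * R then X (j - 2 * R) else Θ (fun c => X (T - (c + 2))) f,
    ?_, ?_, ?_⟩
  · have h0 : (0 : ℤ) < T + 2 * R := by omega
    simp only [h0, if_true]
    rw [hX, Zlow _ _ _ (by omega)]
    apply hq2
    simp
  · intro j h0 hj
    simp only [hj, if_true]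
    by_cases h1 : j + 1 < T + 2 * R
    · simp only [h1, if_true]
      have := Zwalk M [] (j - 2 * R) (by omega)
      rwa [show j - 2 * (R : ℤ) + 1 = j + 1 - 2 * R by ring] at this
    · simp only [h1, if_false]
      rw [show j - 2 * (R : ℤ) = T - 1 by omega]
      exact hlast
  · simp only [lt_irrefl, if_false]
    congr 1
    funext c
    rw [if_pos (by omega)]
    congr 1
    ring

end Catch
end SLL

namespace SLL

section System
variable {A ι : Type*}

open Classical in
noncomputable def sysf (t : (ι → A) → A) (C : Set (ι × ι)) (p : ι × ι) (x : ℕ → A)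
    (f : ι ⊕ Bool → A) : ℕ → ι → A
  | 0, i => f (Sum.inl i)
  | j + 1, i => t (fun l => if l = i ∨ (i, l) ∈ C then sysf t C p x f j l
      else if (i, l) = p then x j else f (Sum.inr (decide (Odd j))))

theorem sysf_idem {t : (ι → A) → A} (hidem : ∀ x : A, t (fun _ => x) = x) (C : Set (ι × ι))
    (p : ι × ι) (a : A) (j : ℕ) : ∀ i, sysf t C p (fun _ => a) (fun _ => a) j i = a := by
  induction j with
  | zero => intro i; rfl
  | succ j ih =>
    intro i
    simp only [sysf, ih, ite_self, hidem]

theorem sysf_comp {E : A → A → Prop} {t : (ι → A) → A}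
    (hcomp : ∀ u v : ι → A, (∀ i, E (u i) (v i)) → E (t u) (t v)) (C : Set (ι × ι))
    (p : ι × ι) {x x' : ℕ → A} {f f' : ι ⊕ Bool → A} (hx : ∀ j, E (x j) (x' j))
    (hf : ∀ l, E (f l) (f' l)) (j : ℕ) : ∀ i, E (sysf t C p x f j i) (sysf t C p x' f' j i) := by
  induction j with
  | zero => intro i; exact hf _
  | succ j ih =>
    intro i
    simp only [sysf]
    apply hcomp
    intro l
    split_ifs
    · exact ih l
    · exact hx j
    · exact hf _

theorem sysf_congr {t : (ι → A) → A} (C : Set (ι × ι))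
    (p : ι × ι) {x x' : ℕ → A} {f : ι ⊕ Bool → A} (k : ℕ) (hx : ∀ j < k, x j = x' j) :
    ∀ i, sysf t C p x f k i = sysf t C p x' f k i := by
  induction k with
  | zero => intro i; rfl
  | succ j ih =>
    intro i
    simp only [sysf]
    congr 1
    funext l
    rw [ih (fun j hj => hx j (by omega)) l, hx j (by omega)]

theorem sysf_congr' {t : (ι → A) → A} (C : Set (ι × ι))
    (p : ι × ι) {x x' : ℕ → A} {f : ι ⊕ Bool → A} (k : ℕ) (hx : ∀ j < k, x j = x' j)
    (i : ι) (hi : i ≠ p.1) :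
    sysf t C p x f (k + 1) i = sysf t C p x' f (k + 1) i := by
  simp only [sysf]
  congr 1
  funext l
  have : (i, l) ≠ p := fun h => hi (by rw [← h])
  simp only [this, if_false]
  rw [sysf_congr C p k hx l]

open Classical in
theorem local_loop [Finite ι] (t : (ι → A) → A) (E : A → A → Prop)
    (hidem : ∀ x : A, t (fun _ => x) = x)
    (hcomp : ∀ u v : ι → A, (∀ i, E (u i) (v i)) → E (t u) (t v))
    (hsc : ∀ u v : A, ∃ k, HasWalk E u v k)
    (hcyc : ∀ k : ℕ, 2 ≤ k → ∃ u : A, HasWalk E u u k) [Nonempty ι]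
    (α : ι → ι → A) (hα : ∀ i, E (α i i) (t (α i))) : ∃ x : A, E x x := by
  obtain ⟨q0, q1, h01, h10, hcatch⟩ := catch_lemma (E := E) hsc hcyc (ι ⊕ Bool)
  -- initial system
  have start_sys : ∃ a : ι → A, ∀ i, E (a i) (t (fun l => if l = i then a l else q0)) := by
    obtain ⟨N, hN⟩ := reach_fin (reach hsc hcyc)
      ({q0} ∪ Set.range (fun p : ι × ι => α p.1 p.2))
      ((Set.finite_singleton _).union (Set.finite_range _))
    have hw : ∀ i l, HasWalk E (α i l) q0 N := fun i l =>
      hN N le_rfl _ (Or.inr ⟨(i, l), rfl⟩) _ (Or.inl rfl)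
    choose w w0 wN we using hw
    let b : ι → ℕ → A := fun i j => Nat.rec (α i i)
      (fun j z => t (fun l => if l = i then z else w i l j)) j
    have b0 : ∀ i, b i 0 = α i i := fun i => rfl
    have bs : ∀ i j, b i (j + 1) = t (fun l => if l = i then b i j else w i l j) := fun i j => rfl
    have be : ∀ i j, j ≤ N → E (b i j) (b i (j + 1)) := by
      intro i j
      induction j with
      | zero =>
        intro _
        rw [bs, b0]
        have : (fun l => if l = i then α i i else w i l 0) = α i := by
          funext l
          by_cases h : l = i
          · subst h; simp
          · simp [h, w0]
        rw [this]
        exact hα i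
      | succ j ih =>
        intro hj
        rw [bs i (j + 1)]
        nth_rewrite 1 [bs i j]
        apply hcomp
        intro l
        by_cases h : l = i
        · simp only [h, if_true]; exact ih (by omega)
        · simp only [h, if_false]; exact we i l j (by omega)
    refine ⟨fun i => b i N, fun i => ?_⟩
    have h := be i N le_rfl
    rw [bs] at h
    have : (fun l => if l = i then b i N else w i l N) = fun l => if l = i then b l N else q0 := by
      funext l
      by_cases h : l = i
      · subst h; simp
      · simp [h, wN]
    rwa [this] at h
  -- catching slots one by one
  have main : ∀ C : Set (ι × ι), C.Finite →
      ∃ a : ι → A, ∀ i, E (a i) (t (fun l => if l = i ∨ (i, l) ∈ C then a l else q0)) := by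
    intro C hC
    induction C, hC using Set.Finite.induction_on with
    | empty => simpa using start_sys
    | @insert p C hp hC ih =>
      obtain ⟨a, ha⟩ := ih
      by_cases hpp : p.2 = p.1
      · refine ⟨a, fun i => ?_⟩
        have : ∀ l, (l = i ∨ (i, l) ∈ insert p C) ↔ (l = i ∨ (i, l) ∈ C) := by
          intro l
          rw [Set.mem_insert_iff]
          constructor
          · rintro (h | h | h)
            · exact Or.inl h
            · left; rw [← h] at hpp; exact hpp
            · exact Or.inr h
          · tauto
        simp only [this]
        exact ha i
      · let f : ι ⊕ Bool → A := Sum.elim a (fun b => if b then q1 else q0)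
        obtain ⟨J, hJe, hJ2, hJ⟩ := hcatch f
        obtain ⟨x, x0, xe, xJ⟩ := hJ
          (fun y f => sysf t C p (fun j => y (J - 2 - j)) f J p.2)
          (fun a => sysf_idem hidem C p a J p.2)
          (fun y y' f f' hy hf => sysf_comp hcomp C p (fun j => hy _) hf J p.2)
        set X : ℕ → A := fun j => x j with hX
        have hxJ : X J = sysf t C p X f J p.2 := by
          show x J = _
          rw [xJ]
          show sysf t C p _ f J p.2 = _
          obtain ⟨k, rfl⟩ : ∃ k, J = k + 1 := ⟨J - 1, by omega⟩
          apply sysf_congr' C p k _ _ hpp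
          intro j hj
          show x _ = x _
          congr 1
          omega
        have hedge : ∀ j, j ≤ J → ∀ i, E (sysf t C p X f j i) (sysf t C p X f (j + 1) i) := by
          intro j
          induction j with
          | zero =>
            intro _ i
            have : sysf t C p X f (0 + 1) i =
                t (fun l => if l = i ∨ (i, l) ∈ C then a l else q0) := by
              simp only [sysf]
              congr 1
              funext l
              split_ifs
              · rfl
              · simp [hX, x0]
              · simp [f]
            rw [this]
            exact ha i
          | succ j ih =>
            intro hj i
            rw [sysf.eq_2, sysf.eq_2 (j := j + 1)]
            apply hcomp
            intro l
            split_ifs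
            · exact ih (by omega) l
            · have := xe j (by omega) (by omega)
              simpa [hX] using this
            · by_cases hodd : Odd j
              · have h2 : ¬ Odd (j + 1) := by
                  rw [Nat.odd_iff] at *; omega
                simpa [f, hodd, h2] using h10
              · have h2 : Odd (j + 1) := by
                  rw [Nat.odd_iff] at *; omega
                simpa [f, hodd, h2] using h01
        refine ⟨sysf t C p X f J, fun i => ?_⟩
        have h := hedge J le_rfl i
        have e : sysf t C p X f (J + 1) i = t (fun l => if l = i ∨ (i, l) ∈ insert p C
            then sysf t C p X f J l else q0) := by
          rw [sysf.eq_2]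
          congr 1
          funext l
          have hno : ¬ Odd J := by rw [Nat.not_odd_iff_even]; exact hJe
          by_cases h1 : l = i ∨ (i, l) ∈ C
          · have h2 : l = i ∨ (i, l) ∈ insert p C := by
              rw [Set.mem_insert_iff]; tauto
            rw [if_pos h1, if_pos h2]
          · rw [if_neg h1]
            by_cases h3 : (i, l) = p
            · have h2 : l = i ∨ (i, l) ∈ insert p C := Or.inr (Or.inl h3)
              have h4 : p.2 = l := by rw [← h3]
              rw [if_pos h3, if_pos h2, hxJ, h4]
            · have h2 : ¬ (l = i ∨ (i, l) ∈ insert p C) := by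
                rw [Set.mem_insert_iff]; tauto
              rw [if_neg h3, if_neg h2]
              simp [f, hno]
        rw [e] at h
        convert h
  obtain ⟨a, ha⟩ := main Set.univ Set.finite_univ
  simp only [Set.mem_univ, or_true, if_true] at ha
  refine ⟨t a, ?_⟩
  have := hcomp a (fun _ => t a) ha
  rwa [hidem] at this

end System

section Star
variable {A : Type*} {n : ℕ}

def WT (n : ℕ) : ℕ → Type
  | 0 => Unit
  | K + 1 => Fin n × WT n K

theorem WT_finite (n : ℕ) : ∀ K, Finite (WT n K)
  | 0 => inferInstanceAs (Finite Unit)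
  | K + 1 => by
    haveI := WT_finite n K
    exact inferInstanceAs (Finite (Fin n × WT n K))

theorem WT_nonempty (n : ℕ) (hn : 0 < n) : ∀ K, Nonempty (WT n K)
  | 0 => ⟨()⟩
  | K + 1 => by
    obtain ⟨w⟩ := WT_nonempty n hn K
    exact ⟨(⟨0, hn⟩, w)⟩

def star (t : (Fin n → A) → A) : (K : ℕ) → (WT n K → A) → A
  | 0, x => x ()
  | K + 1, x => t (fun i => star t K (fun w => x (i, w)))

theorem star_idem {t : (Fin n → A) → A} (hidem : ∀ x : A, t (fun _ => x) = x) (K : ℕ) (a : A) :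
    star t K (fun _ => a) = a := by
  induction K with
  | zero => rfl
  | succ K ih => simp only [star, ih, hidem]

theorem star_comp {E : A → A → Prop} {t : (Fin n → A) → A}
    (hcomp : ∀ u v : Fin n → A, (∀ i, E (u i) (v i)) → E (t u) (t v)) (K : ℕ) :
    ∀ u v : WT n K → A, (∀ i, E (u i) (v i)) → E (star t K u) (star t K v) := by
  induction K with
  | zero => intro u v h; exact h _
  | succ K ih =>
    intro u v h
    simp only [star]
    exact hcomp _ _ (fun i => ih _ _ (fun w => h _))

theorem star_reach {t : (Fin n → A) → A} (hidem : ∀ x : A, t (fun _ => x) = x) (hn : 0 < n)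
    (a : Fin n → A) (K : ℕ) : ∀ (b : Fin n → A) (k : Fin n → ℕ),
    (∀ i, HasWalk (Pdig t i) (a i) (b i) (k i)) → ∑ i, k i ≤ K →
    ∀ w : WT n K, ∃ (i : Fin n) (x : WT n K → A), x w = a i ∧ star t K x = b i := by
  have zero_case : ∀ (K : ℕ) (b : Fin n → A) (k : Fin n → ℕ),
      (∀ i, HasWalk (Pdig t i) (a i) (b i) (k i)) → (∃ i, k i = 0) →
      ∀ w : WT n K, ∃ (i : Fin n) (x : WT n K → A), x w = a i ∧ star t K x = b i := by
    rintro K b k h ⟨i, hi⟩ w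
    obtain ⟨p, p0, p1, -⟩ := h i
    rw [hi, p0] at p1
    exact ⟨i, fun _ => a i, rfl, by rw [star_idem hidem, p1]⟩
  induction K with
  | zero =>
    intro b k h hk w
    refine zero_case 0 b k h ⟨⟨0, hn⟩, ?_⟩ w
    have := Finset.single_le_sum (f := k) (fun i _ => Nat.zero_le _)
      (Finset.mem_univ (⟨0, hn⟩ : Fin n))
    omega
  | succ K ih =>
    intro b k h hk w
    by_cases h0 : ∃ i, k i = 0
    · exact zero_case (K + 1) b k h h0 w
    obtain ⟨j, w'⟩ := w
    have hj : k j ≠ 0 := fun e => h0 ⟨j, e⟩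
    obtain ⟨p, p0, p1, pe⟩ := h j
    obtain ⟨y, yj, ty⟩ := pe (k j - 1) (by omega)
    rw [show k j - 1 + 1 = k j by omega, p1] at ty
    have hlt : ∑ i, Function.update k j (k j - 1) i < ∑ i, k i := by
      apply Finset.sum_lt_sum
      · intro i _
        by_cases e : i = j
        · subst e; simp
        · simp [e]
      · exact ⟨j, Finset.mem_univ _, by simp; omega⟩
    obtain ⟨i, x, hx, hs⟩ := ih (Function.update b j (p (k j - 1)))
      (Function.update k j (k j - 1)) (by
        intro i
        by_cases e : i = j
        · subst e
          simp only [Function.update_self]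
          exact ⟨p, p0, rfl, fun m hm => pe m (by omega)⟩
        · simp only [Function.update_of_ne e]
          exact h i) (by omega) w'
    by_cases e : i = j
    · subst e
      rw [Function.update_self] at hs
      refine ⟨i, fun v => if v.1 = i then x v.2 else y v.1, by simp [hx], ?_⟩
      rw [← ty]
      simp only [star]
      congr 1
      funext l
      by_cases hl : l = i
      · subst hl; simp only [if_true]; rw [hs, yj]
      · simp only [hl, if_false]; exact star_idem hidem K _
    · rw [Function.update_of_ne e] at hs
      refine ⟨i, fun v => if v.1 = j then x v.2 else b i, by simp [hx], ?_⟩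
      have : (fun l => star t K (fun w => if (l, w).1 = j then x (l, w).2 else b i)) =
          fun _ => b i := by
        funext l
        by_cases hl : l = j
        · subst hl; simp only [if_true]; exact hs
        · simp only [hl, if_false]; exact star_idem hidem K _
      show t _ = _
      rw [this, hidem]

end Star

end SLL

/-- Strong local loop lemma: let `t` be idempotent and compatible with a strongly connected
digraph `G` containing closed walks of all lengths `≥ 2`. If there are vertices `aᵢ, bᵢ` such
that `aᵢ → bᵢ` is a `G`-edge and `bᵢ` is reachable from `aᵢ` in `P(t, i)`, then `G` has a
loop. -/
theorem strong_local_loop_lemma {A : Type*} {n : ℕ} (t : (Fin n → A) → A)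
    (E : A → A → Prop)
    (hidem : ∀ x : A, t (fun _ => x) = x)
    (hcomp : ∀ u v : Fin n → A, (∀ i, E (u i) (v i)) → E (t u) (t v))
    (hsc : ∀ u v : A, ∃ k, HasWalk E u v k)
    (hcyc : ∀ k : ℕ, 2 ≤ k → ∃ u : A, HasWalk E u u k)
    (a b : Fin n → A)
    (hab : ∀ i : Fin n, E (a i) (b i) ∧ ∃ k, HasWalk (Pdig t i) (a i) (b i) k) :
    ∃ x : A, E x x := by
  rcases Nat.eq_zero_or_pos n with hn | hn
  · subst hn
    obtain ⟨u, -⟩ := hcyc 2 le_rfl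
    exact ⟨t (fun _ => u), hcomp _ _ (fun i => i.elim0)⟩
  · choose hE k hk using hab
    haveI := SLL.WT_finite n (∑ i, k i)
    haveI := SLL.WT_nonempty n hn (∑ i, k i)
    have hx : ∀ w : SLL.WT n (∑ i, k i), ∃ x : SLL.WT n (∑ i, k i) → A,
        E (x w) (SLL.star t (∑ i, k i) x) := by
      intro w
      obtain ⟨i, x, h1, h2⟩ := SLL.star_reach hidem hn a _ b k hk le_rfl w
      exact ⟨x, by rw [h1, h2]; exact hE i⟩
    choose α hα using hx
    exact SLL.local_loop (SLL.star t (∑ i, k i)) E (SLL.star_idem hidem _)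
      (SLL.star_comp hcomp _) hsc hcyc α hα
end
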